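/- Let f₀ := x¹⁰ + a₁x⁹ + a₂x⁸ + a₃x⁷ + a₄x⁶ + a₅x⁵ + a₆x⁴ + a₇x³ + a₈x² + a₉x + a₁₀, g₀ := x² − 6x + a₁₁, g₁ := x³ + a₁₂x² + a₁₃x + a₁₄, with a₁,…,a₁₄ the explicit rational functions in α given in the context, and set f(x, α, t) := f₀³·(x − 3) − t·g₀⁸·g₁⁴·x. For every rational number c with c ∉ {−4, −1, 2}, the specialized polynomial f(x, c, t), a polynomial of degree 31 in x over ℚ(t), has Galois group over ℚ(t) isomorphic to PSL₅(𝔽₂), the projective special linear group of degree 5 over the field with two elements. -/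

import Mathlib

/-!
Statement 4: for every rational number `c ∉ {−4, −1, 2}`, the specialized polynomial
`f(x, c, t)`, of degree 31 in `x` over `ℚ(t)`, has Galois group `PSL₅(𝔽₂)` over `ℚ(t)`.
We model `ℚ(t)` as `RatFunc ℚ`, with `t = RatFunc.X` a transcendental over `ℚ`; the
specialization `α = c` is realized via the constant embedding `RatFunc.C : ℚ →+* RatFunc ℚ`.
-/

open Polynomial

namespace PSL52Family

/-- The coefficient `a₁` as a rational function of `α`. -/
noncomputable def a1 {F : Type*} [Field F] (α : F) : F :=
  2 * (α^4 - 37/2*α^3 - 3*α^2 - 109/2*α + 91) / ((α - 2) * (α + 1)^2)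

/-- The coefficient `a₂` as a rational function of `α`. -/
noncomputable def a2 {F : Type*} [Field F] (α : F) : F :=
  -12 * ((α^2 - 5/2*α - 8) * (α^3 + 10*α^2 + 17*α + 44)) / ((α - 2) * (α + 1) * (α + 4))

/-- The coefficient `a₃` as a rational function of `α`. -/
noncomputable def a3 {F : Type*} [Field F] (α : F) : F :=
  -8 * (α^6 - 93/2*α^5 - 261/2*α^4 - 1343/2*α^3 - 507/2*α^2 - 963*α + 3076) /
    ((α - 2) * (α + 1) * (α + 4))

/-- The coefficient `a₄` as a rational function of `α`. -/
noncomputable def a4 {F : Type*} [Field F] (α : F) : F :=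
  62 * (α^9 + 159/31*α^8 - 1410/31*α^7 - 3834/31*α^6 - 987*α^5 - 52905/31*α^4 - 72480/31*α^3
      - 50196/31*α^2 + 256224/31*α - 56384/31) / ((α - 2)^2 * (α + 1) * (α + 4)^2)

/-- The coefficient `a₅` as a rational function of `α`. -/
noncomputable def a5 {F : Type*} [Field F] (α : F) : F :=
  -36 * (α^9 + 241/6*α^8 + 226/3*α^7 + 521/3*α^6 + 1483/3*α^5 - 19319/6*α^4 - 12872/3*α^3
      - 58186/3*α^2 - 51344/3*α + 30944/3) / ((α - 2)^2 * (α + 4)^2)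

/-- The coefficient `a₆` as a rational function of `α`. -/
noncomputable def a6 {F : Type*} [Field F] (α : F) : F :=
  -92 * ((α + 1)^2 * (α^7 - 337/23*α^6 - 237/23*α^5 - 2075/23*α^4 - 7724/23*α^3 + 2166/23*α^2
      - 35740/23*α + 44048/23)) / ((α - 2)^2 * (α + 4))

/-- The coefficient `a₇` as a rational function of `α`. -/
noncomputable def a7 {F : Type*} [Field F] (α : F) : F :=
  152 * ((α + 1)^3 * (α^7 + 5/38*α^6 - 489/38*α^5 - 407/38*α^4 - 4367/38*α^3 - 3768/19*α^2
      - 2882/19*α - 23192/19)) / ((α - 2)^2 * (α + 4))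

/-- The coefficient `a₈` as a rational function of `α`. -/
noncomputable def a8 {F : Type*} [Field F] (α : F) : F :=
  -87 * ((α + 1)^4 * (α^6 + 96/29*α^5 + 66/29*α^4 + 532/29*α^3 - 3/29*α^2 + 300/29*α + 4724/29)) /
    ((α - 2)^2)

/-- The coefficient `a₉` as a rational function of `α`. -/
noncomputable def a9 {F : Type*} [Field F] (α : F) : F :=
  18 * ((α + 1)^6 * (α^5 + 53/6*α^4 + 70/3*α^3 + 111/2*α^2 + 376/3*α + 94/3)) / ((α - 2)^2)

/-- The coefficient `a₁₀` as a rational function of `α`. -/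
noncomputable def a10 {F : Type*} [Field F] (α : F) : F :=
  -6 * ((α + 1)^9 * (α + 4)) / (α - 2)

/-- The coefficient `a₁₁` as a rational function of `α`. -/
noncomputable def a11 {F : Type*} [Field F] (α : F) : F := -(α + 1)^2

/-- The coefficient `a₁₂` as a rational function of `α`. -/
noncomputable def a12 {F : Type*} [Field F] (α : F) : F :=
  (α + 1) * (α^2 - 16*α - 8) / ((α - 2) * (α + 4))

/-- The coefficient `a₁₃` as a rational function of `α`. -/
noncomputable def a13 {F : Type*} [Field F] (α : F) : F := -3*(α + 1)^2

/-- The coefficient `a₁₄` as a rational function of `α`. -/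
noncomputable def a14 {F : Type*} [Field F] (α : F) : F := (α + 1)^3 * (α + 4) / (α - 2)

/-- `f₀ = x¹⁰ + a₁x⁹ + ⋯ + a₁₀`. -/
noncomputable def f0 {F : Type*} [Field F] (α : F) : Polynomial F :=
  X^10 + C (a1 α) * X^9 + C (a2 α) * X^8 + C (a3 α) * X^7 + C (a4 α) * X^6 + C (a5 α) * X^5
    + C (a6 α) * X^4 + C (a7 α) * X^3 + C (a8 α) * X^2 + C (a9 α) * X + C (a10 α)

/-- `g₀ = x² − 6x + a₁₁`. -/
noncomputable def g0 {F : Type*} [Field F] (α : F) : Polynomial F :=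
  X^2 - 6*X + C (a11 α)

/-- `g₁ = x³ + a₁₂x² + a₁₃x + a₁₄`. -/
noncomputable def g1 {F : Type*} [Field F] (α : F) : Polynomial F :=
  X^3 + C (a12 α) * X^2 + C (a13 α) * X + C (a14 α)

/-- The family `f(x, α, t) = f₀³·(x − 3) − t·g₀⁸·g₁⁴·x`, as a polynomial in `x` over `F`,
where `α, t : F`. -/
noncomputable def fFamily {F : Type*} [Field F] (α t : F) : Polynomial F :=
  (f0 α)^3 * (X - 3) - C t * (g0 α)^8 * (g1 α)^4 * X

/-- The value at `x` of the polynomial with coefficient list `l`. -/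
def horner {R : Type*} [Semiring R] (l : List R) (x : R) : R :=
  l.foldr (fun c r => c + x * r) 0

/-- The value of a bivariate polynomial given by nested integer lists, the inner lists being
polynomials in `γ`; integers are sent to `R` by `f`. -/
def eval2 {R : Type*} [Semiring R] (f : ℤ → R) (L : List (List ℤ)) (γ x : R) : R :=
  horner (L.map fun l => horner (l.map f) γ) x

/-- The value of a trivariate polynomial given by nested integer lists. -/
def eval3 {R : Type*} [Semiring R] (f : ℤ → R) (L : List (List (List ℤ))) (γ y x : R) : R :=
  horner (L.map fun M => eval2 f M γ y) x

/-- One quintic factor of `f₀`; the entries are coefficient lists in `γ`. -/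
def hList : List (List ℤ) :=
  [[0, 0, 2, 4, 2], [-4, -4, 3, -4, -7], [-8, 8, 0, -8, 8], [0, 12, -6, 12, -2], [0, 0, -2, -4,
  -2], [0, 0, -1, 0, 1]]

/-- The other quintic factor of `f₀`. -/
def kList : List (List ℤ) :=
  [[0, 0, 1, 0, -1], [0, 4, 8, 3, 8, 9], [0, 12, 6, 0, 26, -12], [0, 16, -24, 34, -24, -2], [4,
  -4, 5, 0, -9, 4], [0, 0, 0, -1, 0, 1]]

/-- The quadratic `g₀`. -/
def qList : List (List ℤ) :=
  [[0, -1], [-2], [0, 1]]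

/-- The cubic `g₁`. -/
def cList : List (List ℤ) :=
  [[1, 2, 1], [3, 0, -3], [1, -6, 1], [-1, 0, 1]]

/-- The linear polynomial `x - 3`. -/
def lList : List (List ℤ) :=
  [[-1], [0, 1]]

/-- The factor `hList` at the dual parameter. -/
def hDual : List (List ℤ) :=
  [[2, -4, 2], [-4, 3, -18, 3], [0, -8, 0, -24], [4, 2, 0, 2, -8], [-2, 4, -2], [0, -1, 2, -1]]

/-- The factor `kList` at the dual parameter. -/
def kDual : List (List ℤ) :=
  [[0, 1, -1, -1, 1], [8, -13, 23, -23, 5], [8, 6, -14, 34, -42, 8], [0, 18, -14, 14, 6, -24],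
  [0, 5, 11, -5, 21], [0, -1, 3, -3, 1]]

/-- The factor `qList` at the dual parameter. -/
def qDual : List (List ℤ) :=
  [[-1, 1], [-2, -2], [1, -1]]

/-- The factor `cList` at the dual parameter. -/
def cDual : List (List ℤ) :=
  [[1], [0, 3], [-1, 0, 2], [0, -1]]

/-- The factor `lList` at the dual parameter. -/
def lDual : List (List ℤ) :=
  [[-1, -1], [1, -1]]

set_option maxRecDepth 100000 in
/-- The incidence form, of bidegree `(15, 15)`, indexed by powers of `x`, `y` and `γ`. -/
def incList : List (List (List ℤ)) :=
  [[[], [0, 0, 0, 0, -32, -64, 64, 192, 0, -192, -64, 64, 32], [0, 0, 0, 0, 0, -384, -768, 768,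
  2304, 0, -2304, -768, 768, 384], [0, 0, 0, 0, 128, 256, -2240, -4736, 3968, 12672, 256, -12160,
  -4096, 3968, 1984], [0, 0, 0, 0, 0, 1280, 2560, -8320, -19200, 11520, 42240, 2560, -37120,
  -12800, 11520, 5760], [0, 0, 0, 0, -192, -384, 5760, 11904, -21024, -53952, 20160, 94272,
  10944, -72384, -25920, 20544, 10272], [0, 0, 0, 0, 0, -1536, -3072, 15360, 33792, -36096,
  -105984, 19968, 145920, 26112, -93696, -35328, 23040, 11520], [0, 0, 0, 0, 128, 256, -5248,
  -10752, 26496, 63744, -40704, -145152, 5760, 156672, 38016, -80640, -32384, 15872, 7936], [0,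
  0, 0, 0, 0, 768, 1536, -9984, -21504, 29952, 81408, -27648, -136704, -11520, 113664, 34560,
  -44544, -19200, 6144, 3072], [0, 0, 0, 0, -32, -64, 1856, 3776, -11456, -26688, 21312, 69312,
  -8160, -85632, -16512, 52608, 19136, -14336, -6656, 1024, 512], [0, 0, 0, 0, 0, -128, -256,
  2304, 4864, -7936, -20736, 8448, 37632, 2176, -33280, -9728, 13824, 5888, -2048, -1024], [0, 0,
  0, 0, 0, 0, -192, -384, 1536, 3456, -3072, -9600, 1152, 11904, 2496, -6912, -2688, 1536, 768],
  [0, 0, 0, 0, 0, 0, 0, -128, -256, 512, 1280, -512, -2304, -256, 1792, 640, -512, -256], [0, 0,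
  0, 0, 0, 0, 0, 0, -32, -64, 64, 192, 0, -192, -64, 64, 32], [], []], [[0, 0, 0, -8, -32, -16,
  96, 136, -64, -224, -64, 136, 96, -16, -32, -8], [0, 0, 0, -144, -724, -400, 1560, 1632, -188,
  -800, -1520, -1232, 948, 1200, -40, -256, -36], [0, 0, 0, 480, -272, -7382, -3608, 17620, 9144,
  -13482, -2224, 1400, -8032, 1142, 5832, 276, -840, -54], [0, 0, 0, 1168, 9656, 8204, -39171,
  -22748, 84362, 17072, -96005, 7096, 48708, -23860, -8957, 14484, 1434, -1416, -27], [0, 0, 0,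
  -808, 9712, 68024, 66936, -131528, -83968, 239672, -38584, -363896, 54576, 226664, -27128,
  -40600, 19680, 2472, -1224], [0, 0, 0, -1824, -13260, 29940, 255078, 258000, -285168, -163692,
  477450, -282192, -904284, 119388, 543738, 26448, -75048, 14364, 1494, -432], [0, 0, 0, 512,
  -12896, -75038, 28408, 583764, 598408, -392242, -104832, 757336, -702864, -1570018, 70584,
  767252, 117352, -71182, 5840, -384], [0, 0, 0, 928, 6800, -35464, -217353, -64492, 851950,
  873308, -336791, 219784, 1023956, -960944, -1894727, -142652, 633806, 139484, -34297, 2816,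
  -576], [0, 0, 0, -216, 4736, 29168, -42832, -363304, -223488, 797760, 788784, -186024, 599808,
  1146288, -717552, -1497432, -284288, 279328, 69904, -8960, 1536], [0, 0, 0, -80, -1388, 9176,
  60604, -7456, -359148, -280024, 476556, 404752, -96740, 650024, 946676, -212096, -685508,
  -182568, 54596, 11488, -2432], [0, 0, 0, 32, -144, -3346, 6904, 65916, 32456, -209102, -181456,
  172264, 65472, -98510, 344344, 475580, 32264, -147218, -38720, 6528, 1024], [0, 0, 0, -48, -72,
  -132, -4149, -1204, 35462, 29288, -71827, -64056, 31308, -43796, -81515, 68380, 106390, 14640,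
  -15789, -3072, 192], [0, 0, 0, 8, -80, -152, 312, -1816, -3136, 9448, 11784, -10600, -5008,
  10488, -12984, -17800, 8224, 11192, 888, -768], [0, 0, 0, 0, 12, -60, -122, 368, -104, -1308,
  794, 1552, -1268, 460, 1658, -1872, -1520, 908, 550, -48], [0, 0, 0, 0, 0, 6, -24, -36, 120,
  42, -192, 72, 48, -198, 168, 156, -168, -42, 48], [0, 0, 0, 0, 0, 0, 1, -4, 2, 12, -17, -8, 28,
  -8, -17, 12, 2, -4, 1]], [[0, 0, 0, -96, -192, 384, 960, -480, -1920, 0, 1920, 480, -960, -384,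
  192, 96], [0, 0, 0, -896, -1800, 3984, 7792, -1072, -9072, -13360, -2224, 20112, 10184, -10400,
  -5568, 1632, 688], [0, 0, 2240, 12320, 2912, -18664, 55152, 48896, -103952, -63208, -14496,
  -32224, 96640, 79880, -42896, -28992, 4400, 1992], [0, 0, 2176, 41504, 151600, 74752, -87220,
  329880, 142912, -742744, -241332, 131056, -221968, 240048, 323460, -77736, -72544, 3240, 2916],
  [0, 0, -4544, 192, 259440, 816376, 415896, -117328, 1369904, 296632, -2564840, -489776, 629712,
  -890968, 197640, 735824, -36720, -90968, -4344, 2160], [0, 0, -3072, -62112, -119544, 821896,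
  2498864, 1223024, 452856, 4197448, 841792, -5063792, -85840, 1635816, -2110272, -453408,
  931528, 68488, -47664, -8064, 648], [0, 0, 3712, -5696, -297616, -675600, 1462248, 4642896,
  1913984, 1995856, 8791768, 2177776, -5896656, 2090384, 3290648, -2819792, -1357728, 587056,
  88488, 2512, -3456], [0, 0, 256, 30656, 50336, -721784, -1792308, 1391624, 5090096, 783584,
  2861180, 11526800, 2813120, -4298104, 4912324, 4848552, -1866672, -1390448, 113396, 18816,
  7968], [0, 0, -1664, -7776, 88032, 237072, -973040, -2661312, 587680, 2933776, -2180272,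
  1308864, 8687392, 711344, -2897104, 4922944, 4372832, -343248, -597264, -23776, -8704], [0, 0,
  1024, -3648, -32760, 127424, 469968, -667024, -2160992, 331904, 814288, -3429136, -323896,
  3542416, -1691456, -2395552, 2255008, 2048880, 144032, -79552, 496], [0, 0, 192, 5664, 4352,
  -52648, 92256, 491488, -163408, -865512, 678960, 378304, -1822816, -44472, 1006336, -1434400,
  -1259728, 438344, 418224, 34656, -2944], [0, 0, -384, -1504, 6704, 10352, -58620, -5016,
  230464, -53880, -235292, 446864, 176080, -461088, 238060, 297960, -414688, -269528, 56236,
  35840, 1440], [0, 0, 64, -512, -2704, 4984, 12440, -30736, -22096, 58424, -44008, -66160,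
  117200, 3368, -80888, 91408, 41232, -66776, -22008, 6000, 768], [0, 0, 0, 96, -264, -1752,
  2448, 6480, -8168, -3096, 13728, -13712, -7168, 19240, -10432, -7584, 15528, 392, -5744, -64,
  72], [0, 0, 0, 0, 48, -96, -440, 720, 736, -1920, 920, 1584, -3152, 1056, 2168, -2256, 64, 960,
  -344, -48], [0, 0, 0, 0, 0, 8, -28, -8, 144, -144, -172, 368, -64, -280, 204, 24, -80, 32,
  -4]], [[0, 0, 0, -464, 128, 3040, -384, -7984, 256, 10816, 256, -7984, -384, 3040, 128, -464],
  [0, 0, 624, 368, 3228, 12080, -992, -28048, -47392, 6000, 109376, 24832, -96244, -18080, 35152,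
  2848, -3752], [0, 1664, 25920, 59968, -24704, 23316, 132832, -328856, -261344, 83452, -12224,
  543280, 265600, -521332, -146528, 150312, 20448, -11804], [0, -1280, 28448, 304320, 497280,
  -333880, 87418, 587408, -2521868, -1096904, 1473790, -335680, 1717880, 1366552, -1571530,
  -556048, 306708, 65512, -18126], [0, -5504, -71104, 69840, 1524464, 1804400, -1832280, 620968,
  1252688, -9695600, -2645688, 5499352, -1868016, 3629456, 4182520, -2722984, -1171280, 289392,
  104408, -13608], [0, 4608, -44336, -548112, -183292, 4435800, 3516348, -5636064, 3108740,
  852120, -23457308, -4108752, 10329616, -6136456, 4728628, 7983824, -2506332, -1384296, 55484,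
  80880, -3996], [0, 6400, 95104, -10016, -1797968, -950892, 8755112, 3672160, -10559088,
  9102636, -1833784, -38093272, -3910384, 10671596, -13134408, 2591568, 9296432, -791596,
  -828840, -92216, 24192], [0, -6144, 9920, 436096, 470488, -3288912, -1294914, 12736000,
  1221732, -11998512, 17096834, -4748000, -41116640, -214256, 6144738, -17661184, -1700108,
  6103408, 405598, -167328, -46480], [0, -2816, -64640, -149296, 777632, 1118528, -4179856,
  -601280, 13372960, -2514144, -8027984, 20833376, -5078368, -28116224, 5529168, 2767552,
  -13942048, -3340128, 1893648, 305104, 20160], [0, 3584, 13840, -151856, -503708, 682048,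
  1090984, -4179376, 146040, 9377344, -5122792, -3142080, 15582780, -4265744, -11676824, 7119648,
  1746896, -5993840, -1703000, 157056, 32568], [0, 128, 17216, 91264, -90464, -585892, 522064,
  748680, -2891520, 716916, 4396400, -4365856, -336160, 6884036, -3095440, -2815256, 3850880,
  684268, -1315952, -309712, -8448], [0, -768, -6624, 10176, 120464, -14648, -408874, 345200,
  311308, -1409864, 653698, 1221024, -2093880, 417560, 1637594, -1429616, -241300, 1007720,
  46126, -146784, -18512], [0, 128, -448, -10192, -2576, 78192, -5784, -171448, 200720, 65680,
  -417016, 372344, 153424, -535664, 299576, 136888, -345104, 77168, 123672, -13096, -6464], [0,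
  0, 176, 208, -5636, -1992, 27132, -16736, -39356, 71480, -29564, -66928, 112520, -34248,
  -63468, 80496, -20972, -35240, 19804, 2960, -636], [0, 0, 0, 96, 48, -1284, 1320, 4016, -8496,
  1252, 13192, -17592, 1552, 17348, -15048, 416, 6896, -4644, 536, 392], [0, 0, 0, 0, 24, -64,
  -142, 640, -324, -1344, 1982, 128, -2176, 1472, 270, -768, 364, -64, 2]], [[0, 0, 0, -1120,
  3520, 4480, -17600, -5600, 35200, 0, -35200, 5600, 17600, -4480, -3520, 1120], [0, 192, 5856,
  6960, -8096, -5584, -10672, -95104, -10160, 322848, 39296, -411344, 9088, 219376, -34480,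
  -37344, 9168], [512, 16128, 93568, 33152, -165120, 116600, -436912, -513344, 599824, -23400,
  1347552, 559872, -2368160, -138392, 1087056, -79680, -158320, 29064], [-1024, -11904, 160896,
  808480, -352560, -1702080, 1274972, -3547416, -2903584, 6548792, -571220, 3588464, 3228976,
  -8202000, -909260, 2866184, 28192, -348520, 44612], [-1024, -59136, -349056, 659072, 3132864,
  -3827128, -6437912, 5331008, -15308064, -7364024, 24874728, -3418784, 7528704, 10567832,
  -17929096, -2866560, 4385376, 420312, -420808, 33120], [3072, 47680, -334496, -2038416,
  1953008, 7240040, -15557984, -12392592, 12107872, -42488376, -9335216, 52499216, -11058672,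
  13601336, 22145920, -24789296, -5374080, 3864664, 722480, -262848, 9504], [0, 73216, 606720,
  -539040, -5372000, 5834496, 11392952, -35234048, -10648592, 15924320, -79654840, -3379360,
  67749664, -23751360, 19280200, 30707648, -20898320, -6010528, 1750456, 514944, -65952], [-3072,
  -67328, 188416, 2324704, 20928, -8017704, 14220060, 12871640, -48924912, 5831584, 11911724,
  -99845392, 9293216, 53985688, -34408524, 18660216, 27617072, -9725584, -3773692, 258144,
  134752], [1024, -32256, -464384, -226016, 4121152, 98992, -8362256, 22291584, 8947616,
  -43222352, 26897712, 3708928, -80281568, 20922768, 25627088, -31545600, 11535584, 15286032,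
  -1883120, -1175712, -32480], [1024, 38208, 18336, -1058160, -1095424, 4298592, -1647152,
  -7086336, 21376176, 387280, -25180064, 31308080, -3649856, -39279872, 21629456, 5969952,
  -16759376, 4824208, 4917280, 73760, -134688], [-512, 768, 131200, 268224, -1122880, -1057320,
  3483040, -2830112, -3955696, 13112120, -5250864, -9387680, 18143296, -6748920, -10835584,
  11603616, -1057072, -4782360, 1464976, 870240, 48672], [0, -6784, -27776, 134368, 317072,
  -837168, -414028, 2047416, -2371232, -851112, 5220132, -4414864, -1147824, 5646272, -4141316,
  -733352, 3131296, -1260520, -637012, 275744, 70688], [0, 1280, -5760, -34624, 85568, 153480,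
  -439832, 84896, 708480, -1141496, 408936, 1140032, -1713248, 667992, 702328, -1175136, 523072,
  318744, -292936, -15168, 23392], [0, -64, 1056, -1840, -13648, 39176, 13376, -137328, 148768,
  41032, -299312, 327440, -10192, -304680, 304672, -76176, -127360, 127768, -19792, -15328,
  2432], [0, 0, 0, 96, -1120, 432, 9560, -16416, -9104, 50640, -47352, -19264, 79040, -58288,
  -6424, 36960, -26576, 7216, 1976, -1376], [0, 0, 0, 32, -32, -488, 1236, 520, -5072, 5072,
  3332, -9808, 5472, 2488, -4580, 2216, -368, -32, 12]], [[0, 0, 0, -1272, 10080, -13296, -30240,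
  64632, 20160, -100128, 20160, 64632, -30240, -13296, 10080, -1272], [0, 1728, 19296, -19152,
  -69564, 82368, -46176, -201696, 580620, 190848, -1083648, 127728, 776796, -274944, -167232,
  93120, -10092], [4608, 52960, 85696, -234528, -124272, -244170, -515064, 1488716, -558120,
  1586026, 1645584, -6149560, 496704, 4014762, -1050328, -814516, 346968, -31466], [-8704,
  -23872, 482896, 394160, -3062712, 735492, -121309, -5694156, 13363462, -1756680, -124955,
  8395832, -22205348, 1399892, 11760925, -2072860, -2082634, 668144, -47573], [-9216, -235136,
  -558720, 2553960, -135888, -13249928, 9467824, -1505568, -19044480, 52510648, -8215328,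
  -8775280, 24467056, -52994648, 1825840, 21490208, -2058016, -3052888, 699840, -34552], [25600,
  137984, -1371328, -2578176, 9325692, -6258884, -30484110, 38886432, -14685864, -28994852,
  122654998, -26430448, -15711580, 44786420, -84153314, -1236704, 25145632, -653324, -2556390,
  376240, -9624], [0, 322912, 1378624, -4187712, -5473024, 22348638, -25333552, -41612572,
  84485096, -51636238, -12446856, 186092512, -52199952, -1502366, 56036480, -87687532, -6820472,
  18528814, 437752, -1119576, 80800], [-24576, -236160, 1146224, 4562080, -9068880, -5364856,
  34284681, -56037772, -31584526, 106396460, -99448713, 26179176, 183421868, -68282624, 27113543,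
  49410916, -57987054, -8050484, 8209961, 347936, -195136], [9216, -147456, -1246976, 2103384,
  7967104, -14605872, 1444672, 34428216, -76124640, -1978240, 77350912, -115203272, 51823136,
  108904592, -61235264, 36446216, 28496352, -23621600, -4090880, 2051120, 51296], [7168, 143552,
  -216736, -2563792, 3061244, 8384408, -16355764, 11327200, 22215372, -63973448, 24463780,
  27965872, -78873724, 47902024, 30598196, -34527040, 22167524, 8841896, -6241220, -903808,
  247312], [-4608, 928, 381248, -153568, -2917040, 3688850, 4738920, -12508172, 14263304,
  5869870, -32919168, 25474728, -2329408, -29409586, 26058216, -2719852, -9844984, 7569298,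
  829424, -1232656, -78624], [512, -22592, -43984, 404336, -234360, -1995084, 3087861, 543100,
  -5724022, 9522032, -2697645, -8259352, 12111060, -6983372, -3264405, 7462092, -4535750,
  -560920, 1516669, -190112, -136064], [0, 5760, -19072, -32712, 243440, -283736, -619536,
  1513968, -1060448, -958872, 3234464, -2978880, 245008, 2384056, -2935312, 1445712, 544832,
  -1073480, 265728, 125640, -46560], [0, -640, 4096, -4960, 580, 63340, -169630, 77024, 301200,
  -637844, 449670, 297424, -887492, 728772, -95698, -402592, 436904, -147484, -46742, 39248,
  -5176], [0, 32, -320, -448, 1056, 8922, -14208, -33188, 97336, -51978, -111304, 215600,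
  -121200, -64474, 141744, -95732, 28952, 6314, -9768, 2664], [0, 0, 16, 64, -640, 704, 3359,
  -9508, 4158, 15852, -25967, 8952, 14052, -17800, 7793, -532, -706, 220, -17]], [[0, 0, 0, -192,
  10368, -45312, 40320, 91200, -172800, 0, 172800, -91200, -40320, 45312, -10368, 192], [0, 6272,
  20704, -121600, 43664, 267568, -521296, 443824, 811240, -1868464, 58672, 1870480, -856240,
  -513856, 441920, -84224, 1336], [15616, 54784, -132416, -183072, -86560, -460688, 2468512,
  -1460544, -387552, 5094992, -10289536, 744800, 9490592, -3808112, -2570464, 1783552, -277664,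
  3760], [-27136, 57984, 647040, -1660000, -1294848, 4516736, -6780136, 13671312, -536128,
  -14302224, 22443656, -36297632, 4236512, 28981760, -10122424, -6891792, 3814752, -462448,
  5016], [-30976, -407936, 387200, 3757056, -8677856, 1431536, 22407792, -31633472, 50479488,
  -1306448, -58663056, 61753088, -86428896, 12576208, 58077904, -16995904, -10920128, 4590352,
  -398896, 2944], [77824, 17152, -2627296, 2791744, 11452272, -28103312, 27525600, 46579808,
  -77632800, 127547328, -27647888, -116579504, 104825640, -141562560, 20410896, 78397712,
  -18038720, -10295088, 3023488, -162880, 584], [-512, 681088, 428096, -9676512, 10268736,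
  16409248, -61022640, 90640544, 39897216, -110359392, 220916912, -94045728, -126102560,
  110857184, -160934992, 17848032, 69971648, -11861920, -5375728, 959872, -22880], [-70656,
  -282880, 2829632, 446432, -21341152, 23806608, 1477464, -85878000, 154201536, -18908416,
  -84657000, 255098400, -153221408, -63861424, 72863944, -126010608, 8036224, 38821920, -4810232,
  -1261088, 99264], [31232, -347392, -1179904, 7182912, -1334464, -27697760, 39498336, -30773920,
  -69680224, 157183904, -82674848, -13019296, 182426208, -142224928, 5447200, 27523616,
  -65856928, 2747872, 11957024, -1251616, -54176], [16384, 244864, -867552, -1930624, 11084912,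
  -5405296, -20078288, 43488848, -50150680, -21239664, 96763600, -88051376, 39377504, 66626624,
  -75448160, 25182784, 2104952, -21871264, 1875008, 1611616, -188464], [-15104, 5376, 541504,
  -1507552, -1516192, 9969008, -9537344, -5833760, 26490112, -40734512, 11412704, 28920832,
  -44852160, 38360208, 1387520, -18402976, 14004096, -3520464, -4016608, 903072, 39392], [3584,
  -41344, -15616, 574816, -1438784, 51680, 5254536, -7854960, 3702272, 6458736, -17025416,
  13497024, -2841056, -8005024, 13600408, -8055120, 517792, 3375952, -1731992, -165600, 138112],
  [-256, 13952, -42880, -5504, 235040, -721552, 756144, 827936, -2860192, 3694768, -1816016,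
  -2165152, 4743040, -4797616, 2352016, 955360, -2292000, 1163280, 166672, -259808, 52768], [0,
  -2048, 13024, -14528, -2416, -18736, -74176, 407840, -584944, 119520, 887696, -1501488, 992744,
  160192, -987632, 985904, -403632, -94640, 169280, -58400, 6440], [0, 128, -1600, 2784, 7296,
  -13440, -37808, 94784, 11232, -252096, 332272, -86208, -257856, 361728, -216272, 48960, 29920,
  -38976, 18128, -2976], [0, 0, 64, -224, -736, 4880, -6904, -7600, 34368, -35808, -5528, 46272,
  -43296, 13904, 4184, -4912, 1472, -128, -8]], [[0, 0, 0, 928, -512, -35776, 128512, -119200,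
  -128000, 308096, -128000, -119200, 128512, -35776, -512, 928], [64, 11264, -22048, -138368,
  421192, -284832, -452000, 1598464, -1778652, -829168, 3122192, -1302096, -1296768, 1250192,
  -296048, -10544, 7156], [23808, -45888, -143488, 258176, -898016, 2442232, -295680, -5174224,
  9701568, -10185352, -2755200, 15611552, -6723552, -5994520, 5234176, -1013712, -64000, 22120],
  [-36736, 254848, -73504, -1828288, 4228352, -4261648, 5073036, 7422144, -31521112, 38048240,
  -33308708, -5714080, 48954576, -21963856, -15389724, 12019104, -1757368, -178704, 33428],
  [-46336, -247680, 1876864, -36320, -7397984, 21778912, -21565552, 6994000, 30571776,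
  -104502496, 100545104, -72009024, -5574240, 103068576, -46893520, -24124592, 16156864,
  -1511584, -252816, 24320], [102336, -461952, -1598560, 8792768, -4793416, -12500912, 59704552,
  -77065824, 26569264, 39678704, -205013128, 176839776, -110996428, 4341344, 147748136,
  -64730064, -23762808, 12606176, -459272, -173296, 6780], [-2560, 706368, -2468480, -5922176,
  24699712, -26239880, 1800336, 98767712, -165758048, 93770984, -18724848, -246118704, 204661984,
  -128772536, 21461168, 141059776, -56231968, -14374120, 5255472, 123536, -45472], [-86272,
  47360, 2958752, -8142976, -8880048, 42012448, -61848252, 48459872, 95607432, -208913792,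
  174611916, -115020160, -173501520, 154462048, -113251236, 32048672, 84354696, -29350400,
  -4900108, 912256, 76784], [47616, -465152, 358144, 7330016, -17304384, -274816, 41602656,
  -82064576, 96695840, 34106176, -143850912, 172865056, -145799328, -55157248, 72296224,
  -69478912, 28391136, 27908672, -8367840, -788800, 7392], [12224, 208128, -1369056, 1112320,
  9248312, -23598656, 14869904, 18467456, -64421452, 95983216, -29962048, -35737232, 82595896,
  -91964656, 10006848, 13389936, -25041708, 15652800, 3674224, -951648, -39128], [-21248, 31552,
  447104, -2248832, 2366496, 5009448, -18775968, 19574960, -4497376, -23861880, 50088288,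
  -35472128, 18114816, 8071480, -26832608, 15330800, -6509280, -3116456, 4551328, -178080,
  24736], [8320, -56448, 64800, 560448, -1824800, 2778480, -172332, -7022784, 10840488, -9940368,
  2076180, 7156576, -10136800, 13076528, -9221220, 367392, 4535720, -4371344, 906012, 425216,
  -50064], [-1280, 20608, -85632, 38240, 285088, -610976, 1143824, -1274352, 191968, 1427872,
  -3523760, 4813888, -4429824, 2324256, 1442992, -3567088, 2335584, -142368, -624016, 263104,
  -28128], [64, -3200, 25184, -58176, -4920, 87184, 83496, -231712, -157864, 963344, -1384328,
  685312, 684468, -1593344, 1456008, -559984, -241328, 431328, -227240, 49872, -4164], [0, 192,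
  -2944, 12672, -12672, -34456, 70160, 57280, -276352, 250776, 132368, -532208, 561408, -262760,
  -18384, 119328, -108544, 59816, -17360, 1680], [0, 0, 96, -768, 1744, 2176, -17828, 32416,
  -11384, -47456, 84740, -56512, 512, 25024, -16988, 4384, 40, -224, 28]], [[0, 0, 0, 576, -7296,
  13056, 54912, -224448, 264960, 0, -264960, 224448, -54912, -13056, 7296, -576], [384, 8640,
  -66720, 77152, 284160, -901152, 1103552, -185536, -2053248, 3125440, -511328, -2499552,
  2166464, -471904, -132288, 60480, -4544], [13824, -114688, 238976, -318816, 12320, 2931120,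
  -7682656, 8137248, -2055872, -9885456, 17080640, -4986656, -10599136, 9311248, -1676896,
  -603552, 212352, -14000], [-18944, 275456, -962048, 1329824, 22656, -4640512, 15446744,
  -32239184, 29636384, -3443216, -32074952, 56750464, -22969216, -25747744, 22771912, -2996944,
  -1509920, 389936, -20696], [-27136, 52352, 1452032, -4209920, 4478016, 687696, -24619376,
  48928192, -85074944, 71701200, 5134608, -70293504, 123897920, -61710224, -39168208, 34166720,
  -2564736, -2154000, 386352, -14464], [51584, -607808, 933152, 4455392, -13630784, 17138384,
  -12044704, -52761888, 93976832, -152271664, 129765120, 22197984, -96894848, 179867824,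
  -101452128, -39220512, 31992128, -536336, -1710368, 193664, -3840], [-2048, 356480, -3146368,
  4256736, 9620512, -31166208, 53429424, -59117856, -45483968, 106560448, -189926960, 179458912,
  20109280, -72266880, 169421392, -102044384, -26397696, 18380608, 590768, -688960, 38336],
  [-40960, 280576, 1134656, -8472672, 12457376, 9889648, -43116200, 96112656, -117425984,
  10796544, 61572856, -162673792, 180021920, -10011024, -11787064, 95866128, -60822976,
  -11530976, 6277800, 337600, -107328], [28672, -375040, 1307136, 1742656, -14864128, 24806880,
  -6894240, -28750720, 90874304, -123524896, 53049568, -633984, -84502848, 117046432, -27659744,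
  24201856, 25285952, -20132448, -2943584, 1261120, 37184], [1152, 106304, -1214560, 2818080,
  675712, -16024768, 31538944, -26954432, 1546560, 39296160, -69098464, 39446944, -26946688,
  -12945856, 37231872, -13168704, 19714048, -1417312, -3323840, -375744, 143168], [-11776, 61184,
  253568, -1914784, 3895136, -1838736, -8084288, 22716704, -22863616, 13731632, 3645344,
  -14798880, 6995232, -15580080, 10788736, -3907488, 1929024, 5411856, -2189408, -309696,
  -26816], [6656, -60416, 161152, 301280, -1835584, 3073696, -3164216, -615920, 6284256,
  -6084688, 3761000, -709696, 2895872, -6362624, 572696, 4798992, -5837280, 3017392, 143928,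
  -307136, -39360], [-1536, 19584, -115200, 205696, 213824, -1003312, 1242512, -1074304, 341568,
  -130992, 1612048, -2754368, 1917568, 1357296, -4130256, 3234560, -648640, -742288, 572720,
  -111296, -5184], [128, -2752, 26592, -106848, 144576, 103440, -393248, 139168, 550464, -953904,
  420416, 792672, -1581248, 1326704, -340704, -541152, 746624, -460944, 147680, -17856, 192], [0,
  128, -2432, 16672, -49056, 48096, 65776, -194848, 78976, 294944, -570032, 451808, -65312,
  -226272, 273552, -199904, 113728, -43168, 7344], [0, 0, 64, -800, 3872, -8464, 3080, 27440,
  -68544, 70752, -14744, -47040, 58080, -29008, 3416, 3248, -1600, 256, -8]], [[0, 0, 0, -248,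
  -1888, 21520, -51680, -1928, 184640, -300832, 184640, -1928, -51680, 21520, -1888, -248], [768,
  -1472, -35744, 179440, -275228, -43856, 807640, -1535040, 1094284, 1139616, -2925392, 1994224,
  -98948, -471696, 189080, -16032, -1644], [-1024, -38688, 244032, -778080, 1891376, -2528522,
  -279624, 6316140, -11072248, 9239882, 2170544, -12688632, 9357184, -482070, -2007976, 710828,
  -48312, -4810], [-768, 78528, -635696, 2048240, -5060888, 8521620, -8853149, -2297908,
  26623990, -42194208, 35904645, -3193176, -31836836, 25319284, -869987, -4894564, 1410726,
  -62632, -7221], [-1024, 56448, 235008, -2749848, 6716560, -15971992, 22287000, -14761480,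
  -9474112, 70832744, -100539832, 82182824, -24343600, -51174152, 43827880, -454488, -7115808,
  1529784, -28040, -5296], [3584, -218752, 1157824, -936256, -4444996, 11853548, -31304054,
  42281840, -15888656, -13614260, 118500118, -153174416, 116656444, -53431228, -55777482,
  50346032, 533672, -6066172, 858794, 5936, -1488], [3072, 94048, -1376704, 5639872, -6130176,
  -948290, 14278680, -47824996, 68073400, -28088046, 7795952, 117299736, -144112784, 99644482,
  -61940168, -41904964, 38108312, 765902, -2810240, 204432, 5696], [-7680, 152448, -17296,
  -3610592, 12554288, -15460536, 6604457, 14129404, -60727918, 87234612, -54266537, 43902360,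
  59061868, -76939760, 43149863, -40698100, -20341966, 18159348, 209225, -576960, 6848], [1024,
  -169984, 953344, -1276072, -4602112, 16363536, -24447312, 14022728, 9155776, -52844096,
  74254768, -52253496, 47298240, 8826448, -18742000, -391240, -14886976, -4907808, 4927120,
  -82208, -20032], [3840, 20288, -613536, 2584048, -3267876, -2100024, 14901076, -27028864,
  19104700, -498856, -25453260, 35053200, -15051436, 16130680, 2317724, -547040, -9410508,
  -2927064, 189052, 563680, -37664], [-2048, 51104, -7232, -1063200, 3630832, -4385358, 1245320,
  9619300, -20864456, 15785838, -5040528, -9062600, 7566048, 6429870, -6187736, 7144164, -576200,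
  -3843502, -262112, 353248, -6464], [256, -30272, 161456, -173008, -1055384, 3049444, -3824107,
  2320260, 4186490, -9881464, 7417043, -461928, -6460204, 4161236, 3081099, -5197068, 3968554,
  -774400, -573251, 36288, 48960], [0, 7040, -68096, 270136, -292400, -558728, 1787352, -2254136,
  1328320, 1348216, -3247224, 1996056, 1286992, -4055384, 3595880, -1105896, -447264, 597736,
  -175560, -29744, 16704], [0, -768, 11648, -77216, 232836, -266596, -151158, 772304, -944824,
  359740, 657222, -1217008, 857332, 4564, -700074, 820176, -521712, 193876, -24678, -7440, 1776],
  [0, 32, -832, 8640, -42784, 108698, -127768, -13292, 248200, -324682, 118448, 200360, -370640,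
  327206, -208120, 117044, -51864, 10794, 1184, -624], [0, 0, 16, -320, 2432, -9664, 21791,
  -25036, -642, 48612, -76655, 56616, -13212, -12376, 12401, -4636, 638, 52, -17]], [[0, 0, 0,
  -224, 2112, -2176, -20800, 70560, -79232, 0, 79232, -70560, 20800, 2176, -2112, 224], [512,
  -5120, 13600, 23296, -173384, 333936, -246416, -286672, 1125952, -1403792, 484176, 607280,
  -692792, 223584, 10784, -16800, 1856], [-2048, 15360, -14976, -110720, 698816, -2126088,
  3586928, -2885088, -867120, 5909816, -7986400, 3693760, 2197408, -3051224, 940528, 55712,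
  -60464, 5800], [2048, -13824, -39488, 382784, -1632304, 5333760, -10983204, 16636824,
  -13994528, -550904, 16495036, -24046512, 13256080, 4685744, -7643596, 2014424, 206016, -116920,
  8564], [2048, 0, -24128, -472000, 2232048, -6227816, 18278968, -30243728, 41726960, -35874728,
  -454600, 29808528, -45510960, 29114248, 6183144, -11689840, 2347344, 397192, -122904, 5936],
  [-5120, 13312, 231136, -652832, -199224, 3307432, -9990320, 32599600, -48369704, 61089800,
  -53412608, -7477712, 38351136, -57475288, 41473152, 5115136, -11086040, 1442280, 391248,
  -65536, 1560], [2048, -24576, -170816, 1693344, -4329776, 4878832, -3817336, -4681488,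
  31305440, -48242096, 54529976, -48725808, -20542320, 35837072, -47532680, 37575184, 2615040,
  -6400208, 389768, 187792, -13888], [2048, 18432, -178560, -715936, 4647488, -11322776,
  15826460, -17010808, 6177680, 18139808, -36532532, 33944688, -30162272, -24768920, 23938612,
  -22562328, 20193008, 725264, -2161052, 8768, 34976], [-2048, 4096, 279168, -922080, -278048,
  5802192, -15051952, 24232320, -21362336, 9634768, 13999248, -30448896, 21918304, -17064208,
  -16427024, 11398144, -2898016, 5473392, 72624, -409248, -9024], [512, -12288, -59680, 1023808,
  -2595768, 2243040, 1902480, -11751152, 22202256, -16212448, 6142160, 15702288, -25694680,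
  16302608, -10466400, -7381024, 3949168, 2333104, 302368, 13056, -40560], [0, 5120, -74240,
  -162752, 1660448, -3956296, 4639392, -3090432, -6104816, 14232504, -12192336, 5201888, 9527872,
  -14038040, 9139264, -4323648, -2586544, 1249960, 994672, -131808, 9792], [0, -512, 48064,
  -194176, 8464, 1434032, -3265612, 4608552, -3804384, -1851032, 7357556, -8631824, 5361712,
  1164320, -3835396, 2699816, -882432, -649784, 367132, 77120, -11616], [0, 0, -11328, 99968,
  -322320, 288536, 485304, -1639056, 2568240, -2277160, 70072, 2437392, -3573360, 2857736,
  -976024, -204400, 333584, -123640, -57240, 51568, -7872], [0, 0, 1312, -18464, 105016, -283384,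
  359088, -79728, -466408, 927464, -935712, 431632, 170928, -503960, 496320, -281664, 85096,
  10728, -27504, 10368, -1128], [0, 0, -64, 1440, -12464, 54112, -132248, 184816, -118464,
  -59456, 219512, -251760, 174992, -89504, 47704, -24944, 3808, 4736, -2552, 336], [0, 0, 0, -32,
  480, -3096, 11348, -25928, 37168, -29328, 1284, 25296, -30112, 17352, -4452, -488, 656, -160,
  12]], [[0, 0, 0, 48, 384, -4128, 11136, -8496, -11520, 25152, -11520, -8496, 11136, -4128, 384,
  48], [0, -768, 6768, -18928, 7164, 69744, -191744, 262288, -135528, -209264, 448352, -297408,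
  4028, 91136, -40944, 4896, 208], [0, 3840, -25280, 71872, -85280, -149516, 885792, -1889048,
  2213504, -1183172, -874304, 2389680, -1777248, 185580, 382432, -167000, 17664, 484], [0, -5632,
  33888, -82944, 166080, 265032, -1956806, 5014704, -9082156, 9713176, -5301042, -1155968,
  6449720, -5261288, 562262, 963280, -350796, 27784, 706], [0, -1536, -13632, 51344, 80112,
  -300496, 2477000, -8585592, 15717648, -25367856, 25047016, -13028968, 838288, 10665168,
  -9434536, 775864, 1460080, -400720, 20280, 536], [0, 11264, -25840, -79536, 30564, 287576,
  -1183524, 5942848, -18470508, 29590616, -43751900, 40101392, -18283640, 3780184, 11943924,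
  -11007280, 580676, 1293816, -242532, 6032, 156], [0, -8192, 55168, 53152, -666608, 1156980,
  -2087736, 1588544, 4198640, -19972532, 34534312, -47337080, 41142000, -13965300, 3149976,
  9402864, -8400176, 271796, 622456, -68568, 320], [0, -2560, -36032, 132608, 598104, -2163408,
  5184958, -9318752, 10855748, -7018000, -7259806, 24780384, -31932864, 28142928, -3841502,
  -782688, 4938644, -4012656, 125630, 134752, -5808], [0, 5632, -9088, -198320, 323744, 875328,
  -3093712, 9032320, -16045856, 18432288, -18372496, 5629536, 10176992, -13894400, 14185616,
  2200064, -2832864, 1419168, -1082544, 58576, 5760], [0, -2304, 21136, 41776, -658556, 1003776,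
  -659640, -935888, 7057712, -13701408, 15577976, -17638592, 6915452, 2002128, -5214040, 6183584,
  2057896, -1770416, 87080, -119104, 13576], [0, 256, -7360, 56192, 183232, -1067908, 1991760,
  -2826424, 2860896, 1333108, -4878800, 7279264, -8344832, 3026916, 382704, -2252504, 2324384,
  450092, -462000, -51600, 2624], [0, 0, 96, -33280, 101328, 127944, -924138, 1864784, -3119860,
  3535064, -1943982, 180960, 1541160, -2107112, 781690, 157488, -640148, 569928, -39490, -44128,
  -8304], [0, 0, 192, 6640, -62480, 168368, -107896, -249816, 800144, -1446576, 1700008,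
  -1279560, 606608, 51280, -356200, 217112, -57360, -24272, 50040, -15464, -768], [0, 0, -16,
  -656, 11804, -63944, 162396, -221568, 153732, 25272, -221372, 299376, -226208, 105688, -7596,
  -41232, 44644, -34248, 17020, -3152, 60], [0, 0, 0, 32, -944, 7964, -32824, 79504, -122960,
  124804, -79512, 23976, 3568, -1756, -3176, -1472, 5648, -3652, 824, -24], [0, 0, 0, 0, 24,
  -320, 1906, -6688, 15292, -23648, 24510, -15552, 3456, 3456, -3826, 1760, -404, 32, 2]], [[0,
  0, 0, 32, -320, 896, -448, -1888, 2944, 0, -2944, 1888, 448, -896, 320, -32], [0, 0, 448,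
  -3600, 10240, -11984, -3792, 38272, -70672, 60256, 6944, -68368, 60768, -17296, -3600, 2720,
  -336], [0, 0, -2560, 16480, -49312, 80088, -46832, -148832, 467248, -638216, 489184, -52064,
  -366080, 362632, -108784, -12192, 10352, -1112], [0, 0, 4928, -26560, 99632, -243008, 203340,
  154600, -1099136, 2488664, -2874020, 2101648, -616624, -926032, 1012612, -260408, -38656,
  20664, -1644], [0, 0, -1280, 18560, -76672, 254056, -572536, 75264, 1392288, -4012824, 7527432,
  -7698400, 5357376, -2157832, -1360040, 1617344, -311904, -71752, 22040, -1120], [0, 0, -7808,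
  6960, -432, -34232, 414208, -768976, -289408, 3613864, -8477456, 13959248, -13206416, 8530392,
  -3778400, -1289712, 1577184, -190664, -69904, 11840, -288], [0, 0, 9472, -39872, 32064, -94848,
  32152, 828448, -1122608, 650592, 4129000, -10714048, 16138240, -15075392, 8552552, -3614944,
  -838384, 945504, -48872, -33728, 2528], [0, 0, -896, 41088, -68832, -31304, -132148, -570600,
  1865392, -2622880, 3972124, 872336, -7559104, 11272440, -11707836, 5156216, -1759472, -372368,
  340308, 1248, -6432], [0, 0, -4864, -4192, 87488, -11664, -168016, 96512, -1744480, 2933616,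
  -4389904, 6986624, -2969568, -1750832, 4269584, -6215552, 1586400, -237232, -109232, 70496,
  1952], [0, 0, 3264, -16688, -19360, 154784, 28016, -20736, 251408, -1902000, 2666816, -4039696,
  6209248, -3409600, 1436400, 591264, -2172464, 111824, 141728, -21600, 7392], [0, 0, -768, 9056,
  -27808, -70984, 223648, -201344, 384624, -197608, -795760, 1024832, -1982688, 2761384,
  -1663488, 1125504, -130192, -477560, -35120, 57184, -2912], [0, 0, 64, -1216, 15536, -22640,
  -86908, 254904, -392256, 628088, -552396, 223312, -74192, -316992, 504556, -319080, 249280,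
  -56904, -61924, 3744, 5024], [0, 0, 0, -64, -2304, 17320, -24952, -33568, 145856, -281176,
  406408, -397440, 291424, -191048, 76120, -16544, 13824, 4344, -7016, -2944, 1760], [0, 0, 0,
  16, 80, -3096, 14944, -29744, 24832, 10664, -64080, 105808, -105008, 71800, -39040, 18224,
  -10208, 7160, -1936, -608, 192], [0, 0, 0, 0, 0, 240, -2120, 8256, -18672, 27024, -25432,
  13920, -1440, -3312, 648, 2432, -2160, 624, 24, -32], [0, 0, 0, 0, 0, -8, 100, -568, 1936,
  -4400, 6996, -7920, 6336, -3432, 1100, -88, -80, 32, -4]], [[0, 0, 0, -8, 32, -16, -96, 136,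
  64, -224, 64, 136, -96, -16, 32, -8], [0, 0, 0, -144, 908, -2528, 3568, -1344, -4284, 9472,
  -9216, 1776, 6292, -6944, 2768, -288, -36], [0, 0, 0, 800, -5424, 15018, -27560, 32244, -1560,
  -55178, 89584, -81992, 26912, 36598, -43592, 15732, -1496, -86], [0, 0, 0, -1584, 8536, -39076,
  87229, -118820, 111418, 51832, -299493, 402536, -364092, 152428, 95491, -119316, 35402, -2368,
  -123], [0, 0, 0, 984, -5680, 31464, -125376, 248176, -286144, 172840, 318096, -915008, 1091856,
  -963720, 431392, 140112, -177440, 40056, -1520, -88], [0, 0, 0, 1632, 2228, 8676, 50206,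
  -216928, 386312, -487868, 65418, 846032, -1689636, 1954668, -1611854, 694624, 123904, -150420,
  23334, -304, -24], [0, 0, 0, -3456, 6496, -11390, 75552, 45100, -212264, 380206, -752360,
  -144720, 1189936, -1908290, 2394768, -1724260, 664440, 63314, -69320, 6216, 32], [0, 0, 0,
  1696, -16112, 8888, -53865, 152444, 90638, -126396, 405449, -1075592, -134764, 827808,
  -1252839, 2018252, -1151378, 372068, 13223, -14432, 448], [0, 0, 0, 1064, 9216, -28880, 5984,
  -100696, 130848, 216704, -107232, 588712, -1196256, 114800, 70688, -376680, 1138656, -445728,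
  112480, -2064, -544], [0, 0, 0, -1488, 3252, 17096, -30940, 10944, -127420, 36296, 247516,
  -161360, 625132, -903656, 240700, -316000, 38604, 395608, -86396, 13248, -1136], [0, 0, 0, 608,
  -4912, 6606, 17176, -26196, 41848, -127310, 27360, 121784, -116704, 382802, -406056, 153932,
  -208584, 71022, 72752, -5712, -416], [0, 0, 0, -112, 1688, -7700, 8939, 8116, -24266, 60320,
  -109843, 67768, -14388, -21236, 111029, -95452, 35654, -46744, 22035, 4320, -128], [0, 0, 0, 8,
  -240, 2040, -6912, 8928, -1184, -14408, 41168, -64240, 58288, -39128, 15968, 7584, -7360,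
  -1240, -1072, 2152, -352], [0, 0, 0, 0, 12, -204, 1294, -3872, 6192, -5004, -1190, 11024,
  -18844, 19100, -13566, 6688, -1640, 444, -874, 496, -56], [0, 0, 0, 0, 0, 6, -80, 436, -1336,
  2602, -3368, 2784, -1008, -774, 1440, -988, 296, 22, -40, 8], [0, 0, 0, 0, 0, 0, 1, -12, 66,
  -220, 495, -792, 924, -792, 495, -220, 66, -12, 1]], [[], [0, 0, 0, 0, 0, -48, 240, -432, 264,
  240, -720, 816, -288, -384, 480, -192, 24], [0, 0, 0, 0, -128, 512, -1152, 2720, -4192, 2528,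
  1536, -5824, 7616, -3136, -2688, 3104, -992, 96], [0, 0, 0, 0, 256, -1664, 4992, -8640, 14112,
  -17056, 8880, 4192, -22624, 33440, -14016, -8224, 8256, -2048, 144], [0, 0, 0, 0, 0, 1152,
  -8512, 19872, -31776, 44352, -34240, 13344, 3520, -57088, 87104, -33312, -13984, 11584, -2112,
  96], [0, 0, 0, 0, -256, 1376, -224, -22272, 40976, -70032, 95056, -24208, 5832, -12368,
  -103888, 142608, -46576, -14016, 9056, -1088, 24], [0, 0, 0, 0, 128, -1536, 10048, -11232,
  -30944, 43328, -108608, 144736, 35424, -1920, -45376, -137248, 147680, -39872, -8128, 3744,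
  -224], [0, 0, 0, 0, 0, -128, -4224, 29792, -31360, -16256, 13920, -135200, 156864, 99520,
  11136, -69536, -126144, 94272, -20832, -2464, 640], [0, 0, 0, 0, 0, 384, -2752, -6176, 46688,
  -44928, 16576, -17440, -137952, 120448, 103616, 29856, -60512, -75904, 34624, -6240, -288], [0,
  0, 0, 0, 0, -48, 1776, -7632, -3800, 41552, -40304, 37936, -22032, -104928, 66176, 58496,
  26680, -31616, -27648, 6240, -848], [0, 0, 0, 0, 0, 0, -192, 3264, -10048, 1504, 20544, -24608,
  33120, -11840, -52800, 26752, 18816, 10336, -9792, -5408, 352], [0, 0, 0, 0, 0, 0, 0, -288,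
  2976, -7264, 3824, 4800, -10528, 16544, -5056, -15552, 8000, 3392, 1232, -1632, -448], [0, 0,
  0, 0, 0, 0, 0, 0, -192, 1344, -2816, 2176, 160, -2944, 4864, -2048, -2176, 1600, 256, -128,
  -96], [0, 0, 0, 0, 0, 0, 0, 0, 0, -48, 240, -464, 424, -80, -400, 688, -416, -64, 160, -32,
  -8], [], []], [[], [0, 0, 0, 0, 0, 0, 0, 0, 4, -16, 16, 16, -40, 16, 16, -16, 4], [0, 0, 0, 0,
  0, 0, 0, 0, 32, -48, -128, 256, 64, -352, 128, 128, -96, 16], [0, 0, 0, 0, 0, 0, 0, 0, 80, 192,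
  -680, -416, 1600, 32, -1456, 416, 432, -224, 24], [0, 0, 0, 0, 0, 0, 0, 0, 32, 768, 384, -3504,
  -704, 5504, -128, -3552, 672, 768, -256, 16], [0, 0, 0, 0, 0, 0, 0, 0, -104, 288, 3392, 96,
  -10348, -816, 11696, 48, -5392, 528, 752, -144, 4], [0, 0, 0, 0, 0, 0, 0, 0, -32, -864, 896,
  8832, -736, -19392, -1024, 16128, 800, -5088, 128, 384, -32], [0, 0, 0, 0, 0, 0, 0, 0, 80, -64,
  -2864, 1280, 14704, -1216, -23840, -1216, 14704, 1280, -2864, -64, 80], [0, 0, 0, 0, 0, 0, 0,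
  0, -32, 384, 128, -5088, 800, 16128, -1024, -19392, -736, 8832, 896, -864, -32], [0, 0, 0, 0,
  0, 0, 0, 0, 4, -144, 752, 528, -5392, 48, 11696, -816, -10348, 96, 3392, 288, -104], [0, 0, 0,
  0, 0, 0, 0, 0, 0, 16, -256, 768, 672, -3552, -128, 5504, -704, -3504, 384, 768, 32], [0, 0, 0,
  0, 0, 0, 0, 0, 0, 0, 24, -224, 432, 416, -1456, 32, 1600, -416, -680, 192, 80], [0, 0, 0, 0, 0,
  0, 0, 0, 0, 0, 0, 16, -96, 128, 128, -352, 64, 256, -128, -48, 32], [0, 0, 0, 0, 0, 0, 0, 0, 0,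
  0, 0, 0, 4, -16, 16, 16, -40, 16, 16, -16, 4], [], []]]

set_option maxRecDepth 100000 in
/-- The complementary form, of bidegree `(16, 16)`. -/
def coList : List (List (List ℤ)) :=
  [[[0, 0, 0, 0, 0, 0, 0, 0, 1, -4, 2, 12, -17, -8, 28, -8, -17, 12, 2, -4, 1], [0, 0, 0, 0, 0,
  0, 0, 0, 16, -32, -64, 160, 80, -320, 0, 320, -80, -160, 64, 32, -16], [0, 0, 0, 0, 0, 0, 0, 0,
  104, 32, -688, -96, 1816, 64, -2464, 64, 1816, -96, -688, 32, 104], [0, 0, 0, 0, 0, 0, 0, 0,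
  336, 1120, -1344, -5600, 1680, 11200, 0, -11200, -1680, 5600, 1344, -1120, -336], [0, 0, 0, 0,
  0, 0, 0, 0, 476, 4368, 6328, -13104, -29596, 8736, 45584, 8736, -29596, -13104, 6328, 4368,
  476], [0, 0, 0, 0, 0, 0, 0, 0, -112, 5600, 29120, 29344, -57904, -116032, 0, 116032, 57904,
  -29344, -29120, -5600, 112], [0, 0, 0, 0, 0, 0, 0, 0, -1064, -3360, 27440, 124768, 129192,
  -121408, -311136, -121408, 129192, 124768, 27440, -3360, -1064], [0, 0, 0, 0, 0, 0, 0, 0, -432,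
  -11936, -35136, 51488, 333712, 429504, 0, -429504, -333712, -51488, 35136, 11936, 432], [0, 0,
  0, 0, 0, 0, 0, 0, 1222, 1000, -49268, -166840, -76070, 427984, 772520, 427984, -76070, -166840,
  -49268, 1000, 1222], [0, 0, 0, 0, 0, 0, 0, 0, 432, 11936, 35136, -51488, -333712, -429504, 0,
  429504, 333712, 51488, -35136, -11936, -432], [0, 0, 0, 0, 0, 0, 0, 0, -1064, -3360, 27440,
  124768, 129192, -121408, -311136, -121408, 129192, 124768, 27440, -3360, -1064], [0, 0, 0, 0,
  0, 0, 0, 0, 112, -5600, -29120, -29344, 57904, 116032, 0, -116032, -57904, 29344, 29120, 5600,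
  -112], [0, 0, 0, 0, 0, 0, 0, 0, 476, 4368, 6328, -13104, -29596, 8736, 45584, 8736, -29596,
  -13104, 6328, 4368, 476], [0, 0, 0, 0, 0, 0, 0, 0, -336, -1120, 1344, 5600, -1680, -11200, 0,
  11200, 1680, -5600, -1344, 1120, 336], [0, 0, 0, 0, 0, 0, 0, 0, 104, 32, -688, -96, 1816, 64,
  -2464, 64, 1816, -96, -688, 32, 104], [0, 0, 0, 0, 0, 0, 0, 0, -16, 32, 64, -160, -80, 320, 0,
  -320, 80, 160, -64, -32, 16], [0, 0, 0, 0, 0, 0, 0, 0, 1, -4, 2, 12, -17, -8, 28, -8, -17, 12,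
  2, -4, 1]], [[0, 0, 0, 0, 0, 0, 0, 16, -64, 32, 192, -272, -128, 448, -128, -272, 192, 32, -64,
  16], [0, 0, 0, 0, 0, 48, -288, 568, 168, -2288, 2720, 1784, -6104, 1712, 4960, -2520, -1928,
  496, 800, 168, -328, 32], [0, 0, 0, 0, 128, -736, 744, -840, 6840, -2880, -20240, 27064, 2680,
  -44928, 26304, 30632, -14424, -11520, -6832, 4584, 4776, -1376, 24], [0, 0, 0, 0, -512, 1088,
  -6144, 10376, 20024, 36976, -46400, -110072, 107768, -39824, -183552, 167064, 163240, -13680,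
  -49280, -67368, -3800, 15440, -1344], [0, 0, 0, 0, 512, -160, 7664, -12664, 89720, 194944,
  116960, -338808, -530248, 35776, -454784, -617064, 610152, 749248, 313952, 37080, -170136,
  -47968, 16208, -384], [0, 0, 0, 0, 512, -16, 2592, -10728, -65592, 323088, 733920, 95960,
  -1644728, -2395344, -1834464, -3241016, -3109416, 93168, 1304288, 1052488, 485656, -118048,
  -67072, 6144], [0, 0, 0, 0, -1280, 832, -5832, 11352, -149256, -248256, 1078800, 2650328,
  1411128, -2182208, -3877504, -4605560, -8434072, -8682368, -3515856, -215736, 881512, 720448,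
  28936, -31744, 512], [0, 0, 0, 0, 512, -2048, 8704, 37544, 102040, -534416, -895744, 2191400,
  6458200, 6392304, 3249472, 2462968, 448200, -6745712, -9638592, -5788616, -2196152, -158704,
  370304, 48128, -4096], [0, 0, 0, 0, 512, -320, -11616, -7096, 173624, 285312, -1555776,
  -3549944, -408712, 4933696, 6081344, 5702360, 8540072, 8269888, 1157504, -3548968, -3071832,
  -1656256, -428576, 57088, 9216], [0, 0, 0, 0, -512, 2064, -4064, -54616, -81416, 562352,
  1301600, -1091352, -4628872, -3512688, -840800, -1500552, -1230488, 3399760, 5820128, 2787832,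
  84008, -451488, -419584, -141312], [0, 0, 0, 0, 128, -96, 12888, 13480, -149144, -379840,
  599824, 2281128, 1173416, -1025280, -211008, 452728, -1821512, -2867456, -439888, 1386552,
  810936, 172576, 38184, -33792, -13824], [0, 0, 0, 0, 0, -1088, -3072, 28568, 79016, -182832,
  -783936, -364008, 778472, 246224, -483712, 652232, 1188600, -136912, -965888, -326008, 190328,
  74608, 192, 9216], [0, 0, 0, 0, 0, 480, -2704, -12008, 32168, 179712, 99040, -304104, -148632,
  285248, -146944, -436664, 159992, 431808, 48352, -175608, -43528, 34592, 2256, -3456], [0, 0,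
  0, 0, 0, -48, 1248, -2296, -24680, -21968, 68128, 54088, -101352, -3184, 134880, -56936,
  -137656, 28112, 78624, 5144, -23032, -2912, 3840], [0, 0, 0, 0, 0, 0, -120, 1608, 3304, -7488,
  -11792, 19144, 11176, -32064, 6144, 33368, -14536, -20608, 5840, 7320, 56, -1280, -72], [0, 0,
  0, 0, 0, 0, 0, -200, 136, 1360, -1408, -2632, 4296, 976, -5824, 2216, 3736, -2384, -960, 616,
  24, 48], [0, 0, 0, 0, 0, 0, 0, 8, -24, -32, 192, -152, -280, 512, -64, -424, 312, 32, -128, 56,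
  -8]], [[0, 0, 0, 0, 0, 0, 112, -448, 216, 1376, -1920, -992, 3272, -832, -2128, 1408, 360,
  -544, 96, 32, -8], [0, 0, 0, -32, 864, -3448, 2576, 9216, -23448, 17624, 23952, -60416, 21608,
  40104, -30352, -2240, -1608, 6984, 3824, -7968, 2584, 176], [0, 0, 0, 1600, -6384, 3968,
  -19668, 37632, 86976, -224928, 180528, 125824, -518496, 287840, 235176, -215808, 35136, -71904,
  63600, 50752, -58032, 5024, 1164], [0, 0, 0, -4224, 7936, -53264, 3408, 76336, 320808, 380424,
  -1031952, 830640, 209832, -2431064, 1455760, 904400, -821128, 82456, -422000, 341712, 282552,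
  -128952, -5216, 1536], [0, 0, 0, 960, 1632, 53072, -138256, 159840, 1197000, 1959840, 1192296,
  -2477632, 2684136, -354208, -7177048, 4304160, 2528792, -2345824, -774600, -1973568, 576664,
  687120, -91192, -13760, 576], [0, 0, 0, 8032, -288, 99112, 124688, -622912, 411112, 4542168,
  6431440, 2341440, -2896280, 7819368, -1020880, -12071040, 11641656, 8665928, -2032208,
  -2241248, -4955752, -159152, 691264, 6912, -6144], [0, 0, 0, -9088, 1840, -68368, 342740,
  -177088, -3492752, -1481056, 7902976, 10654208, 181584, -2341952, 15518024, -2439104,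
  -13241776, 24040416, 22670368, 6412032, 461504, -5468976, -1003324, 239104, 18944], [0, 0, 0,
  -1024, -20480, -62832, 21808, 1735216, 344552, -8626808, -6305104, 7760176, 7258088, -11532568,
  -7887216, 13315536, -15646792, -22626152, 22723792, 28027600, 14355064, 5210216, -2261824,
  -616448, 1024], [0, 0, 0, 7552, 8256, -34272, -448088, 300384, 5600040, 4652064, -9503368,
  -6328960, 9702888, 1304192, -22913208, -12933920, 4287416, -31617120, -37023512, 2837312,
  13643640, 9442208, 4214448, -135296, -74368], [0, 0, 0, -3936, 17952, 50776, -217296, -2026752,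
  -1296008, 8240328, 9140400, -4261888, 3506296, 20287672, 7149904, -13827392, 379880, 10481816,
  -21465904, -28014176, -5778424, 1723280, 2247168, 1058816, 24576], [0, 0, 0, -704, -8848,
  65632, 417300, 65408, -3652128, -4554080, 5059440, 5173888, -4351104, 7177952, 21556984,
  10142080, -2046048, 10841312, 15196016, -4148928, -9255024, -1996480, 55316, 302592, 96768],
  [0, 0, 0, 1152, -6912, -55984, 18864, 880272, 1064248, -2982184, -4904240, 676624, -2708040,
  -9996872, -1353168, 6481520, -129880, -3960184, 4416688, 6607216, -344216, -1875048, -275296,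
  29184, 27648], [0, 0, 0, -320, 5472, -368, -113952, -158688, 834680, 1669984, -458920, -622528,
  2706904, -310176, -4043592, -51232, 1957672, -1321632, -2156152, 850624, 1478888, -37808,
  -216184, -17856, 5184], [0, 0, 0, 32, -1120, 7160, 18608, -110528, -305096, 136584, 483056,
  -573504, -200520, 1249336, -124144, -991104, 414504, 600792, -369008, -468384, 92232, 156528,
  -8512, -6912], [0, 0, 0, 0, 80, -1232, 4332, 31040, -11024, -98976, 72544, 135168, -240752,
  -27392, 300568, -127680, -171568, 120864, 80128, -38528, -37536, 6736, 3228], [0, 0, 0, 0, 0,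
  48, -816, -1264, 8120, -1128, -24176, 23824, 21176, -50760, 12976, 39152, -28888, -9016, 12016,
  -272, -408, -584], [0, 0, 0, 0, 0, 0, 24, -32, -320, 896, 72, -2976, 3472, 1024, -4952, 3232,
  672, -1920, 1016, -224, 16]], [[0, 0, 0, 0, 0, 448, -1792, 784, 5824, -7840, -4928, 14448,
  -2688, -10752, 6272, 2800, -3136, 224, 448, -112], [0, 0, -384, 5184, -12448, -10304, 73840,
  -109928, 25864, 202656, -344656, 104024, 247752, -240160, 61200, -35640, 28184, 50208, -76720,
  36360, -2632, -2400], [0, 0, 6912, -15808, 5792, -69808, -87568, 741224, -1063624, 235760,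
  1714000, -3182424, 1504632, 1658704, -2019536, 837304, -631896, 303632, 396336, -530696,
  185096, 22112, -10144], [0, 0, -10496, 21632, -106880, -244864, -17552, 15016, 3071256,
  -5039296, 1038608, 7166120, -14692264, 8211904, 7079600, -8383112, 3409864, -3208448, 1842416,
  1192888, -1717176, 280704, 102624, -12544], [0, 0, -10496, 4992, 139776, -265248, -1239616,
  924200, 2580184, 6163776, -15777248, 3750184, 16438104, -42233600, 25731168, 21367288,
  -21972664, 6679040, -8693856, 6440760, 2819400, -2958368, -9952, 126976, -4800], [0, 0, 28544,
  -26432, 347424, 1291488, -656688, -3311624, 4119656, 12509984, 5134896, -34555720, 16993960,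
  23339680, -79833264, 58650344, 48566840, -38419808, 3669712, -16263256, 12392344, 5472960,
  -2423456, -299008, 48640], [0, 0, -8704, 7872, -251488, 1347984, 5597424, -2530648, -7963208,
  10902352, 28977584, -7999000, -57325576, 49715504, 16705168, -108548488, 102858280, 82594096,
  -44674992, -11215560, -24579960, 11526336, 5986432, -634624, -155136], [0, 0, -18944, -31488,
  -520512, -1775712, 3505616, 15277896, -5642184, -15973568, 22297232, 36566856, -45693448,
  -84051712, 74793456, -22900136, -128361688, 128850176, 101829232, -30643176, -23823896,
  -26000608, 3646784, 2778624, 85504], [0, 0, 19968, 37632, 172800, -2041568, -6915648, 6524232,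
  28506840, -6304288, -16156800, 46970120, 37573528, -84845472, -88210368, 72929240, -74842104,
  -133796512, 112356800, 91040472, -5357304, -17274048, -14725440, -502784, 314752], [0, 0,
  -3712, 32704, 445600, 1324544, -4148976, -16299320, 6514072, 33963232, -8405104, -528888,
  81968856, 49888032, -75797712, -40423080, 65779656, -87040928, -107167632, 64866328, 54656296,
  6059424, -5287360, -3453440, -165376], [0, 0, -6400, -45632, -123936, 1259248, 4315728,
  -4218376, -22590360, 2473104, 20644016, -24708424, 3299624, 79890352, 42279248, -42465176,
  8292664, 50510192, -60990256, -62390232, 19847000, 17759072, 2146272, -1286912, -336384], [0,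
  0, 4864, 1664, -165376, -707776, 1312784, 6809848, -1962808, -18118208, 2299056, 3256568,
  -36836984, -7126336, 39516944, 11886952, -19294760, 21994240, 31803216, -22095064, -19834920,
  3958080, 3337696, 140032, -179712], [0, 0, -1280, 10624, 71424, -161504, -1138880, 589624,
  6274632, 472576, -6154592, 9406776, 3029064, -19850944, -2514592, 12054056, -4613224, -9975616,
  9256864, 10259944, -4732520, -3098912, 552480, 293376, -29376], [0, 0, 128, -3264, -288,
  110944, -53328, -1058648, -336136, 2398304, -1361776, -2580248, 5667000, 734304, -5716368,
  1774840, 3310056, -2671392, -2741136, 1825848, 1394568, -572160, -162720, 41472], [0, 0, 0,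
  320, -2080, -8144, 84688, 82424, -377688, 20784, 817232, -855368, -643736, 1667536, -474384,
  -1106328, 839928, 434512, -408400, -271448, 183576, 35712, -19136], [0, 0, 0, 0, 192, -608,
  -7504, 17176, 27624, -104512, 42928, 171288, -242136, -4480, 263248, -175928, -69320, 106752,
  -11952, -12536, -3080, 2848], [0, 0, 0, 0, 0, 32, 64, -952, 1352, 3968, -13056, 8232, 16200,
  -31392, 15232, 10520, -17576, 9472, -2240, 120, 24]], [[0, 0, 0, 0, 1120, -4480, 1568, 16128,
  -20356, -17136, 42840, -3248, -38332, 18592, 14448, -12768, -700, 3024, -616, -112, 28], [0,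
  -1536, 11904, -6400, -93888, 247440, -197568, -257440, 965896, -1143416, 56640, 1266464,
  -1226424, 426408, -112384, -37664, 376600, -469608, 241408, -33120, -22184, 8872], [0, 11264,
  -5056, -9024, 54688, -840672, 2339960, -1648224, -3088216, 9324320, -11018008, 2084288,
  10210824, -11400064, 5307512, -2384096, 424440, 2493088, -3058504, 1367232, -23112, -177760,
  35120], [0, -5632, 17920, 95808, -465024, 315040, -2245344, 9377056, -7908760, -15052504,
  42619392, -50838304, 12709288, 45882472, -50860032, 22870048, -12692936, 5958136, 6001856,
  -9247072, 3442232, 432088, -448992, 43264], [0, -30720, -18304, 216576, 643376, -1757728,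
  -1081408, 140736, 20275584, -33623104, -36429120, 112921280, -144699792, 44232896, 134483552,
  -137820800, 52158192, -30741312, 25087872, 7679680, -17073184, 4602080, 1272096, -455360,
  16912], [0, 25600, -86912, -157568, 2715264, 2619344, -4436000, -7095936, 15180488, 26827816,
  -111838272, -33678336, 189406344, -297912376, 109270208, 258982400, -259262888, 54472824,
  -40895104, 54860736, 7098840, -20568120, 2962848, 1338432, -161280], [0, 24576, 34752, -510528,
  -975488, 12820544, 11206856, -11564704, -5647816, 54195424, 20195512, -246913728, 53297880,
  214671296, -477934040, 217607008, 335292648, -365911712, -19016152, -36706624, 69349576,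
  6506944, -15454608, 395648, 487360], [0, -27648, 97280, -104512, -4297792, -4120416, 34005440,
  30105280, -29447960, 25632968, 119507328, -23920896, -356421464, 231684872, 178263232,
  -570879616, 381417144, 342417368, -370247616, -112784512, -23867144, 53245880, 5475264,
  -6113920, -281856], [0, -2048, -256, 603136, 17296, -17286784, -14337040, 58814336, 37963896,
  -58489248, 81205824, 176856608, -133288152, -358611072, 373432176, 72375232, -497417880,
  507446880, 318772896, -245873248, -121458040, -7505344, 25061824, 2776320, -779296], [0, 8704,
  -64640, 243200, 3433280, 2643888, -36429184, -28410912, 76069592, 10005016, -75317312,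
  138913056, 180214424, -244619144, -271427456, 329062368, -114922360, -362636472, 419541248,
  226796576, -107807032, -64982920, 1052864, 6345984, 367616], [0, -3072, -5184, -416192, 127264,
  9677600, 9029640, -46331680, -28530344, 75163104, -39796648, -63675584, 170714296, 135181824,
  -222596920, -117535264, 195053640, -212248480, -225288440, 199733568, 97986504, -34116448,
  -18006000, 1879680, 756928], [0, 512, 24064, -44608, -1362944, -1700384, 13537312, 12052768,
  -41163912, -9473032, 52482560, -69201952, -38080200, 140105656, 71675776, -97614560, 26995816,
  115485032, -125510080, -85051744, 57440232, 22491912, -7949792, -2014848, 430848], [0, 0,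
  -6016, 114176, 191184, -1872544, -3006368, 11705664, 8572960, -25695808, 11474144, 25394752,
  -57674672, -19524032, 55308096, -863616, -39992496, 35377088, 42158816, -37173696, -15335200,
  9896672, 1886752, -995904, 60048], [0, 0, 384, -25984, 116992, 413168, -1557152, -2517952,
  6095704, 1361976, -12406976, 13744064, 8783768, -22433256, 2472384, 14904640, -9098744,
  -11578712, 11016832, 6272384, -5570040, -705256, 802208, -90432], [0, 0, 64, 1856, -24640,
  52352, 370872, -654816, -792760, 2564128, -1078520, -3830848, 5508968, 62400, -5366376,
  3334560, 1932504, -2119264, -1254120, 1444160, 69816, -264704, 44368], [0, 0, 0, 64, 1216,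
  -10528, -768, 114432, -196808, -133608, 703104, -608192, -403336, 1148120, -582720, -449216,
  571048, -65336, -119616, 11072, 27880, -6808], [0, 0, 0, 0, 16, 192, -1072, -896, 13548,
  -24304, -9272, 83856, -104236, 16096, 86912, -100320, 48916, -8368, -1944, 976, -100]], [[0, 0,
  0, 1792, -7168, 1344, 30464, -34608, -42560, 88928, 7616, -98896, 36736, 51072, -36736, -8400,
  12992, -1568, -1344, 336], [-2048, 6144, 40448, -216384, 309824, 198032, -1392800, 2455512,
  -1754616, -1560752, 4661024, -3905256, 1020168, 413104, -960544, 1810184, -1895784, 959664,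
  -111712, -144056, 86040, -16192], [4096, 15360, -86272, 426496, -1656160, 2325984, 3182088,
  -15464680, 24079960, -15951200, -13676144, 42573080, -38902952, 14620640, -1280096, -4247096,
  11287176, -11969632, 5632560, -223224, -1103576, 477184, -63592], [4096, -24576, 191488,
  -170112, 882816, -4388928, 8908768, 13014312, -71942760, 110461040, -68854848, -63817240,
  197003608, -179350160, 64740032, -15100744, 1629640, 26605968, -34418560, 16345592, 504520,
  -3110704, 965920, -79168], [-12288, -61440, 183040, 771584, 1840256, -3370016, -6856368,
  32085224, 1487544, -179225696, 315486368, -196515864, -164909384, 562505952, -493963008,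
  135152568, -32184600, 37556768, 24200608, -61588232, 28659432, 2137472, -4201360, 853120,
  -31680], [0, 49152, -772608, 1792064, 5287616, 5328816, -19956032, -13119304, 101443944,
  -135732592, -254650720, 651576504, -475274008, -203000528, 1068201504, -910048664, 119831864,
  17248880, 100653600, -12997208, -76504008, 30500384, 2671712, -2809280, 278912], [12288, 71680,
  -71680, -3403520, 6649760, 30378784, -1051144, -48530824, -3512552, 198843744, -486043728,
  -168181896, 1030317848, -999816032, 43056800, 1417283432, -1225992632, -44666400, 183485456,
  162243624, -48276632, -62572288, 19058600, 1481088, -763776], [-4096, -45056, 822272, -2616064,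
  -13033088, 20576480, 91165312, -27361720, -76719304, 108414128, 188758592, -918187832,
  154723192, 1215225840, -1587565952, 596000728, 1376992296, -1313528752, -247272448, 333301272,
  173105960, -42832336, -28561216, 6673920, 356480], [-4096, -20480, -27136, 3470592, -11766400,
  -44170656, 51809440, 151611496, -78637384, -62505504, 344694784, -30352216, -1137020424,
  620880096, 937264512, -1746440264, 1099430184, 1027041376, -1149395648, -322978632, 290924712,
  106304128, -20374880, -5616256, 1044480], [2048, 10240, -322048, 1757504, 11201984, -26973328,
  -93586080, 95921160, 142206232, -160796176, 42476640, 504818120, -339649128, -997542256,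
  881456928, 259623064, -1315051960, 1158561808, 619145696, -744058280, -217294648, 138150912,
  30066496, -6650368, -251776], [0, -5120, -6400, -1643008, 6378720, 26546336, -40902792,
  -113167416, 130170312, 55170912, -220926224, 198303816, 436246088, -457893856, -563977248,
  734079064, -285320616, -688415904, 769917520, 290681112, -303034056, -63379328, 39380072,
  2421888, -955520], [0, 4096, 43008, -462464, -4704896, 9074816, 37587296, -48651528, -73526072,
  130846288, -39098560, -179334600, 259961480, 239858128, -311201856, -109857880, 397450712,
  -344223312, -255492224, 294538344, 70278104, -74095184, -3844064, 5232960, -382592], [0, 0,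
  7936, 400896, -742016, -6730464, 8139088, 30526008, -45741208, -19060000, 86566944, -86133576,
  -90778264, 150386592, 46716928, -141524696, 63270776, 138420832, -144200544, -47645208,
  62757496, 2647552, -8502544, 1256448, -38976], [0, 0, -2560, -44096, 653632, -491696, -5549440,
  6241128, 13504376, -28298192, 10778080, 39874152, -53820808, -9974128, 49219296, -14283784,
  -42283032, 37265616, 20807776, -27528008, -654104, 5823776, -1303968, 65984], [0, 0, 512, -256,
  -66336, 470624, -107896, -2659160, 3912392, 2050720, -11224112, 9342760, 7113032, -17336992,
  7138784, 8068728, -7015720, -4725472, 6458224, -207176, -1715144, 539776, -37288], [0, 0, 0,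
  512, 128, -35104, 139840, -32360, -730520, 1434768, -388416, -2152168, 3143336, -818992,
  -2025728, 1904072, 28216, -718736, 168960, 148872, -73672, 6992], [0, 0, 0, 0, 128, -160,
  -4160, 16808, -8344, -79296, 198016, -146168, -138136, 381216, -335616, 121912, 15288, -30912,
  10688, -1256, -8]], [[0, 0, 1792, -7168, -896, 39424, -37744, -74816, 129640, 41888, -184576,
  43232, 127736, -73920, -37296, 38528, -168, -7392, 1568, 224, -56], [-6144, 55424, -137216,
  -110560, 1176800, -2551432, 2490960, 801376, -6923448, 10600600, -6610224, -794912, 4167752,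
  -4644152, 5518128, -4978080, 2245208, 100488, -737360, 457792, -135880, 14880], [14336,
  -101632, 341696, -465856, -2342096, 12901600, -25948460, 21190368, 14791504, -70289536,
  102363104, -69187680, 4733872, 25002368, -27740632, 33896480, -31262992, 13731584, 1074688,
  -4831968, 2713312, -643040, 58980], [12288, -55808, 252416, 611200, -1426816, -8873776,
  52601776, -115929776, 91132168, 88709672, -339189072, 475182000, -316605688, 20044296,
  84585616, -58706288, 80864536, -90532744, 43992528, 1130704, -12835752, 6064264, -1102528,
  74784], [-45056, 243968, -235904, 3055936, 2103136, -20419280, 11511568, 97566560, -319737416,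
  315921056, 222337912, -944850944, 1333696376, -852280736, -54330696, 255014816, -46473656,
  74968608, -152943128, 90986624, -4131640, -17490256, 6330968, -829632, 30816], [0, -130432,
  -205312, 4112288, 9198560, 3959320, -99434448, 145870784, 36710408, -658315880, 981472336,
  83034016, -1604477432, 2546341768, -1576497936, -403684512, 666302232, 31289224, -62513616,
  -157011712, 122978424, -9128256, -12344736, 3042464, -235904], [49152, -176640, -612544,
  -4298752, 27856016, 27713712, -42474964, -205142176, 404719488, -300007040, -1033000720,
  2285685216, -892716704, -1594276512, 3604697320, -2295697760, -908344192, 1276829696,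
  118989424, -265492576, -94888432, 101280368, -6200756, -3690368, 526336], [-12288, 231424,
  144384, -8659200, -9169920, 89388464, 73516016, -215618704, -142801272, 609286440, -1046372304,
  -986924752, 3541327240, -2569419960, -576348144, 3926612432, -2892404456, -1110605448,
  1662847312, 136330704, -339674792, -32107416, 43368064, -1829696, -109184], [-20480, 33280,
  847360, 2650752, -42680064, -6326176, 199384152, 87173536, -408840872, 229220960, 559938376,
  -1975261696, -61673512, 3461300736, -3727176840, 867491232, 3218824840, -3049929760,
  -842212008, 1424954688, 76945032, -221094560, -4760688, 6195968, -505152], [6144, -121472,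
  33792, 6243680, 5085088, -105931096, 6674480, 312238048, -61642216, -364451576, 693453040,
  193082272, -2328860520, 1205442328, 1921018256, -3335322464, 1814075464, 1908173656,
  -2354464112, -385950016, 768352744, 11894880, -69845312, 1577920, -146560], [2048, -256,
  -434880, -899008, 22905680, 1714112, -158468244, 45259808, 307022608, -308605824, -76238720,
  851442272, -304380112, -1669795776, 1623789624, 235988064, -1917730000, 1699694336, 765483296,
  -1166506144, -69961664, 232953216, -11855492, -9325184, 220928], [0, 20992, -60928, -1935232,
  -3204992, 41538416, -8162032, -150488912, 115868888, 153006648, -378212976, 179105552,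
  602120024, -527245608, -621452240, 1036709424, -499342328, -720868696, 863685104, 147765872,
  -328285496, 22040280, 31219008, -4012256, -140160], [0, 1280, 107648, 317504, -4298272,
  -3956880, 41259168, -22482912, -92465272, 139365600, -18442616, -231477376, 209923208,
  228790112, -347705176, 8214496, 382414136, -339103904, -135287912, 229964928, -13622024,
  -40628240, 9215000, -68672, -33824], [0, -128, -10752, 121568, 933792, -4851256, -933296,
  25198592, -25673576, -26555704, 89423856, -64743456, -63965928, 104937624, 12220496,
  -120900704, 77784648, 63769240, -86816880, 2486784, 25207912, -8083264, 403424, 47008], [0, 0,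
  1216, -17536, 44272, 837296, -3064684, 1223584, 9049120, -16703872, 3201456, 25708576,
  -32194880, 1663200, 26425784, -14970656, -15436704, 19215872, -512144, -7225376, 3068880,
  -293904, -19500], [0, 0, 0, 1280, -12032, 2576, 286800, -1015664, 940440, 1717368, -5249136,
  4664848, 1154072, -5825064, 3658032, 1521520, -2804280, 658792, 648944, -416528, 66440, 1592],
  [0, 0, 0, 0, 320, -2816, 4200, 28960, -132864, 192128, 59064, -594528, 881712, -561920, 9176,
  239712, -165472, 44928, -1016, -1824, 240]], [[0, 1024, -4096, -3328, 33792, -23680, -90624,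
  128464, 90816, -245216, 12736, 228400, -99968, -101568, 79744, 13104, -24640, 3360, 2240,
  -560], [-1024, 60672, -410112, 1111552, -1130784, -1276000, 6487920, -11923464, 11583272,
  -1723552, -10025552, 13248568, -10871320, 9818464, -7668464, 2300136, 1986680, -2682272,
  1564624, -542488, 96152, -3008], [6144, -157696, 1118848, -4380672, 9849600, -7462640,
  -21532880, 75997512, -120875880, 109081616, -21420944, -77147896, 98456728, -69678096,
  58668240, -48558248, 16429000, 10715760, -15772400, 9111128, -2817016, 382080, -12288], [1024,
  -37376, 328704, 2245888, -16650112, 39823872, -30439280, -108956472, 380016440, -573979968,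
  482944016, -71151160, -356913032, 382227520, -174869264, 127268312, -144879576, 69727360,
  14104304, -36946024, 20976552, -5317504, 492416, -16640], [-24576, 532480, -1717504, 9729536,
  -17789504, -30299296, 133069792, -179212664, -164671912, 1029459616, -1656675872, 1341283208,
  -102085096, -1171694752, 1063864672, -200751592, 39882632, -229894368, 177149408, -16382504,
  -43924536, 24251264, -4311040, 220160, -7552], [2048, -242944, 2263552, -1620224, 33053152,
  -103840160, -16558160, 390058648, -812840760, 435750432, 1569686896, -3295283112, 2839297032,
  -261523296, -2658329520, 2271360840, -38998312, -410250848, -149513200, 267408712, -60648456,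
  -29123008, 14254208, -1154688, 13952], [36864, -612352, 113536, 1514240, 34728384, 16908336,
  -282714736, 137708232, 670376472, -2091625424, 2445733456, 1012026632, -4750518504, 5056377680,
  -1231617936, -4063749544, 3682008520, 111664592, -1043656016, 76869720, 238864328, -61922688,
  -12245632, 3283584, 116608], [-2048, 412672, -3770368, -3433472, 9499776, 144513600,
  -132293680, -506845784, 656824984, 183025920, -3038888752, 5239084584, -1139379368,
  -4722122240, 7211738416, -3268134664, -4105360696, 4458820672, -14145488, -1269069640,
  198627144, 123175552, -26705408, -3774848, -185472], [-24576, 289792, 1231360, -11108608,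
  -33545216, 90362880, 259642304, -398804760, -520744168, 1392761088, -1544338880, -2242372568,
  6581137880, -3911788224, -2470329344, 7418651960, -4973457976, -2592144704, 3914246656,
  -226650056, -856976184, 134088448, 35500544, -3247488, -437120], [-1024, -226560, 2187776,
  4715520, -31258976, -93745824, 265563472, 221937640, -617104392, 10576544, 1528737296,
  -3179130840, 24915640, 5097081760, -5186976208, 646231096, 5033440104, -4701251424, -851853712,
  2305269560, -235589688, -307453760, 41016832, 5957760, 184192], [6144, -65536, -839296,
  6604288, 17275520, -78591376, -111044272, 387795096, -14973432, -593610128, 784147216,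
  680733272, -3034889592, 1750279824, 2086648752, -3961609528, 2183230360, 2025613840,
  -2772026768, 5051080, 784248024, -116221312, -51110912, 5693824, 877696], [1024, 34304,
  -506880, -2278144, 12699264, 33188480, -125811280, -25872552, 320480808, -264905536,
  -296360400, 977520856, -291679896, -1548061120, 1713215184, -55858424, -1747323528, 1634791168,
  357834448, -915306680, 130708984, 120573312, -24954240, -2584448, 455296], [0, 12288, 195328,
  -1107968, -4700736, 17173984, 26749664, -119631528, 74470856, 140998048, -294332704, 37232600,
  550492808, -491973536, -288191520, 802693128, -483686056, -375995232, 558258016, -56467128,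
  -131914856, 38800256, 2039808, -1172096, 56576], [0, -768, 5632, 388864, -966496, -5283680,
  17299344, 2708872, -62766056, 85487584, 5774032, -152284856, 120095064, 113290848, -235099024,
  79363480, 171505480, -188016800, 340400, 75552920, -28499288, 158912, 1038720, -93184], [0, 0,
  128, -18688, 324800, -510896, -3124752, 10921816, -9416888, -13752496, 39211056, -24510568,
  -28345912, 53728304, -13286128, -41421944, 39122648, 3912624, -21934128, 10182280, -767144,
  -365440, 51328], [0, 0, 0, 512, -19328, 136512, -230928, -745928, 3598344, -5444736, 1477872,
  6721848, -9726776, 2451328, 6531856, -6629336, 649624, 2473024, -1528304, 259688, 34072,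
  -9344], [0, 0, 0, 0, 128, -4288, 28544, -68248, -9720, 404128, -935616, 939080, -154616,
  -680512, 795968, -376456, 33176, 45664, -19968, 2776, -40]], [[256, -1024, -3072, 17408, -4800,
  -71936, 79296, 116224, -223354, -49176, 287820, -79032, -185062, 112336, 49896, -54320, 1050,
  9800, -2100, -280, 70], [5120, -26368, -99840, 1054976, -3424256, 6050144, -5908224, -230720,
  12063176, -21080248, 18696576, -10791488, 7128584, -4358072, -2061760, 6890112, -6337960,
  3395288, -1189568, 229376, 2520, -7368], [-15872, 98816, 184576, -3171584, 14720704, -39559872,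
  63051792, -49802176, -18777464, 118650176, -178815688, 138804320, -58428344, 31957856,
  -29238888, -3313920, 34872664, -35075584, 19273832, -6363808, 896280, 81440, -29256], [-13312,
  66048, 728064, -2282368, -10508544, 67369920, -188527168, 307394752, -219786968, -150069816,
  602542400, -804447328, 510575720, -61273208, -17184128, -97737888, 54728312, 51290456,
  -75544192, 44173344, -12689160, 940952, 291072, -36960], [48896, -82432, -83712, 7470848,
  -44860128, 57176896, 88731520, -481979008, 977914120, -803111520, -417587776, 1851242720,
  -2415779064, 1320569152, 306801040, -500648064, -118320184, 235215904, -26037344, -78452000,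
  53463576, -11768896, -274032, 364608, -15120], [6144, 92928, 863232, 993024, 17008512,
  -202076704, 440078912, -286314752, -632198968, 2302996456, -2604762560, -8471520, 3456903560,
  -5165789464, 2816218752, 1184745312, -1734585384, 154702264, 417767808, -164784608, -41934632,
  37415576, -4812928, -992160, 153984], [-50176, -156672, 961024, 3701248, 29829120, -89581312,
  -339495568, 1182240704, -1496024072, 177141184, 3829555720, -6166063968, 2678547192,
  3524262176, -8012963160, 5057180416, 1755488104, -3100262144, 669974616, 419657376, -207568920,
  -15099104, 15705480, -411648, -453696], [10240, -246784, -2951168, 6707328, 20253824,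
  108195776, -519672320, 52631552, 1545129064, -3259714840, 2788006784, 3613593280, -9401217496,
  7340216744, 582009408, -8858059520, 7080800952, 1068497848, -3313897920, 891984512, 282065592,
  -123054088, -6271488, 4138304, 181120], [16128, 249856, -1380864, -13153792, 18374240,
  112660224, 84554528, -1056969984, 1126538116, 520277232, -4163330296, 6248817456, 178700956,
  -8504846496, 10321034480, -3658262688, -6513829988, 7061870640, -198145144, -2192306192,
  595263940, 136701056, -36234272, -1212288, 673440], [-11264, 147200, 2269696, -7215360,
  -35133184, 40114208, 299044480, -247520832, -950894312, 1998423640, -1566078720, -2833346560,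
  7378783064, -4063876776, -3551943104, 8681917248, -5666606648, -2688362488, 4626604864,
  -671393728, -876150200, 206576936, 40156416, -6518848, 66176], [512, -138752, 597248, 8226560,
  -20279872, -68433856, 100411632, 366304448, -651702344, -59088960, 1716055752, -2855973728,
  -111002824, 4781510304, -5103896728, 849554944, 4274707624, -4297027328, -235456616,
  1797312416, -376489752, -185903520, 40773192, 5493248, -719424], [3072, -32256, -680960,
  1962368, 16182784, -34169536, -85084992, 181976512, 139701688, -649850664, 678893376,
  594091296, -2247024904, 1469507096, 1291267584, -2964623008, 1875452840, 1000413320,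
  -1746716416, 277502752, 338099496, -92463800, -15388416, 4660000, -124800], [256, 30208,
  -68352, -1793280, 3582176, 18421312, -40875456, -47395712, 187683784, -119849568, -273163392,
  648189408, -209362104, -828361152, 1122009552, -288006784, -830106872, 910504480, -46807328,
  -314530848, 101573912, 16338368, -8629872, 620864, -3600], [0, -768, 59392, 35072, -2304128,
  4120736, 11642432, -36152192, 7614552, 91081336, -151723200, 10253856, 249763096, -267407496,
  -41948928, 336212704, -266565624, -46362776, 163922432, -60855904, -7382264, 6812936, -826496,
  11232], [0, 0, -2048, 37888, 105344, -1603200, 3229072, 2939712, -18937016, 23199552, 9905400,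
  -56740768, 50511240, 21538528, -78638760, 48833024, 24267672, -47701504, 20225192, 801376,
  -2397672, 437856, -10888], [0, 0, 0, -1664, 9856, 61248, -610432, 1612160, -843592, -4008328,
  9219072, -6492032, -4956552, 13092024, -8014528, -2918848, 6794024, -3476888, 323392, 293440,
  -86232, 3880], [0, 0, 0, 0, -416, 2176, 10592, -112384, 365990, -540184, 136812, 824520,
  -1435142, 1033296, -165432, -288304, 232058, -69304, 3884, 2152, -314]], [[0, -1024, 4096,
  3328, -33792, 23680, 90624, -128464, -90816, 245216, -12736, -228400, 99968, 101568, -79744,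
  -13104, 24640, -3360, -2240, 560], [0, -22016, 150016, -264960, -555520, 3553616, -8687328,
  13705384, -13789448, 6059696, 2752096, -4620056, 4360056, -8395504, 11543456, -8930184,
  4180072, -1202608, 99040, 109816, -52440, 6816], [-3072, 144896, -840192, 1936512, -711744,
  -12127392, 48309368, -97913560, 125217832, -97247616, 13129104, 59901224, -52460056, 16846784,
  -28850560, 54796792, -47681800, 23544768, -6608848, 42808, 804664, -256864, 26952], [4096,
  98816, 201216, -5703424, 17862912, -14947392, -51298240, 247087640, -512798424, 603819600,
  -371301952, -106616296, 461829480, -323091376, -6020352, 48900296, 70233208, -98601808,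
  54528768, -14358136, -1471496, 2067184, -459264, 34944], [21504, -322048, 2277376, -7218432,
  -15412608, 109099808, -191659120, 80042136, 531469736, -1546091072, 1958320160, -1159768424,
  -511245592, 1812802176, -1303198848, -27455032, 388819064, -81713664, -91717728, 72062088,
  -17228296, -3948384, 2416944, -366720, 14976], [-4096, 95232, -875520, 9422336, -54112256,
  25753168, 335582752, -887930808, 1162681304, -60785616, -2742409824, 4512769800, -3274969256,
  -531007856, 4116058336, -3350966312, 245378056, 838466000, -361068128, -24652968, 66380232,
  -12605152, -3971648, 1273728, -112896], [-38912, 300032, -690688, 5895296, 4609600, -198762496,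
  366116520, 307470728, -1862488088, 3713793152, -3021834768, -2295635192, 7172515624,
  -7220342912, 1514982976, 5577967896, -5477938888, 883343552, 1002698704, -506292520, 19323512,
  46468928, -5058728, -1468672, 231168], [-4096, -410624, 1305600, 24576, 37265920, -88767808,
  -385831808, 1231189624, -925415992, -1334051120, 5936788736, -7699087624, 1362457352,
  7010249936, -10878101824, 5490550888, 4297238872, -5789878480, 1304926656, 788444200,
  -396013864, 13196912, 20521472, -782848, -8960], [26624, -131072, -1699840, 1029888, 21105792,
  88763264, -378341664, -217047464, 1915978088, -3153321920, 1873839040, 4755243928,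
  -10144993752, 6505167360, 2580144960, -10395427320, 7837417272, 1375507712, -4018141952,
  1062179592, 426868920, -183834304, 429344, 3273216, -173056], [4096, 317952, -771584, -6485760,
  -1027072, 86577904, 86556512, -742611720, 610769640, 1092250512, -4026963552, 5197407160,
  401684840, -7503132496, 8588696416, -2594070424, -5737528776, 6219412848, -443067360,
  -1815118872, 508029048, 143108448, -46641792, -585216, -33536], [-7168, -2560, 1382912,
  -2046592, -18846656, 4669536, 168829384, -63434504, -716458696, 1391644288, -808022160,
  -2263242504, 5164771448, -3023265856, -2314559744, 5916888936, -4011572696, -1355024320,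
  2863075280, -557355992, -486034712, 143995680, 20874744, -5655296, -271104], [0, -81408, 82432,
  3410176, -4017408, -32774464, 25456192, 176617800, -273744520, -174769808, 1162281664,
  -1675119800, 74602296, 2491986032, -2974536320, 795135832, 2009455720, -2232797808, 170889600,
  695504280, -202603288, -56018992, 21245440, -4736, -198912], [1024, 11776, -303104, 262400,
  5173632, -6321120, -30837488, 49581128, 80106424, -295068480, 270632736, 319361608,
  -1034533256, 804987520, 333967872, -1227124520, 921937832, 157664896, -539107808, 155305240,
  63255336, -30922720, 1561520, 434816, -27264], [0, 2048, 38912, -451584, 361984, 4453744,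
  -7728288, -14416872, 48661576, -19196528, -121366944, 244529752, -110244408, -230621264,
  405272608, -194441912, -165147816, 247035504, -70235296, -35920440, 22019224, -2328864,
  -320832, 45696], [0, 0, 512, 39296, -332352, 396352, 2082072, -5730216, -564040, 22756480,
  -35664624, 1759960, 62325880, -81295616, 17713216, 61579656, -68668504, 20034880, 9996336,
  -7820856, 1340776, 76544, -25752], [0, 0, 0, -512, 18944, -134464, 261888, 419880, -2323048,
  2633072, 2525824, -10442328, 11288152, -843152, -10510144, 10991992, -3788856, -1004912,
  1209792, -313672, 6728, 4816], [0, 0, 0, 0, -128, 4288, -28544, 68248, 9720, -404128, 935616,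
  -939080, 154616, 680512, -795968, 376456, -33176, -45664, 19968, -2776, 40]], [[0, 0, 1792,
  -7168, -896, 39424, -37744, -74816, 129640, 41888, -184576, 43232, 127736, -73920, -37296,
  38528, -168, -7392, 1568, 224, -56], [0, 4224, 8192, -190432, 648608, -849800, -225104,
  3326400, -7937224, 10465096, -7980752, 5187776, -7150536, 9195128, -6328368, 1881344, 254760,
  -557928, 370256, -149408, 28616, -848], [11264, -54528, -128320, 1233984, -3790352, 6892864,
  -2474732, -22265664, 63970976, -99834784, 98437040, -46347584, -3147200, -6853024, 37378744,
  -34008256, 12072928, 650784, -3368592, 2297088, -777904, 108256, -2988], [8192, 50688, -807936,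
  1033856, 7843328, -30676080, 56646832, -37682480, -118718600, 384341656, -575489712, 519169552,
  -163852296, -186627080, 176980144, 13436912, -75179160, 35338696, -1920464, -7993232, 5441320,
  -1474024, 133920, -4032], [-27648, 208128, 6272, -6669504, 23730784, -1491280, -114200816,
  300661280, -397647176, -47711776, 1051074904, -1871309632, 1834861144, -649586144, -696052712,
  815230816, -209850456, -82996000, 69078408, -13058112, -9584536, 6482800, -1197704, 50880,
  -1920], [-12288, -121216, 1519616, -5001312, -18890720, 129311576, -168271248, -126080448,
  851977272, -1745893304, 1303984496, 1039405440, -3525427784, 4319205048, -2080129008,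
  -1147866048, 1739531304, -598202472, -39539184, 98961440, -25626424, -6520944, 3982848,
  -292800, -3840], [22528, -195072, 124224, 6001920, -41836720, 24820816, 320560876, -725626112,
  529716272, 957600672, -3858955488, 4772946368, -1544934960, -3407239296, 6671030360,
  -4282068096, -864566384, 2224049632, -849261824, 3626944, 97763104, -23169872, -3072676,
  985856, 65536], [-4096, 110592, -643072, 4590848, 3487488, -142717712, 282013200, 294811152,
  -1457016008, 2355157272, -1018851824, -4157956976, 7985980216, -6139938632, -191241808,
  6642849392, -5630621016, 43772744, 1843498608, -744034192, 3284200, 59577848, -9722944,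
  -1160832, -58624], [-6144, -7680, 43520, 116864, 23511040, -55324192, -226747688, 751553440,
  -404661032, -1258393632, 4082682248, -4676591488, -655389160, 6884916096, -8598862920,
  3653151008, 4007195848, -4822895008, 688828440, 1010533568, -408628664, -11081120, 19875792,
  -1548928, -173056], [12288, -49792, -321536, -1044128, 9210080, 51711656, -200437872,
  -90351680, 973711464, -1508278632, 487054480, 3327596096, -6267891352, 3673842600, 2106056816,
  -6526586624, 4646583480, 1114685448, -2669522448, 625548320, 353502616, -130072176, -7779968,
  3539840, -79104], [-1024, 69376, -64192, -1951680, -3541872, 33906656, 43065516, -312353856,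
  266546112, 510718880, -1837246544, 2199439168, 469962144, -3924610976, 4451531176, -1391121344,
  -2650002624, 2915717088, -185625936, -891522176, 261436624, 65215808, -22675956, -1473280,
  388608], [-4096, 2560, 263168, -55424, -5176832, -3800016, 56917456, -23645200, -233425496,
  488983560, -234420496, -947567312, 2043026728, -1339038680, -755699312, 2265995984,
  -1605352200, -380485608, 987856272, -236028336, -140698312, 52359560, 3541024, -2025920,
  88320], [1024, -20224, -2432, 624704, -146464, -7245712, 2647072, 46883168, -79329272,
  -43662304, 343708776, -494855104, 35209576, 756687392, -1016795896, 404475040, 468692376,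
  -601593312, 98957112, 144847296, -59694184, -2519504, 3453112, -328768, 6528], [0, 2944,
  -34816, -14624, 718176, -518776, -5582768, 9401920, 14813224, -62848040, 58308816, 79497600,
  -255530840, 240982312, 9026992, -250266688, 220620792, -11957816, -81651280, 37421408, -151080,
  -2627536, 403328, -13248], [0, 0, 2752, -29056, 11824, 437904, -761260, -1964928, 7355504,
  -3734432, -19172736, 41714752, -24844464, -32883264, 74453576, -51404544, -3439536, 25644064,
  -13033504, 935872, 913856, -212176, 9796], [0, 0, 0, 1280, -13056, 19280, 150128, -514768,
  92072, 2014792, -3540560, 135728, 7777192, -12277464, 7567888, 789712, -4099848, 2345176,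
  -376368, -112944, 44728, -2968], [0, 0, 0, 0, 320, -2816, 4200, 28960, -132864, 192128, 59064,
  -594528, 881712, -561920, 9176, 239712, -165472, 44928, -1016, -1824, 240]], [[0, 0, 0, -1792,
  7168, -1344, -30464, 34608, 42560, -88928, -7616, 98896, -36736, -51072, 36736, 8400, -12992,
  1568, 1344, -336], [0, -768, -7296, 34752, 23968, -333440, 766544, -935864, 274584, 1316064,
  -1718256, -771704, 2897368, -1418208, -1107920, 1640408, -962872, 438112, -169488, 32408, 3368,
  -1760], [-2048, -23040, 132736, -88640, -631648, 2860144, -7367920, 9349304, 177448, -22162160,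
  47124144, -52127624, 21401448, 12973360, -14196784, -1336920, 7277432, -5217552, 2626384,
  -880792, 88920, 30816, -7008], [0, -51200, -35072, 1522304, -3395200, -1381504, 19715728,
  -57657736, 84703816, -25110720, -128674768, 301901688, -361242104, 201746624, 13652368,
  -67865368, 19348568, 8809856, -10490416, 6133416, -1714728, 12032, 81632, -9216], [8192, 33280,
  -724992, 1800832, 6538496, -30680416, 35295744, 23520888, -205272760, 432082048, -349358624,
  -147277448, 814737480, -1182315072, 766808096, -55030808, -182650984, 86832704, -10625440,
  -9900632, 7831960, -1533216, -206432, 91136, -4032], [0, 122112, -196480, -3596736, 16916064,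
  372000, -110994384, 230490856, -213025224, -257843232, 1164648464, -1470046936, 656516600,
  943235936, -2226616080, 1676470200, -236298072, -300251552, 171392240, -41286664, -5379640,
  6138944, -549536, -256512, 37632], [-12288, -1024, 900224, -3893696, -5290208, 71170800,
  -99355312, -140149256, 589533864, -1029370448, 473354192, 1538249912, -3037447960, 2671257552,
  -203707280, -2566797208, 2357694456, -446485296, -317624656, 196781224, -47903656, -3721536,
  2908992, 6656, -98048], [0, -96256, 343552, 2293504, -20136256, 22026528, 150831728,
  -380405032, 207928616, 597176768, -2078087376, 2265156056, 292247656, -3281991808, 4509674320,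
  -2126619896, -1754677256, 2223606016, -513761840, -226325432, 142847672, -25895776, -2691264,
  726272, 23808], [8192, -15360, -355328, 2796032, -1785216, -51639008, 124278080, 111615576,
  -640982328, 982046688, -340956928, -2069140328, 3673617928, -2128689952, -1321137344,
  4267183112, -3042748200, -534567712, 1419260096, -382001656, -112871080, 64889152, -5738048,
  -594688, 111232], [0, 26368, -161664, -93632, 8893792, -23485888, -65090896, 263281112,
  -172889784, -432726624, 1447368880, -1624257896, -531442936, 2984700128, -3343138672,
  963921288, 2271064536, -2287537888, 142104400, 601205448, -180278408, -37290208, 16194624,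
  -370432, 4352], [-2048, 7680, -8320, -740288, 2799840, 13555920, -58027472, -10835096,
  272127672, -478650000, 192725072, 962052264, -1871371656, 1013697232, 953815472, -2358154568,
  1528680232, 526168464, -996980560, 191777016, 153952200, -50087072, -5278816, 1940480, 59136],
  [0, 0, 27392, -268160, -1383680, 7907904, 7548784, -69610392, 80066904, 94426816, -445251056,
  558528616, 81028760, -987757888, 1166733232, -310809928, -785346168, 814630272, -57209360,
  -232231688, 69303432, 16529088, -7043616, 127744, 52992], [0, -1536, 23552, 62080, -720640,
  -908064, 9549696, -6704216, -39327464, 104220480, -71460256, -157123416, 392522136, -286954496,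
  -148014048, 494223224, -354770424, -58886144, 188561248, -53935944, -19731192, 10157536,
  -680288, -109312, 7488], [0, -256, -3200, 42944, 42656, -802016, 510672, 5732600, -13013528,
  -1657440, 50108208, -82538312, 22946600, 103991200, -165253552, 75655400, 65051832, -91799264,
  25672144, 11737256, -7369832, 884608, 74336, -13056], [0, 0, -640, -64, 36704, -45104, -406160,
  981992, 1164664, -7306800, 9107248, 4518440, -26347208, 30129712, -3438576, -26759368,
  27355496, -7696208, -3565744, 2781944, -505720, -12416, 7808], [0, 0, 0, -512, 1216, 17696,
  -60528, -61368, 474424, -415680, -1189232, 3377224, -2936584, -1266432, 5165936, -4623528,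
  1409064, 486400, -500112, 128536, -4888, -1632], [0, 0, 0, 0, -128, 160, 4160, -16808, 8344,
  79296, -198016, 146168, 138136, -381216, 335616, -121912, -15288, 30912, -10688, 1256, 8]],
  [[0, 0, 0, 0, 1120, -4480, 1568, 16128, -20356, -17136, 42840, -3248, -38332, 18592, 14448,
  -12768, -700, 3024, -616, -112, 28], [0, 0, 1920, 1024, -30016, 48400, 22208, -151328, 210712,
  139608, -1059392, 1420320, -227880, -1105288, 1048832, -358432, 54600, -15352, -13568, 20256,
  -7416, 792], [0, 5120, 15680, -124352, 222880, -160096, -754952, 3752480, -7078056, 6513440,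
  669080, -13727744, 21215992, -12208832, -1528088, 4950560, -2191608, 574496, -85048, -159360,
  128008, -32544, 2944], [0, 3072, 90112, -127680, -1015424, 3218848, -4433120, -275936,
  22399288, -52775560, 57649152, -19167456, -59356168, 117301432, -85399936, 17382752, 8383144,
  -5345304, 2067008, -348960, -491864, 292936, -54240, 3904], [0, -18432, 59776, 759552,
  -2887632, -771360, 15589056, -35793216, 43105536, 28524608, -169652384, 242343872, -163465968,
  -91722816, 329445248, -273599232, 79594000, 3257152, -8266656, 4839872, -855360, -758304,
  310912, -40000, 1776], [0, -10240, -192128, 972416, 2020352, -16580272, 19725280, 20600192,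
  -112761128, 229390648, -130273856, -247483968, 570999320, -586130984, 79351616, 530823872,
  -507681912, 159857320, -7898624, -10751104, 7522952, -1007368, -623712, 142336, -11008], [0,
  24576, -167488, -785856, 6580864, -4784960, -42248632, 95577824, -72570872, -125176096,
  539833096, -597529344, 11860200, 755275520, -1188159304, 549410400, 497873880, -597714464,
  190155032, -11819520, -12009096, 7011200, -434400, -217728, 15168], [0, 12288, 149504,
  -1279552, -29248, 21149088, -42240960, -34143936, 191485496, -334695592, 149510144, 637296000,
  -1120636808, 699791256, 411043520, -1474093056, 992237480, 231514248, -463908544, 148004224,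
  -5127704, -9439512, 3380160, 16896, 4608], [0, -14336, 143616, 210432, -4983408, 9627008,
  31713264, -108931200, 76326008, 144296288, -577369344, 649910304, 214302696, -1130999424,
  1312856880, -297392960, -1115824344, 979402080, -16959776, -240466016, 77203144, 1636928,
  -4260096, 617984, 2848], [0, -6144, -43392, 641792, -1084480, -9862352, 32167680, 6462560,
  -133000056, 238091400, -111763904, -477688416, 892863176, -429900312, -529369216, 1253037152,
  -703502184, -461071464, 580139008, -86321120, -82181288, 25450184, 2000064, -899456, 35072],
  [0, 3072, -48960, 53440, 1495072, -5136224, -7729272, 48196192, -51846360, -54071328,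
  272081064, -336906496, -88688952, 617805632, -677241000, 80976096, 659082040, -548009760,
  -50579208, 201664128, -45823368, -16227488, 4864704, 380544, -99264], [0, 1024, 2048, -124736,
  457216, 1683680, -9074400, 4641056, 33409128, -82421272, 53591808, 133409568, -301903960,
  180612520, 177490944, -433604768, 241594936, 157263416, -213207104, 33131744, 34131896,
  -10414760, -1135584, 487104, -21504], [0, 0, 5504, -23808, -151088, 877664, 245088, -7582656,
  14302624, 2713152, -52819584, 79596352, -6272272, -122632896, 162122848, -34918912, -127305104,
  119596608, -4447296, -35427008, 11710400, 1165792, -830080, 76352, -1680], [0, 0, 128, 6784,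
  -42624, -48528, 789088, -1320640, -2317432, 10749160, -11262400, -10403712, 38772040,
  -35006008, -11626432, 53271808, -37324136, -7595592, 20818688, -7567040, -464104, 662824,
  -95328, 3456], [0, 0, 64, 704, -1344, -30720, 60728, 303776, -1165832, 721952, 2923960,
  -6680064, 3811416, 6260352, -12704760, 6280352, 4702696, -7103712, 2832168, -3072, -259832,
  53824, -2656], [0, 0, 0, 64, 704, -4128, -9344, 57216, -4568, -321208, 600320, -91072,
  -1164312, 1699336, -506176, -1073344, 1312632, -574120, 46272, 44224, -13384, 888], [0, 0, 0,
  0, 16, 192, -1072, -896, 13548, -24304, -9272, 83856, -104236, 16096, 86912, -100320, 48916,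
  -8368, -1944, 976, -100]], [[0, 0, 0, 0, 0, -448, 1792, -784, -5824, 7840, 4928, -14448, 2688,
  10752, -6272, -2800, 3136, -224, -448, 112], [0, 0, 0, -1472, 1984, 8432, -15200, -16568,
  96344, -197904, 150496, 187656, -439976, 211600, 130336, -160680, 53896, -22256, 21088, -8936,
  1032, 128], [0, 0, -4864, 384, 42784, -134240, 351128, -428280, -326456, 1778208, -3039760,
  2569224, 903752, -4048928, 2860832, -113512, -583464, 252832, -167856, 122584, -36616, 1728,
  520], [0, 0, -6144, -59520, 167040, 79424, -865824, 2826296, -4641528, 737488, 8748992,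
  -17708040, 17886792, -554544, -18096320, 15341544, -3664360, -203472, 186112, -400984, 287256,
  -58896, -2016, 704], [0, 0, 13056, -111872, -237312, 1538976, -1954000, -33800, 9184552,
  -23551712, 17469024, 14265592, -52310616, 67744992, -18191360, -46052120, 43897144, -13469920,
  2695776, -675416, -534088, 352064, -32496, -6784, 320], [0, 0, 17408, 78784, -899776, 494608,
  4864768, -11307800, 14551288, 8170288, -63990560, 77524840, -19888520, -83733232, 161575648,
  -72923144, -70559000, 75578320, -24419488, 6615992, -1474328, -509984, 226784, 11328, -4224],
  [0, 0, -11776, 215680, -74976, -3458656, 6478120, 3125160, -24875512, 58344416, -34133424,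
  -90798936, 172242824, -133589984, -54449760, 257314296, -154571752, -63735584, 82473968,
  -26409032, 7265464, -1063552, -357128, 56192, 13952], [0, 0, -17408, -11520, 1045632, -2109344,
  -5938432, 19939992, -19265944, -15922160, 112831424, -131416552, -33292248, 215282000,
  -284292736, 53499080, 274927032, -201281808, -27354880, 58129288, -18404168, 4031312, -232768,
  -140288, -5504], [0, 0, 3584, -153600, 356352, 2381664, -8002080, -219912, 27267496, -59844768,
  38885760, 113873592, -214238104, 108295392, 135085056, -348885144, 159950840, 188084832,
  -166879168, 4741992, 26681848, -8286720, 906848, 12672, -18432], [0, 0, 7168, -23616, -482240,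
  1748368, 1932064, -13898152, 17181704, 9029072, -80158304, 104770456, 31680648, -190556624,
  214435296, -3754360, -265295848, 171868208, 70884128, -87101496, 11910296, 7910976, -2095552,
  7168, 640], [0, 0, 256, 46208, -201632, -614048, 3591016, -2468200, -10837608, 31141344,
  -24294256, -50829288, 114897816, -61524704, -82962080, 190963656, -77181752, -117869728,
  102490160, 6050440, -26657752, 5363776, 1174904, -259456, -19072], [0, 0, -1024, 9600, 89984,
  -505088, 32352, 3553320, -7354600, 361072, 25084992, -38484376, -1344680, 65369072, -81054656,
  1441592, 91862216, -61670000, -23294464, 33454456, -4967992, -3555056, 958240, 25408, -10368],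
  [0, 0, -256, -4864, 33536, 42720, -567760, 1015912, 1197880, -6961568, 7450080, 7453928,
  -25427784, 19951520, 15117312, -42692680, 19724264, 21014112, -22025632, 1588984, 4473448,
  -1432384, 26256, 24320, -1344], [0, 0, 0, -448, -4416, 42352, -73920, -274056, 1124008,
  -736240, -2693728, 5820920, -2272856, -7611856, 12396064, -2570456, -9995144, 8379120, 427808,
  -2978456, 1113208, -73376, -21024, 2496], [0, 0, 0, -128, -672, 2400, 23000, -97096, 13720,
  469536, -796880, -68808, 1826968, -2167584, -330272, 2790824, -1896376, -462304, 1105808,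
  -474392, 56360, 7552, -1656], [0, 0, 0, 0, -128, -416, 3776, 2312, -38536, 57520, 47168,
  -231032, 204856, 159984, -442624, 247320, 121192, -217520, 104960, -18600, -664, 432], [0, 0,
  0, 0, 0, -32, -64, 952, -1352, -3968, 13056, -8232, -16200, 31392, -15232, -10520, 17576,
  -9472, 2240, -120, -24]], [[0, 0, 0, 0, 0, 0, 112, -448, 216, 1376, -1920, -992, 3272, -832,
  -2128, 1408, 360, -544, 96, 32, -8], [0, 0, 0, -32, 544, -376, -4368, 11744, -13544, -696,
  37488, -52640, -4840, 61464, -30832, -19616, 17096, 1176, -2288, -896, 744, -128], [0, 0, 0,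
  1856, -4400, 7776, -2196, -68256, 176464, -181568, 9536, 363040, -572304, 107456, 442488,
  -292960, -53008, 62912, 11424, -3680, -7552, 3424, -452], [0, 0, 0, 3712, 9344, -43088, 91216,
  -127568, -262056, 1028920, -1215728, 414096, 1611608, -3126184, 1047600, 1791152, -1357560,
  10664, 70256, 69616, -1336, -20712, 6656, -608], [0, 0, 0, -2112, 45920, -29488, -128528,
  497696, -1159480, 118240, 3065032, -4788352, 3330376, 3552544, -10233464, 4405728, 4589304,
  -3649440, 335960, -119040, 182968, 8144, -27800, 6080, -288], [0, 0, 0, -7328, 12064, 202856,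
  -362416, 181568, 1130456, -4629176, 3697520, 4419232, -11787304, 13267800, 2742992, -22144288,
  11104136, 7699096, -6095856, 796096, -461528, 232544, 17760, -18400, 2176], [0, 0, 0, -896,
  -60688, 182288, 341396, -1210016, 2302688, -75712, -10000144, 12864096, -849280, -17900704,
  31927160, -5169760, -33159520, 18386496, 8344048, -6495328, 1020688, -592368, 138260, 11904,
  -4608], [0, 0, 0, 4608, -36096, -167728, 709840, -304048, -1634728, 6996536, -6297840,
  -11344624, 23643480, -17198312, -14602320, 50145776, -17517944, -34418520, 20539248, 5396720,
  -4455608, 858424, -348928, 31168, 896], [0, 0, 0, 1920, 26432, -200288, -77272, 1275744,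
  -2518872, 625568, 10827960, -15747584, -2250456, 25842176, -36957048, -914848, 52645624,
  -24260576, -23660888, 15460544, 1514040, -2006880, 446448, -75776, 4032], [0, 0, 0, -864,
  23904, 31064, -452336, 589664, 826888, -5119592, 5619152, 8138784, -20091000, 13141640,
  15521968, -43190880, 11599128, 36166408, -20091216, -9568896, 7646840, -289920, -597568,
  102592, -5760], [0, 0, 0, -960, -2640, 78848, -93356, -440160, 1558608, -938688, -5098912,
  8963040, -280912, -14796672, 21222184, 2029024, -30487312, 13387328, 14995520, -10475040,
  -1548960, 2269184, -274716, -75904, 10496], [0, 0, 0, -128, -6016, 8976, 101744, -324400,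
  -1464, 1792232, -2441040, -1935184, 7374792, -6292152, -5644272, 16093328, -4218792, -12519240,
  7704016, 2994640, -3150184, 237064, 279552, -55136, 1664], [0, 0, 0, 192, -672, -10864, 42592,
  32864, -405256, 418208, 936632, -2257408, 920632, 3315744, -5545832, -98912, 6517512, -3334880,
  -2523224, 2329856, -43512, -388208, 101032, -6592, 96], [0, 0, 0, 32, 352, -3144, -6480, 58240,
  -43768, -226856, 437328, 42208, -1066104, 1235976, 584432, -2197984, 831640, 1234888, -1024464,
  -52672, 277880, -90464, 9184, -224], [0, 0, 0, 0, 144, 400, -4436, 1696, 31616, -52288, -40848,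
  203680, -165024, -219040, 469992, -96032, -370560, 276928, 35888, -109344, 43024, -6000, 204],
  [0, 0, 0, 0, 0, 112, 112, -2256, 3336, 6056, -21200, 9904, 38792, -59064, -1520, 64208, -44008,
  -8456, 22608, -10416, 1880, -88], [0, 0, 0, 0, 0, 0, 24, -32, -320, 896, 72, -2976, 3472, 1024,
  -4952, 3232, 672, -1920, 1016, -224, 16]], [[0, 0, 0, 0, 0, 0, 0, -16, 64, -32, -192, 272, 128,
  -448, 128, 272, -192, -32, 64, -16], [0, 0, 0, 0, 32, -224, 464, -216, -712, 2080, -1904,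
  -2584, 5752, 160, -6224, 2168, 3240, -2016, -528, 632, -120], [0, 0, 0, 0, -64, 304, -2352,
  5784, -3320, -6672, 20368, -23080, -15224, 51088, -9168, -40888, 16152, 17040, -8848, -3256,
  2456, -320], [0, 0, 0, 0, -128, 256, -1168, -8680, 33640, -27968, -20816, 100376, -145624,
  -43712, 256720, -71224, -164424, 66816, 52304, -20472, -10184, 4608, -320], [0, 0, 0, 0, 320,
  -992, 4704, -22312, -4728, 117664, -143840, 25048, 292424, -593440, -31200, 826376, -263272,
  -437600, 166432, 102728, -24744, -17472, 3904], [0, 0, 0, 0, 160, 1440, 1872, 12936, -111976,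
  79584, 244816, -459832, 405848, 519520, -1681552, 188440, 1812552, -590496, -785872, 257816,
  129704, -10048, -15680, 640, 128], [0, 0, 0, 0, -640, 848, 2352, 38040, -17528, -301360,
  363056, 189528, -930296, 1529776, 492688, -3381560, 697880, 2774064, -866736, -940600, 251224,
  96768, 8640, -5504, -640], [0, 0, 0, 0, 0, -3840, -4112, 12856, 153096, -179712, -458384,
  841400, -483256, -1182336, 3349904, -1112, -4809704, 1207744, 2937744, -861976, -717800,
  158144, 32128, 8832, 384], [0, 0, 0, 0, 640, 448, -11968, -38024, 73544, 307520, -488128,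
  -247240, 1201288, -1839744, -865152, 4808424, -675496, -4740352, 1293184, 2067176, -600872,
  -317312, 72064, -896, 896], [0, 0, 0, 0, -160, 3680, 5872, -31368, -107736, 203488, 312752,
  -747208, 476520, 1084512, -3005936, -188696, 4595960, -991264, -3104304, 941544, 893336,
  -300416, -65664, 25728, -640], [0, 0, 0, 0, -320, -1072, 10032, 23048, -66344, -145520, 317936,
  39496, -726056, 1201904, 581968, -2905576, 310792, 2841840, -812528, -1254376, 478216, 202944,
  -97408, -2688, 3712], [0, 0, 0, 0, 128, -1536, -3888, 17224, 39352, -95552, -77040, 312264,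
  -295816, -453568, 1242736, 108248, -1709784, 402048, 1063408, -424296, -271448, 148608, 11200,
  -13440, 1152], [0, 0, 0, 0, 64, 544, -2976, -7224, 20184, 28960, -90080, 35400, 201624,
  -359840, -158048, 698968, -97016, -586592, 231328, 207896, -124984, -14912, 19776, -3200, 128],
  [0, 0, 0, 0, -32, 224, 1008, -2856, -5880, 16928, 2416, -56552, 67784, 76192, -193840, -4472,
  215064, -78176, -99824, 64136, 9784, -15168, 3520, -256], [0, 0, 0, 0, 0, -80, 208, 712, -1896,
  -1616, 9808, -7288, -20072, 34768, 10224, -51496, 15560, 30288, -20432, -3368, 6408, -1920,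
  192], [0, 0, 0, 0, 0, 0, -48, 104, 216, -896, 208, 2920, -3560, -2816, 7472, -1608, -5368,
  3776, 560, -1416, 520, -64], [0, 0, 0, 0, 0, 0, 0, -8, 24, 32, -192, 152, 280, -512, 64, 424,
  -312, -32, 128, -56, 8]], [[0, 0, 0, 0, 0, 0, 0, 0, 1, -4, 2, 12, -17, -8, 28, -8, -17, 12, 2,
  -4, 1], [0, 0, 0, 0, 0, 0, 0, 0, 8, -8, -64, 96, 136, -296, -64, 384, -104, -216, 128, 32, -40,
  8], [0, 0, 0, 0, 0, 0, 0, 0, 16, 96, -264, -448, 1184, 672, -2392, -128, 2448, -608, -1208,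
  576, 192, -160, 24], [0, 0, 0, 0, 0, 0, 0, 0, -24, 312, 512, -2496, -1688, 7576, 1792, -11552,
  312, 9448, -1984, -3904, 1400, 584, -320, 32], [0, 0, 0, 0, 0, 0, 0, 0, -100, -176, 2664, 1488,
  -13548, -3552, 30592, 2528, -36652, 1808, 24008, -3696, -7956, 1920, 976, -320, 16], [0, 0, 0,
  0, 0, 0, 0, 0, 8, -1320, -384, 13696, 2056, -48456, -3712, 84128, 1560, -79672, 2752, 41088,
  -3496, -10328, 1344, 864, -128], [0, 0, 0, 0, 0, 0, 0, 0, 240, -96, -7928, 448, 47008, -416,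
  -120360, -640, 161840, 1120, -119880, -64, 46848, -608, -8088, 256, 320], [0, 0, 0, 0, 0, 0, 0,
  0, 40, 2456, -960, -28768, 3880, 111608, -5568, -211136, 1144, 217864, 4864, -122912, -4936,
  34152, 1664, -3264, -128], [0, 0, 0, 0, 0, 0, 0, 0, -314, 360, 11052, -3000, -68998, 7632,
  184776, -6576, -259590, -2616, 201324, 8424, -82522, -5376, 14688, 1152, -416], [0, 0, 0, 0, 0,
  0, 0, 0, -40, -2456, 960, 28768, -3880, -111608, 5568, 211136, -1144, -217864, -4864, 122912,
  4936, -34152, -1664, 3264, 128], [0, 0, 0, 0, 0, 0, 0, 0, 240, -96, -7928, 448, 47008, -416,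
  -120360, -640, 161840, 1120, -119880, -64, 46848, -608, -8088, 256, 320], [0, 0, 0, 0, 0, 0, 0,
  0, -8, 1320, 384, -13696, -2056, 48456, 3712, -84128, -1560, 79672, -2752, -41088, 3496, 10328,
  -1344, -864, 128], [0, 0, 0, 0, 0, 0, 0, 0, -100, -176, 2664, 1488, -13548, -3552, 30592, 2528,
  -36652, 1808, 24008, -3696, -7956, 1920, 976, -320, 16], [0, 0, 0, 0, 0, 0, 0, 0, 24, -312,
  -512, 2496, 1688, -7576, -1792, 11552, -312, -9448, 1984, 3904, -1400, -584, 320, -32], [0, 0,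
  0, 0, 0, 0, 0, 0, 16, 96, -264, -448, 1184, 672, -2392, -128, 2448, -608, -1208, 576, 192,
  -160, 24], [0, 0, 0, 0, 0, 0, 0, 0, -8, 8, 64, -96, -136, 296, 64, -384, 104, 216, -128, -32,
  40, -8], [0, 0, 0, 0, 0, 0, 0, 0, 1, -4, 2, 12, -17, -8, 28, -8, -17, 12, 2, -4, 1]]]

section Forms

variable {R : Type*} [Semiring R] (f : ℤ → R)

/-- The rescaled numerator `f₀³ (x - 3)` of the cover. -/
def numer (γ x : R) : R :=
  eval2 f hList γ x ^ 3 * eval2 f kList γ x ^ 3 * eval2 f lList γ x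

/-- The rescaled denominator `g₀⁸ g₁⁴ x` of the cover. -/
def denom (γ x : R) : R := eval2 f qList γ x ^ 8 * eval2 f cList γ x ^ 4 * x

/-- The numerator of the dual cover. -/
def numerDual (γ y : R) : R :=
  eval2 f hDual γ y ^ 3 * eval2 f kDual γ y ^ 3 * eval2 f lDual γ y

/-- The denominator of the dual cover. -/
def denomDual (γ y : R) : R := eval2 f qDual γ y ^ 8 * eval2 f cDual γ y ^ 4 * y

end Forms

section Length

/-- A submultiplicative length function taking values in `ℕ`, homogeneous for natural scalars. -/
structure IsLength {R : Type*} [CommRing R] (N : R → ℕ) : Prop where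
  zero : N 0 = 0
  eq_zero : ∀ a, N a = 0 → a = 0
  add_le : ∀ a b, N (a + b) ≤ N a + N b
  mul_le : ∀ a b, N (a * b) ≤ N a * N b
  natCast_mul : ∀ (n : ℕ) a, N (n * a) = n * N a
  intCast_le : ∀ n : ℤ, N n ≤ n.natAbs

lemma isLength_natAbs : IsLength (Int.natAbs) where
  zero := rfl
  eq_zero a := Int.natAbs_eq_zero.1
  add_le := Int.natAbs_add_le
  mul_le a b := (Int.natAbs_mul a b).le
  natCast_mul n a := by simp [Int.natAbs_mul]
  intCast_le n := by simp

/-- The sum of the lengths of the coefficients. -/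
noncomputable def polyLength {R : Type*} [CommRing R] (N : R → ℕ) (p : R[X]) : ℕ :=
  p.sum fun _ a => N a

variable {R : Type*} [CommRing R] {N : R → ℕ}

lemma polyLength_eq (hN : IsLength N) (p : R[X]) {n : ℕ} (h : p.natDegree < n) :
    polyLength N p = ∑ i ∈ Finset.range n, N (p.coeff i) :=
  p.sum_over_range' (fun _ => hN.zero) n h

lemma polyLength_monomial (hN : IsLength N) (n : ℕ) (a : R) :
    polyLength N (monomial n a) = N a :=
  sum_monomial_index _ _ hN.zero

lemma polyLength_add_le (hN : IsLength N) (p q : R[X]) :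
    polyLength N (p + q) ≤ polyLength N p + polyLength N q := by
  have hp : p.natDegree < p.natDegree + q.natDegree + 1 := by omega
  have hq : q.natDegree < p.natDegree + q.natDegree + 1 := by omega
  have hpq : (p + q).natDegree < p.natDegree + q.natDegree + 1 :=
    (natDegree_add_le p q).trans_lt (by omega)
  rw [polyLength_eq hN p hp, polyLength_eq hN q hq, polyLength_eq hN _ hpq,
    ← Finset.sum_add_distrib]
  exact Finset.sum_le_sum fun i _ => by simpa using hN.add_le _ _

lemma polyLength_sum_le (hN : IsLength N) {ι : Type*} (s : Finset ι) (g : ι → R[X]) :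
    polyLength N (∑ i ∈ s, g i) ≤ ∑ i ∈ s, polyLength N (g i) :=
  Finset.le_sum_of_subadditive _ (by simp [polyLength]) (polyLength_add_le hN) s g

lemma isLength_polyLength (hN : IsLength N) : IsLength (polyLength N) where
  zero := by simp [polyLength]
  eq_zero p h := by
    rw [polyLength_eq hN p p.natDegree.lt_succ_self, Finset.sum_eq_zero_iff] at h
    ext i
    by_cases hi : i < p.natDegree + 1
    · exact hN.eq_zero _ (h i (Finset.mem_range.2 hi))
    · exact coeff_eq_zero_of_natDegree_lt (by omega)
  add_le := polyLength_add_le hN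
  mul_le p q := by
    rw [mul_eq_sum_sum]
    refine (polyLength_sum_le hN _ _).trans ?_
    rw [polyLength, polyLength, sum_def, sum_def, Finset.sum_mul_sum]
    refine Finset.sum_le_sum fun i _ => (polyLength_sum_le hN _ _).trans ?_
    exact Finset.sum_le_sum fun j _ => (polyLength_monomial hN _ _).trans_le (hN.mul_le _ _)
  natCast_mul n p := by
    have h : ((n : R[X]) * p).natDegree < p.natDegree + 1 :=
      Nat.lt_succ_of_le (by simpa using natDegree_C_mul_le (n : R) p)
    rw [polyLength_eq hN _ h, polyLength_eq hN p p.natDegree.lt_succ_self, Finset.mul_sum]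
    exact Finset.sum_congr rfl fun i _ => by rw [coeff_natCast_mul, hN.natCast_mul]
  intCast_le n := by
    rw [← C_eq_intCast, ← monomial_zero_left, polyLength_monomial hN]
    exact hN.intCast_le n

lemma IsLength.neg_le (hN : IsLength N) (a : R) : N (-a) ≤ N a := by
  have h1 : N (-1) ≤ 1 := by simpa using hN.intCast_le (-1)
  calc N (-a) = N (-1 * a) := by ring_nf
    _ ≤ N (-1) * N a := hN.mul_le _ _
    _ ≤ 1 * N a := by gcongr
    _ = N a := one_mul _

lemma IsLength.one_le (hN : IsLength N) : N 1 ≤ 1 := by simpa using hN.intCast_le 1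

lemma IsLength.pow_le (hN : IsLength N) (a : R) (n : ℕ) : N (a ^ n) ≤ N a ^ n := by
  induction n with
  | zero => simpa using hN.one_le
  | succ n ih =>
    rw [pow_succ, pow_succ]
    exact (hN.mul_le _ _).trans (by gcongr)

lemma IsLength.eq_zero_of_natCast_mul (hN : IsLength N) {a b : R} {n : ℕ} (hn : N a < n)
    (h : n * b + a = 0) : a = 0 := by
  have h1 : n * N b ≤ N a := by
    rw [← hN.natCast_mul, eq_neg_of_add_eq_zero_left h]
    exact hN.neg_le a
  have h2 : N b = 0 := by
    by_contra h0
    nlinarith [Nat.pos_of_ne_zero h0]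
  simpa [hN.eq_zero b h2] using h

/-- Kronecker substitution: a polynomial is determined by its value at a natural number that
exceeds its length. -/
lemma IsLength.eq_zero_of_eval (hN : IsLength N) {b : ℕ} (p : R[X]) (hp : polyLength N p < b)
    (h : p.eval (b : R) = 0) : p = 0 := by
  induction hn : p.natDegree generalizing p with
  | zero =>
    rw [eq_C_of_natDegree_eq_zero hn] at h ⊢
    simpa using h
  | succ n ih =>
    have h0 : N (p.coeff 0) < b := by
      refine lt_of_le_of_lt ?_ hp
      rw [polyLength_eq hN p p.natDegree.lt_succ_self]
      exact Finset.single_le_sum (f := fun i => N (p.coeff i)) (fun _ _ => Nat.zero_le _)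
        (by simp)
    have hd : polyLength N p.divX < b := by
      refine lt_of_le_of_lt ?_ hp
      rw [polyLength_eq hN p p.natDegree.lt_succ_self,
        polyLength_eq hN p.divX (n := p.natDegree) (by
          rw [natDegree_divX_eq_natDegree_tsub_one]; omega), Finset.sum_range_succ']
      simp
    have he : (b : R) * p.divX.eval (b : R) + p.coeff 0 = 0 := by
      have := congrArg (eval (b : R)) (divX_mul_X_add p)
      rwa [eval_add, eval_mul_X, eval_C, mul_comm, h] at this
    have hc := hN.eq_zero_of_natCast_mul h0 he
    rw [hc, add_zero] at he
    have hv : p.divX.eval (b : R) = 0 := by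
      apply hN.eq_zero
      have := congrArg N he
      rw [hN.natCast_mul, hN.zero] at this
      exact (Nat.mul_eq_zero.1 this).resolve_left (by omega)
    rw [← divX_mul_X_add p, ih p.divX hd hv
      (by rw [natDegree_divX_eq_natDegree_tsub_one]; omega), hc]
    simp

lemma IsLength.horner_le (hN : IsLength N) {α : Type*} (l : List α) (g : α → R) (g' : α → ℕ)
    (hg : ∀ a, N (g a) ≤ g' a) {x : R} {n : ℕ} (hx : N x ≤ n) :
    N (horner (l.map g) x) ≤ horner (l.map g') n := by
  induction l with
  | nil => simp [horner, hN.zero]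
  | cons a l ih =>
    refine (hN.add_le _ _).trans (add_le_add (hg a) ((hN.mul_le _ _).trans ?_))
    exact Nat.mul_le_mul hx ih

lemma IsLength.eval2_le (hN : IsLength N) (L : List (List ℤ)) {γ x : R} {m n : ℕ}
    (hγ : N γ ≤ m) (hx : N x ≤ n) :
    N (eval2 (fun a => (a : R)) L γ x) ≤ eval2 Int.natAbs L m n :=
  hN.horner_le L _ _ (fun l => hN.horner_le l _ _ hN.intCast_le hγ) hx

lemma IsLength.eval3_le (hN : IsLength N) (L : List (List (List ℤ))) {γ y x : R} {m n k : ℕ}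
    (hγ : N γ ≤ m) (hy : N y ≤ n) (hx : N x ≤ k) :
    N (eval3 (fun a => (a : R)) L γ y x) ≤ eval3 Int.natAbs L m n k :=
  hN.horner_le L _ _ (fun M => hN.eval2_le M hγ hy) hx

end Length

section Identity

/-- The bound for the length of `discrepancy`. -/
def discrepancyBound (γ y x : ℕ) : ℕ :=
  4 * numer Int.natAbs γ x * denomDual Int.natAbs γ y +
    numerDual Int.natAbs γ y * denom Int.natAbs γ x +
    eval3 Int.natAbs incList γ y x * eval3 Int.natAbs coList γ y x

/-- The difference of the two sides of `fiber_product_factorization`. -/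
def discrepancy {R : Type*} [CommRing R] (γ y x : R) : R :=
  4 * numer Int.cast γ x * denomDual Int.cast γ y + numerDual Int.cast γ y * denom Int.cast γ x -
    eval3 Int.cast incList γ y x * eval3 Int.cast coList γ y x

variable {R S : Type*} [CommRing R] [CommRing S]

lemma IsLength.discrepancy_le {N : R → ℕ} (hN : IsLength N) {γ y x : R} {m n k : ℕ}
    (hγ : N γ ≤ m) (hy : N y ≤ n) (hx : N x ≤ k) :
    N (discrepancy γ y x) ≤ discrepancyBound m n k := by
  have h4 : N 4 ≤ 4 := by simpa using hN.intCast_le 4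
  have pw : ∀ {a : R} {b : ℕ} (e : ℕ), N a ≤ b → N (a ^ e) ≤ b ^ e := fun e h =>
    (hN.pow_le _ e).trans (Nat.pow_le_pow_left h e)
  have ml : ∀ {a b : R} {c d : ℕ}, N a ≤ c → N b ≤ d → N (a * b) ≤ c * d := fun h h' =>
    (hN.mul_le _ _).trans (Nat.mul_le_mul h h')
  have ad : ∀ {a b : R} {c d : ℕ}, N a ≤ c → N b ≤ d → N (a + b) ≤ c + d := fun h h' =>
    (hN.add_le _ _).trans (Nat.add_le_add h h')
  have e2 := fun (L : List (List ℤ)) => hN.eval2_le L hγ hx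
  have e2' := fun (L : List (List ℤ)) => hN.eval2_le L hγ hy
  rw [discrepancy, sub_eq_add_neg]
  refine ad (ad (ml (ml h4 ?_) ?_) (ml ?_ ?_)) ((hN.neg_le _).trans (ml ?_ ?_))
  · exact ml (ml (pw 3 (e2 _)) (pw 3 (e2 _))) (e2 _)
  · exact ml (ml (pw 8 (e2' _)) (pw 4 (e2' _))) hy
  · exact ml (ml (pw 3 (e2' _)) (pw 3 (e2' _))) (e2' _)
  · exact ml (ml (pw 8 (e2 _)) (pw 4 (e2 _))) hx
  · exact hN.eval3_le _ hγ hy hx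
  · exact hN.eval3_le _ hγ hy hx

lemma map_horner (φ : R →+* S) (l : List R) (x : R) :
    φ (horner l x) = horner (l.map φ) (φ x) := by
  induction l with
  | nil => simp [horner]
  | cons a l ih =>
    rw [horner, horner] at ih
    simp [horner, ih]

@[simp] lemma map_eval2 (φ : R →+* S) (L : List (List ℤ)) (γ x : R) :
    φ (eval2 Int.cast L γ x) = eval2 Int.cast L (φ γ) (φ x) := by
  simp only [eval2, map_horner, List.map_map, Function.comp_def, map_intCast]

@[simp] lemma map_eval3 (φ : R →+* S) (L : List (List (List ℤ))) (γ y x : R) :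
    φ (eval3 Int.cast L γ y x) = eval3 Int.cast L (φ γ) (φ y) (φ x) := by
  simp only [eval3, map_horner, List.map_map, Function.comp_def, map_eval2]

@[simp] lemma map_numer (φ : R →+* S) (γ x : R) :
    φ (numer Int.cast γ x) = numer Int.cast (φ γ) (φ x) := by
  simp [numer]

@[simp] lemma map_denom (φ : R →+* S) (γ x : R) :
    φ (denom Int.cast γ x) = denom Int.cast (φ γ) (φ x) := by
  simp [denom]

@[simp] lemma map_numerDual (φ : R →+* S) (γ x : R) :
    φ (numerDual Int.cast γ x) = numerDual Int.cast (φ γ) (φ x) := by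
  simp [numerDual]

@[simp] lemma map_denomDual (φ : R →+* S) (γ x : R) :
    φ (denomDual Int.cast γ x) = denomDual Int.cast (φ γ) (φ x) := by
  simp [denomDual]

lemma map_discrepancy (φ : R →+* S) (γ y x : R) :
    φ (discrepancy γ y x) = discrepancy (φ γ) (φ y) (φ x) := by
  have h4 : φ 4 = 4 := map_ofNat φ 4
  simp [discrepancy, h4]

lemma discrepancyBound_lt : discrepancyBound 1 1 1 < 2 ^ 90 := by decide +kernel

lemma discrepancyBound_lt' : discrepancyBound (2 ^ 90) 1 1 < 2 ^ 5000 := by decide +kernel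

lemma discrepancyBound_lt'' : discrepancyBound (2 ^ 90) (2 ^ 5000) 1 < 2 ^ 165000 := by
  decide +kernel

lemma discrepancy_int : discrepancy (2 ^ 90) (2 ^ 5000) (2 ^ 165000 : ℤ) = 0 := by
  decide +kernel

lemma discrepancy_generic :
    discrepancy (X : ℤ[X][X][X]) (C X) (C (C X)) = 0 := by
  have h0 := isLength_natAbs
  have h1 := isLength_polyLength h0
  have h2 := isLength_polyLength h1
  have h3 := isLength_polyLength h2
  have hX : ∀ {R : Type} [CommRing R] {N : R → ℕ}, IsLength N → polyLength N (X : R[X]) ≤ 1 :=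
    fun hN => (polyLength_monomial hN 1 1).trans_le hN.one_le
  have hC : ∀ {R : Type} [CommRing R] {N : R → ℕ} {a : R}, IsLength N → N a ≤ 1 →
      polyLength N (C a) ≤ 1 := fun hN ha =>
    (by rw [← monomial_zero_left, polyLength_monomial hN]; exact ha)
  have hn : ∀ {R : Type} [CommRing R] {N : R → ℕ} (n : ℕ), IsLength N → N n ≤ n :=
    fun n hN => by simpa using hN.intCast_le n
  refine h2.eq_zero_of_eval _ ((h3.discrepancy_le (hX h2) (hC h2 (hX h1))
    (hC h2 (hC h1 (hX h0)))).trans_lt discrepancyBound_lt) ?_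
  rw [← coe_evalRingHom, map_discrepancy]
  simp only [coe_evalRingHom, eval_X, eval_C]
  refine h1.eq_zero_of_eval _ ((h2.discrepancy_le (hn _ h2) (hX h1)
    (hC h1 (hX h0))).trans_lt discrepancyBound_lt') ?_
  rw [← coe_evalRingHom, map_discrepancy]
  simp only [coe_evalRingHom, eval_X, eval_C, eval_natCast]
  refine h0.eq_zero_of_eval _ ((h1.discrepancy_le (hn _ h1) (hn _ h1)
    (hX h0)).trans_lt discrepancyBound_lt'') ?_
  rw [← coe_evalRingHom, map_discrepancy]
  simp only [coe_evalRingHom, eval_X, eval_natCast]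
  simpa only [Nat.cast_pow, Nat.cast_ofNat] using discrepancy_int

/-- The numerator of `t(x) - t'(y)` splits off the incidence form. -/
theorem fiber_product_factorization (γ y x : R) :
    4 * numer Int.cast γ x * denomDual Int.cast γ y +
        numerDual Int.cast γ y * denom Int.cast γ x =
      eval3 Int.cast incList γ y x * eval3 Int.cast coList γ y x := by
  let φ : ℤ[X][X][X] →+* R :=
    eval₂RingHom (eval₂RingHom (eval₂RingHom (Int.castRingHom R) x) y) γ
  have h := map_discrepancy (R := ℤ[X][X][X]) (S := R) φ X (C X) (C (C X))
  simp only [discrepancy_generic, map_zero, φ, coe_eval₂RingHom, eval₂_X, eval₂_C] at h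
  replace h := h.symm
  exact sub_eq_zero.1 h

end Identity

section Place

/-- A homomorphism to an algebraically closed field extends along integral extensions. -/
theorem exists_extension_of_isIntegral {L S k : Type*} [CommRing L] [CommRing S] [Field k]
    [IsAlgClosed k] [Algebra L S] [Algebra.IsIntegral L S]
    (hL : Function.Injective (algebraMap L S)) (φ : L →+* k) :
    ∃ ψ : S →+* k, ψ.comp (algebraMap L S) = φ := by
  have hp : (RingHom.ker φ).IsPrime := RingHom.ker_isPrime φ
  obtain ⟨Q, -, hQ, hQp⟩ := Ideal.exists_ideal_over_prime_of_isIntegral (S := S) (RingHom.ker φ) ⊥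
    (by rw [← RingHom.ker_eq_comap_bot, (RingHom.injective_iff_ker_eq_bot _).1 hL]; exact bot_le)
  have : Q.LiesOver (RingHom.ker φ) := ⟨hQp.symm⟩
  let : Algebra (L ⧸ RingHom.ker φ) k := (RingHom.kerLift φ).toAlgebra
  have : FaithfulSMul (L ⧸ RingHom.ker φ) k :=
    (faithfulSMul_iff_algebraMap_injective _ _).2 (RingHom.kerLift_injective φ)
  have : Algebra.IsIntegral (L ⧸ RingHom.ker φ) (S ⧸ Q) := inferInstance
  have : FaithfulSMul (L ⧸ RingHom.ker φ) (S ⧸ Q) := inferInstance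
  have : Module.IsTorsionFree (L ⧸ RingHom.ker φ) (S ⧸ Q) :=
    Module.isTorsionFree_iff_faithfulSMul.2 this
  let χ : (S ⧸ Q) →ₐ[L ⧸ RingHom.ker φ] k := IsAlgClosed.lift
  refine ⟨χ.toRingHom.comp (Ideal.Quotient.mk Q), RingHom.ext fun a => ?_⟩
  exact χ.commutes (Ideal.Quotient.mk _ a)

/-- A homomorphism from a subring of a field to an algebraically closed field extends to a subring
containing all roots of the polynomials whose leading coefficient survives. -/
theorem exists_extension_to_roots {R Ω k : Type*} [CommRing R] [Field Ω] [Field k] [IsAlgClosed k]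
    (ι : R →+* Ω) (hι : Function.Injective ι) (φ : R →+* k) :
    ∃ (S : Subring Ω) (j : R →+* S) (ψ : S →+* k), S.subtype.comp j = ι ∧ ψ.comp j = φ ∧
      ∀ f : R[X], φ f.leadingCoeff ≠ 0 → ∀ z, (f.map ι).IsRoot z → z ∈ S := by
  let p : Ideal R := RingHom.ker φ
  have hp : p.IsPrime := RingHom.ker_isPrime φ
  let L := Localization.AtPrime p
  have hu : ∀ y : p.primeCompl, IsUnit (ι y) := fun y => by
    refine isUnit_iff_ne_zero.2 fun h => y.2 ?_
    rw [← map_zero ι] at h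
    rw [hι h]
    exact p.zero_mem
  have hv : ∀ y : p.primeCompl, IsUnit (φ y) := fun y => isUnit_iff_ne_zero.2 y.2
  let lΩ : L →+* Ω := IsLocalization.lift hu
  let lk : L →+* k := IsLocalization.lift hv
  have hΩ : lΩ.comp (algebraMap R L) = ι := IsLocalization.lift_comp hu
  let : Algebra L Ω := lΩ.toAlgebra
  let S := integralClosure L Ω
  have hinj : Function.Injective lΩ := (IsLocalization.lift_injective_iff hu).2 fun x y =>
    ⟨fun h => congrArg ι (by
      apply hι
      rw [← hΩ]
      exact congrArg lΩ h), fun h => by rw [hι h]⟩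
  obtain ⟨ψ, hψ⟩ := exists_extension_of_isIntegral (S := S)
    (fun x y h => hinj (congrArg (Subtype.val : S → Ω) h)) lk
  refine ⟨S.toSubring, (algebraMap L S).comp (algebraMap R L), ψ, hΩ, ?_, fun f hf z hz => ?_⟩
  · rw [← RingHom.comp_assoc]
    exact (congrArg (fun g => RingHom.comp g (algebraMap R L)) hψ).trans
      (IsLocalization.lift_comp hv)
  · obtain ⟨u, hu⟩ :=
      (IsLocalization.map_units L (⟨f.leadingCoeff, hf⟩ : p.primeCompl)).exists_left_inv
    have hlc : (f.map (algebraMap R L)).leadingCoeff = algebraMap R L f.leadingCoeff :=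
      leadingCoeff_map_of_leadingCoeff_ne_zero _ fun h => one_ne_zero (α := L) (by
        rw [← hu]
        exact (congrArg (u * ·) h).trans (mul_zero u))
    refine ⟨C u * f.map (algebraMap R L), monic_C_mul_of_mul_leadingCoeff_eq_one
      (by rw [hlc]; exact hu), ?_⟩
    rw [eval₂_mul, eval₂_map]
    have : (algebraMap L Ω).comp (algebraMap R L) = ι := hΩ
    have hz' : f.eval₂ ι z = 0 := (eval_map ι z).symm.trans hz
    rw [this, hz', mul_zero]

/-- Specialization of a product of linear factors along `exists_extension_to_roots`. -/
theorem map_eq_prod_of_extension {R Ω k I : Type*} [CommRing R] [Field Ω] [Field k] [Fintype I]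
    {ι : R →+* Ω} {φ : R →+* k} {S : Subring Ω} {j : R →+* S} {ψ : S →+* k}
    (hj : S.subtype.comp j = ι) (hψ : ψ.comp j = φ) (f : R[X]) (c : R) (r : I → S)
    (h : f.map ι = C (ι c) * ∏ i, (X - C (r i : Ω))) :
    f.map φ = C (φ c) * ∏ i, (X - C (ψ (r i))) := by
  have h1 : f.map j = C (j c) * ∏ i, (X - C (r i)) := by
    apply map_injective S.subtype Subtype.val_injective
    rw [map_map, hj, h, ← hj]
    simp [Polynomial.map_prod]
  rw [← hψ, ← map_map, h1]
  simp [Polynomial.map_prod]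

end Place

section SpecialFibre

/-- Horner evaluation of an integer list with reduction modulo `881` at every step. -/
def hornerMod (l : List ℤ) (x : ℤ) : ℤ := l.foldr (fun c r => (c + x * r) % 881) 0

/-- Partial evaluation at `γ = 353` modulo `881`. -/
def reduceList (L : List (List ℤ)) : List ℤ := L.map fun l => hornerMod l 353

/-- Roots of the cover modulo `881`, ordered by the binary code of the labelling vector. -/
def specialPoints : List ℤ :=
  [38, 62, 375, 63, 258, 127, 302, 76, 462, 533, 494, 284, 355, 519, 496, 96, 220, 526, 614, 190,
  454, 738, 367, 817, 350, 717, 403, 814, 507, 300, 712]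

/-- Roots of the dual cover modulo `881`, ordered by the binary code of the labelling vector. -/
def specialHyperplanes : List ℤ :=
  [616, 778, 565, 530, 43, 522, 176, 791, 6, 757, 324, 475, 593, 750, 216, 32, 298, 708, 470, 395,
  265, 311, 821, 779, 76, 433, 389, 425, 71, 666, 600]

/-- The coordinate vectors over `𝔽₂`. -/
abbrev Vec := Fin 5 → ZMod 2

/-- The position of a nonzero vector in the tables of roots. -/
def Vec.index (v : Vec) : ℕ :=
  (v 0).val + 2 * (v 1).val + 4 * (v 2).val + 8 * (v 3).val + 16 * (v 4).val - 1

/-- The vector at a given position in the tables of roots. -/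
def Vec.ofIndex (n : ℕ) : Vec := fun i => if (n + 1).testBit i then 1 else 0

lemma Vec.index_lt : ∀ v : Vec, v.index < 31 := by decide +kernel

lemma Vec.ofIndex_index : ∀ v : Vec, v ≠ 0 → Vec.ofIndex v.index = v := by decide +kernel

/-- The residue modulo `881` of `numer - 870 * denom`. -/
def pointResidue (x : ℤ) : ℤ :=
  (hornerMod (reduceList hList) x ^ 3 * hornerMod (reduceList kList) x ^ 3 *
    hornerMod (reduceList lList) x - 870 *
      (hornerMod (reduceList qList) x ^ 8 * hornerMod (reduceList cList) x ^ 4 * x)) % 881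

/-- The residue modulo `881` of `numerDual + 4 * 870 * denomDual`. -/
def hyperplaneResidue (x : ℤ) : ℤ :=
  (hornerMod (reduceList hDual) x ^ 3 * hornerMod (reduceList kDual) x ^ 3 *
    hornerMod (reduceList lDual) x + 4 * 870 *
      (hornerMod (reduceList qDual) x ^ 8 * hornerMod (reduceList cDual) x ^ 4 * x)) % 881

/-- The vanishing pattern modulo `881` of a form at the roots of the dual cover and the cover. -/
def zeroPattern (L : List (List (List ℤ))) : List (List Bool) :=
  specialHyperplanes.map fun y =>
    specialPoints.map fun x => hornerMod ((L.map reduceList).map fun l => hornerMod l y) x == 0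

lemma point_residues : specialPoints.map pointResidue = List.replicate 31 0 := by decide +kernel

lemma hyperplane_residues :
    specialHyperplanes.map hyperplaneResidue = List.replicate 31 0 := by decide +kernel

set_option maxRecDepth 10000 in
lemma zeroPattern_incList : zeroPattern incList = (List.range 31).map fun n =>
    (List.range 31).map fun m => Vec.ofIndex n ⬝ᵥ Vec.ofIndex m == 0 := by decide +kernel

set_option maxRecDepth 10000 in
lemma zeroPattern_coList : zeroPattern coList = (List.range 31).map fun n =>
    (List.range 31).map fun m => Vec.ofIndex n ⬝ᵥ Vec.ofIndex m == 1 := by decide +kernel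

lemma intCast_hornerMod (l : List ℤ) (x : ℤ) :
    ((hornerMod l x : ℤ) : ZMod 881) = horner (l.map Int.cast) (x : ZMod 881) := by
  induction l with
  | nil => simp [hornerMod, horner]
  | cons a l ih =>
    have h : hornerMod (a :: l) x = (a + x * hornerMod l x) % (881 : ℕ) := rfl
    rw [h, ZMod.intCast_mod, Int.cast_add, Int.cast_mul, ih]
    rfl

lemma intCast_hornerMod_reduceList (L : List (List ℤ)) (x : ℤ) :
    ((hornerMod (reduceList L) x : ℤ) : ZMod 881) = eval2 Int.cast L 353 (x : ZMod 881) := by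
  rw [intCast_hornerMod, eval2, reduceList, List.map_map]
  congr 2
  funext l
  simpa using intCast_hornerMod l 353

lemma intCast_hornerMod_eval3 (L : List (List (List ℤ))) (y x : ℤ) :
    ((hornerMod ((L.map reduceList).map fun l => hornerMod l y) x : ℤ) : ZMod 881) =
      eval3 Int.cast L 353 (y : ZMod 881) (x : ZMod 881) := by
  rw [intCast_hornerMod, eval3, List.map_map, List.map_map]
  congr 2
  funext l
  exact intCast_hornerMod_reduceList l y

lemma hornerMod_emod (l : List ℤ) (x : ℤ) : hornerMod l x % 881 = hornerMod l x := by
  cases l with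
  | nil => rfl
  | cons a l => exact Int.emod_emod_of_dvd _ dvd_rfl

lemma intCast_hornerMod_eq_zero {l : List ℤ} {x : ℤ} :
    ((hornerMod l x : ℤ) : ZMod 881) = 0 ↔ hornerMod l x = 0 := by
  rw [ZMod.intCast_zmod_eq_zero_iff_dvd]
  refine ⟨fun h => ?_, fun h => h ▸ dvd_zero _⟩
  rw [← hornerMod_emod]
  exact Int.emod_eq_zero_of_dvd h

/-- The root of the cover modulo `881` labelled by `v`. -/
def Vec.point (v : Vec) : ZMod 881 := (specialPoints[v.index]'v.index_lt : ℤ)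

/-- The root of the dual cover modulo `881` labelled by `w`. -/
def Vec.hyperplane (w : Vec) : ZMod 881 := (specialHyperplanes[w.index]'w.index_lt : ℤ)

lemma Vec.point_injOn : ∀ v w : Vec, v ≠ 0 → w ≠ 0 → v.point = w.point → v = w := by
  have h : (specialPoints.map (Int.cast : ℤ → ZMod 881)).Nodup := by decide +kernel
  intro v w hv hw e
  rw [← Vec.ofIndex_index v hv, ← Vec.ofIndex_index w hw]
  congr 1
  refine (h.getElem_inj_iff (hi := v.index_lt) (hj := w.index_lt)).1 ?_
  exact (List.getElem_map _).trans (Eq.trans e (List.getElem_map _).symm)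

lemma Vec.hyperplane_injOn :
    ∀ v w : Vec, v ≠ 0 → w ≠ 0 → v.hyperplane = w.hyperplane → v = w := by
  have h : (specialHyperplanes.map (Int.cast : ℤ → ZMod 881)).Nodup := by decide +kernel
  intro v w hv hw e
  rw [← Vec.ofIndex_index v hv, ← Vec.ofIndex_index w hw]
  congr 1
  refine (h.getElem_inj_iff (hi := v.index_lt) (hj := w.index_lt)).1 ?_
  exact (List.getElem_map _).trans (Eq.trans e (List.getElem_map _).symm)

lemma Vec.point_root (v : Vec) :
    numer Int.cast 353 v.point - 870 * denom Int.cast 353 v.point = 0 := by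
  have h := congrArg (fun l : List ℤ => l[v.index]?) point_residues
  simp only [List.getElem?_map, List.getElem?_replicate, v.index_lt, if_true,
    List.getElem?_eq_getElem (show v.index < specialPoints.length from v.index_lt),
    Option.map_some, Option.some.injEq] at h
  have h2 := congrArg (Int.cast : ℤ → ZMod 881) h
  rw [pointResidue, show (881 : ℤ) = (881 : ℕ) from rfl, ZMod.intCast_mod] at h2
  push_cast [intCast_hornerMod_reduceList] at h2
  exact h2

lemma Vec.hyperplane_root (v : Vec) :
    numerDual Int.cast 353 v.hyperplane + 4 * 870 * denomDual Int.cast 353 v.hyperplane = 0 := by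
  have h := congrArg (fun l : List ℤ => l[v.index]?) hyperplane_residues
  simp only [List.getElem?_map, List.getElem?_replicate, v.index_lt, if_true,
    List.getElem?_eq_getElem (show v.index < specialHyperplanes.length from v.index_lt),
    Option.map_some, Option.some.injEq] at h
  have h2 := congrArg (Int.cast : ℤ → ZMod 881) h
  rw [hyperplaneResidue, show (881 : ℤ) = (881 : ℕ) from rfl, ZMod.intCast_mod] at h2
  push_cast [intCast_hornerMod_reduceList] at h2
  exact h2

lemma eval3_eq_zero_of_zeroPattern {L : List (List (List ℤ))} {a : ZMod 2}
    (h : zeroPattern L = (List.range 31).map fun n =>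
      (List.range 31).map fun m => Vec.ofIndex n ⬝ᵥ Vec.ofIndex m == a)
    {v w : Vec} (hv : v ≠ 0) (hw : w ≠ 0) :
    eval3 Int.cast L 353 w.hyperplane v.point = 0 ↔ w ⬝ᵥ v = a := by
  have h1 := congrArg (fun l : List (List Bool) => l[w.index]?) h
  simp only [zeroPattern, List.getElem?_map, List.getElem?_range w.index_lt,
    List.getElem?_eq_getElem (show w.index < specialHyperplanes.length from w.index_lt),
    Option.map_some, Option.some.injEq] at h1
  have h2 := congrArg (fun l : List Bool => l[v.index]?) h1
  simp only [List.getElem?_map, List.getElem?_range v.index_lt,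
    List.getElem?_eq_getElem (show v.index < specialPoints.length from v.index_lt),
    Option.map_some, Option.some.injEq, Vec.ofIndex_index v hv, Vec.ofIndex_index w hw] at h2
  rw [Vec.point, Vec.hyperplane, ← intCast_hornerMod_eval3, intCast_hornerMod_eq_zero,
    ← beq_iff_eq, List.map_map, ← beq_iff_eq (a := w ⬝ᵥ v), ← h2, List.map_map]
  exact Iff.rfl

end SpecialFibre

section CoverPolynomial

variable {R S : Type*} [CommRing R] [CommRing S]

lemma coeff_horner (l : List R) (i : ℕ) : (horner (l.map C) X).coeff i = l.getD i 0 := by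
  induction l generalizing i with
  | nil => simp [horner]
  | cons a l ih =>
    have h : horner ((a :: l).map C) X = C a + X * horner (l.map C) X := rfl
    rw [h]
    cases i with
    | zero => simp
    | succ i => simp [ih]

lemma eval2_C_X (L : List (List ℤ)) (γ : R) :
    eval2 Int.cast L (C γ) X = horner ((L.map fun l => horner (l.map Int.cast) γ).map C) X := by
  simp [eval2, map_horner, List.map_map, Function.comp_def]

lemma coeff_eval2 (L : List (List ℤ)) (γ : R) (i : ℕ) :
    (eval2 Int.cast L (C γ) X).coeff i =
      (L.map fun l => horner (l.map Int.cast) γ).getD i 0 := by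
  rw [eval2_C_X, coeff_horner]

lemma natDegree_eval2_le (L : List (List ℤ)) (γ : R) {n : ℕ} (h : L.length = n + 1) :
    (eval2 Int.cast L (C γ) X).natDegree ≤ n := by
  refine natDegree_le_iff_coeff_eq_zero.2 fun i hi => ?_
  rw [coeff_eval2, List.getD_eq_default]
  simpa [h] using hi

/-- The cover with parameters `γ` and `T`. -/
noncomputable def coverPoly (γ T : R) : R[X] :=
  numer Int.cast (C γ) X - C T * denom Int.cast (C γ) X

/-- The dual cover with parameters `γ` and `T`. -/
noncomputable def dualPoly (γ T : R) : R[X] :=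
  numerDual Int.cast (C γ) X + 4 * C T * denomDual Int.cast (C γ) X

lemma map_coverPoly (φ : R →+* S) (γ T : R) :
    (coverPoly γ T).map φ = coverPoly (φ γ) (φ T) := by
  rw [← coe_mapRingHom, coverPoly, map_sub, map_mul, map_numer, map_denom]
  simp [coverPoly]

lemma map_dualPoly (φ : R →+* S) (γ T : R) :
    (dualPoly γ T).map φ = dualPoly (φ γ) (φ T) := by
  rw [← coe_mapRingHom, dualPoly, map_add, map_mul, map_numerDual, map_denomDual]
  simp [dualPoly]

@[simp] lemma eval_numer (γ x : R) :
    (numer Int.cast (C γ) X).eval x = numer Int.cast γ x := by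
  rw [← coe_evalRingHom, map_numer]
  simp

@[simp] lemma eval_denom (γ x : R) :
    (denom Int.cast (C γ) X).eval x = denom Int.cast γ x := by
  rw [← coe_evalRingHom, map_denom]
  simp

@[simp] lemma eval_numerDual (γ x : R) :
    (numerDual Int.cast (C γ) X).eval x = numerDual Int.cast γ x := by
  rw [← coe_evalRingHom, map_numerDual]
  simp

@[simp] lemma eval_denomDual (γ x : R) :
    (denomDual Int.cast (C γ) X).eval x = denomDual Int.cast γ x := by
  rw [← coe_evalRingHom, map_denomDual]
  simp

@[simp] lemma eval_coverPoly (γ T x : R) :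
    (coverPoly γ T).eval x = numer Int.cast γ x - T * denom Int.cast γ x := by
  simp [coverPoly]

@[simp] lemma eval_dualPoly (γ T x : R) :
    (dualPoly γ T).eval x = numerDual Int.cast γ x + 4 * T * denomDual Int.cast γ x := by
  simp [dualPoly]

lemma natDegree_numer_le (γ : R) : (numer Int.cast (C γ) X).natDegree ≤ 31 :=
  natDegree_mul_le_of_le (m := 30) (n := 1) (natDegree_mul_le_of_le (m := 15) (n := 15)
    (natDegree_pow_le_of_le 3 (natDegree_eval2_le hList γ (n := 5) rfl))
    (natDegree_pow_le_of_le 3 (natDegree_eval2_le kList γ (n := 5) rfl)))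
    (natDegree_eval2_le lList γ (n := 1) rfl)

lemma natDegree_numerDual_le (γ : R) : (numerDual Int.cast (C γ) X).natDegree ≤ 31 :=
  natDegree_mul_le_of_le (m := 30) (n := 1) (natDegree_mul_le_of_le (m := 15) (n := 15)
    (natDegree_pow_le_of_le 3 (natDegree_eval2_le hDual γ (n := 5) rfl))
    (natDegree_pow_le_of_le 3 (natDegree_eval2_le kDual γ (n := 5) rfl)))
    (natDegree_eval2_le lDual γ (n := 1) rfl)

lemma natDegree_denom_le (γ : R) : (denom Int.cast (C γ) X).natDegree ≤ 29 :=
  natDegree_mul_le_of_le (m := 28) (n := 1) (natDegree_mul_le_of_le (m := 16) (n := 12)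
    (natDegree_pow_le_of_le 8 (natDegree_eval2_le qList γ (n := 2) rfl))
    (natDegree_pow_le_of_le 4 (natDegree_eval2_le cList γ (n := 3) rfl))) natDegree_X_le

lemma natDegree_denomDual_le (γ : R) : (denomDual Int.cast (C γ) X).natDegree ≤ 29 :=
  natDegree_mul_le_of_le (m := 28) (n := 1) (natDegree_mul_le_of_le (m := 16) (n := 12)
    (natDegree_pow_le_of_le 8 (natDegree_eval2_le qDual γ (n := 2) rfl))
    (natDegree_pow_le_of_le 4 (natDegree_eval2_le cDual γ (n := 3) rfl))) natDegree_X_le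

lemma coeff_eval2_pow (L : List (List ℤ)) (γ : R) {n : ℕ} (h : L.length = n + 1) (m : ℕ) :
    (eval2 Int.cast L (C γ) X ^ m).coeff (m * n) =
      (L.map fun l => horner (l.map Int.cast) γ).getD n 0 ^ m := by
  rw [coeff_pow_of_natDegree_le (natDegree_eval2_le L γ h), coeff_eval2]

lemma coeff_numer (γ : R) :
    (numer Int.cast (C γ) X).coeff 31 = γ ^ 16 * (γ ^ 2 - 1) ^ 6 := by
  have hh := natDegree_pow_le_of_le 3 (natDegree_eval2_le hList γ (n := 5) rfl)
  have hk := natDegree_pow_le_of_le 3 (natDegree_eval2_le kList γ (n := 5) rfl)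
  have hl := natDegree_eval2_le lList γ (n := 1) rfl
  rw [numer, coeff_mul_add_eq_of_natDegree_le (df := 3 * 5 + 3 * 5) (dg := 1)
    (natDegree_mul_le_of_le hh hk) hl, coeff_mul_add_eq_of_natDegree_le hh hk,
    coeff_eval2_pow hList γ (n := 5) rfl, coeff_eval2_pow kList γ (n := 5) rfl, coeff_eval2]
  simp [hList, kList, lList, horner]
  ring

lemma coeff_numerDual (γ : R) :
    (numerDual Int.cast (C γ) X).coeff 31 = γ ^ 6 * (1 - γ) ^ 16 := by
  have hh := natDegree_pow_le_of_le 3 (natDegree_eval2_le hDual γ (n := 5) rfl)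
  have hk := natDegree_pow_le_of_le 3 (natDegree_eval2_le kDual γ (n := 5) rfl)
  have hl := natDegree_eval2_le lDual γ (n := 1) rfl
  rw [numerDual, coeff_mul_add_eq_of_natDegree_le (df := 3 * 5 + 3 * 5) (dg := 1)
    (natDegree_mul_le_of_le hh hk) hl, coeff_mul_add_eq_of_natDegree_le hh hk,
    coeff_eval2_pow hDual γ (n := 5) rfl, coeff_eval2_pow kDual γ (n := 5) rfl, coeff_eval2]
  simp [hDual, kDual, lDual, horner]
  ring

lemma four_mul_C (T : R) : (4 * C T : R[X]) = C (4 * T) := by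
  rw [C_mul, ← C_ofNat]

lemma coeff_coverPoly (γ T : R) : (coverPoly γ T).coeff 31 = γ ^ 16 * (γ ^ 2 - 1) ^ 6 := by
  rw [coverPoly, coeff_sub, coeff_numer, coeff_C_mul, coeff_eq_zero_of_natDegree_lt
    ((natDegree_denom_le γ).trans_lt (by norm_num)), mul_zero, sub_zero]

lemma coeff_dualPoly (γ T : R) : (dualPoly γ T).coeff 31 = γ ^ 6 * (1 - γ) ^ 16 := by
  rw [dualPoly, coeff_add, coeff_numerDual, four_mul_C,
    coeff_C_mul, coeff_eq_zero_of_natDegree_lt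
    ((natDegree_denomDual_le γ).trans_lt (by norm_num)), mul_zero, add_zero]

lemma natDegree_coverPoly_le (γ T : R) : (coverPoly γ T).natDegree ≤ 31 :=
  natDegree_sub_le_of_le (m := 31) (n := 31) (natDegree_numer_le γ)
    ((natDegree_C_mul_le _ _).trans ((natDegree_denom_le γ).trans (by norm_num)))

lemma natDegree_dualPoly_le (γ T : R) : (dualPoly γ T).natDegree ≤ 31 := by
  rw [dualPoly, four_mul_C]
  exact natDegree_add_le_of_degree_le (natDegree_numerDual_le γ)
    ((natDegree_C_mul_le _ _).trans ((natDegree_denomDual_le γ).trans (by norm_num)))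

lemma natDegree_coverPoly {γ : R} (h : γ ^ 16 * (γ ^ 2 - 1) ^ 6 ≠ 0) (T : R) :
    (coverPoly γ T).natDegree = 31 :=
  natDegree_eq_of_le_of_coeff_ne_zero (natDegree_coverPoly_le γ T) (by rwa [coeff_coverPoly])

lemma natDegree_dualPoly {γ : R} (h : γ ^ 6 * (1 - γ) ^ 16 ≠ 0) (T : R) :
    (dualPoly γ T).natDegree = 31 :=
  natDegree_eq_of_le_of_coeff_ne_zero (natDegree_dualPoly_le γ T) (by rwa [coeff_dualPoly])

lemma leadingCoeff_coverPoly {γ : R} (h : γ ^ 16 * (γ ^ 2 - 1) ^ 6 ≠ 0) (T : R) :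
    (coverPoly γ T).leadingCoeff = γ ^ 16 * (γ ^ 2 - 1) ^ 6 := by
  rw [leadingCoeff, natDegree_coverPoly h, coeff_coverPoly]

lemma leadingCoeff_dualPoly {γ : R} (h : γ ^ 6 * (1 - γ) ^ 16 ≠ 0) (T : R) :
    (dualPoly γ T).leadingCoeff = γ ^ 6 * (1 - γ) ^ 16 := by
  rw [leadingCoeff, natDegree_dualPoly h, coeff_dualPoly]

end CoverPolynomial

section Lifting

/-- If the image of `f` under `ψ ∘ j` has as many distinct roots as its degree, then the roots of
`f` can be labelled by the roots of that image. -/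
theorem exists_lift_roots {R Ω k I : Type*} [CommRing R] [Field Ω] [Field k] [Fintype I]
    [IsAlgClosed Ω] {ι : R →+* Ω} {φ : R →+* k} {S : Subring Ω} {j : R →+* S} {ψ : S →+* k}
    (hj : S.subtype.comp j = ι) (hψ : ψ.comp j = φ) (f : R[X])
    (hS : ∀ z, (f.map ι).IsRoot z → z ∈ S) (hf : φ f.leadingCoeff ≠ 0)
    (hι : ι f.leadingCoeff ≠ 0) (x : I → k) (hx : Function.Injective x)
    (hroot : ∀ i, (f.map φ).IsRoot (x i)) (hcard : f.natDegree = Fintype.card I) :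
    ∃ r : I → S, f.map ι = C (ι f.leadingCoeff) * ∏ i, (X - C (r i : Ω)) ∧ ∀ i, ψ (r i) = x i := by
  have h0 : f.map ι ≠ 0 := fun h => hι (by
    rw [← leadingCoeff_map_of_leadingCoeff_ne_zero ι hι, h, leadingCoeff_zero])
  let s : Multiset S := (f.map ι).roots.attach.map fun z => ⟨z.1, hS z.1 (isRoot_of_mem_roots z.2)⟩
  have hs : s.map S.subtype = (f.map ι).roots := by
    simp only [s, Multiset.map_map, Function.comp_def]
    exact Multiset.attach_map_val _
  have hprod : f.map ι = C (ι f.leadingCoeff) * ((f.map ι).roots.map fun z => X - C z).prod := by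
    conv_lhs => rw [(IsAlgClosed.splits (f.map ι)).eq_prod_roots,
      leadingCoeff_map_of_leadingCoeff_ne_zero ι hι]
  have hjprod : f.map j = C (j f.leadingCoeff) * (s.map fun z => X - C z).prod := by
    apply map_injective S.subtype Subtype.val_injective
    rw [map_map, hj, hprod, ← hs, ← hj]
    simp [Polynomial.map_multiset_prod]
  have hφprod : f.map φ = C (φ f.leadingCoeff) * (s.map fun z => X - C (ψ z)).prod := by
    rw [← hψ, ← map_map, hjprod]
    simp [Polynomial.map_multiset_prod]
  have hex : ∀ i, ∃ z ∈ s, ψ z = x i := fun i => by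
    have h := hroot i
    rw [hφprod, IsRoot, eval_mul, eval_C, eval_multiset_prod, mul_eq_zero, or_iff_right hf,
      Multiset.prod_eq_zero_iff, Multiset.map_map, Multiset.mem_map] at h
    obtain ⟨z, hz, hz'⟩ := h
    exact ⟨z, hz, (sub_eq_zero.1 (by simpa using hz')).symm⟩
  choose r hr hrx using hex
  have hrinj : Function.Injective r := fun a b h => hx (by rw [← hrx, ← hrx, h])
  have hle : Finset.univ.val.map r ≤ s :=
    (Multiset.le_iff_subset (Finset.univ.nodup.map hrinj)).2 fun z hz => by
      obtain ⟨i, -, rfl⟩ := Multiset.mem_map.1 hz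
      exact hr i
  have heq : Finset.univ.val.map r = s := by
    refine Multiset.eq_of_le_of_card_le hle ?_
    have hc := Multiset.card_map S.subtype s
    rw [hs] at hc
    rw [← hc, Multiset.card_map]
    refine (card_roots' _).trans ((natDegree_map_le).trans ?_)
    rw [hcard]
    rfl
  refine ⟨r, ?_, hrx⟩
  rw [← hs, ← heq, Multiset.map_map, Multiset.map_map] at hprod
  exact hprod

/-- The nonzero vectors of `𝔽₂⁵`. -/
abbrev NzVec := {v : Vec // v ≠ 0}

/-- A labelling of the roots of the cover and of the dual cover by nonzero vectors for which the
incidence form detects orthogonality. -/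
structure IsLabelling {k : Type*} [Field k] (γ T : k) (x y : NzVec → k) : Prop where
  cover : coverPoly γ T = C (γ ^ 16 * (γ ^ 2 - 1) ^ 6) * ∏ v, (X - C (x v))
  dual : dualPoly γ T = C (γ ^ 6 * (1 - γ) ^ 16) * ∏ w, (X - C (y w))
  inc : ∀ v w : NzVec, w.1 ⬝ᵥ v.1 = 0 → eval3 Int.cast incList γ (y w) (x v) = 0
  co : ∀ v w : NzVec, w.1 ⬝ᵥ v.1 ≠ 0 → eval3 Int.cast coList γ (y w) (x v) = 0

instance : Fact (Nat.Prime 881) := ⟨by norm_num⟩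

lemma inc_mul_co_eq_zero {R : Type*} [CommRing R] {γ T x y : R}
    (hx : (coverPoly γ T).eval x = 0) (hy : (dualPoly γ T).eval y = 0) :
    eval3 Int.cast incList γ y x * eval3 Int.cast coList γ y x = 0 := by
  rw [← fiber_product_factorization]
  rw [eval_coverPoly] at hx
  rw [eval_dualPoly] at hy
  linear_combination 4 * denomDual Int.cast γ y * hx + denom Int.cast γ x * hy

lemma card_nzVec : Fintype.card NzVec = 31 := by decide +kernel

lemma IsLabelling.eval_cover {k : Type*} [Field k] {γ T : k} {x y : NzVec → k}
    (h : IsLabelling γ T x y) (v : NzVec) : (coverPoly γ T).eval (x v) = 0 := by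
  rw [h.cover, eval_mul, eval_prod, Finset.prod_eq_zero (Finset.mem_univ v) (by simp), mul_zero]

lemma IsLabelling.eval_dual {k : Type*} [Field k] {γ T : k} {x y : NzVec → k}
    (h : IsLabelling γ T x y) (w : NzVec) : (dualPoly γ T).eval (y w) = 0 := by
  rw [h.dual, eval_mul, eval_prod, Finset.prod_eq_zero (Finset.mem_univ w) (by simp), mul_zero]

/-- The labelling of the special fibre modulo `881` lifts to characteristic zero. -/
theorem IsLabelling.exists_lift {R Ω k : Type*} [CommRing R] [Field Ω] [IsAlgClosed Ω] [Field k]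
    [IsAlgClosed k] {ι : R →+* Ω} (hι : Function.Injective ι) {φ : R →+* k} (a : ZMod 881 →+* k)
    {γ T : R} (hγ : φ γ = a 353) (hT : φ T = a 870) :
    ∃ x y, IsLabelling (ι γ) (ι T) x y := by
  have hφ1 : φ (γ ^ 16 * (γ ^ 2 - 1) ^ 6) ≠ 0 := by
    have h : (353 ^ 16 * (353 ^ 2 - 1) ^ 6 : ZMod 881) ≠ 0 := by decide +kernel
    have h' := (map_ne_zero a).2 h
    rw [map_mul, map_pow, map_pow, map_sub, map_pow, map_one, ← hγ] at h'
    rwa [map_mul, map_pow, map_pow, map_sub, map_pow, map_one]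
  have hφ2 : φ (γ ^ 6 * (1 - γ) ^ 16) ≠ 0 := by
    have h : (353 ^ 6 * (1 - 353) ^ 16 : ZMod 881) ≠ 0 := by decide +kernel
    have h' := (map_ne_zero a).2 h
    rw [map_mul, map_pow, map_pow, map_sub, map_one, ← hγ] at h'
    rwa [map_mul, map_pow, map_pow, map_sub, map_one]
  have hR1 : γ ^ 16 * (γ ^ 2 - 1) ^ 6 ≠ 0 := fun h => hφ1 (by rw [h, map_zero])
  have hR2 : γ ^ 6 * (1 - γ) ^ 16 ≠ 0 := fun h => hφ2 (by rw [h, map_zero])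
  have hPl := leadingCoeff_coverPoly hR1 T
  have hQl := leadingCoeff_dualPoly hR2 T
  obtain ⟨S, j, ψ, hj, hψ, hS⟩ := exists_extension_to_roots ι hι φ
  obtain ⟨x, hx, hxψ⟩ := exists_lift_roots hj hψ (coverPoly γ T) (hS _ (by rwa [hPl]))
    (by rwa [hPl]) (by rw [hPl]; exact (map_ne_zero_iff ι hι).2 hR1)
    (fun v : NzVec => a v.1.point)
    (fun v w h => Subtype.ext (Vec.point_injOn _ _ v.2 w.2 (a.injective h)))
    (fun v => by
      rw [map_coverPoly, hγ, hT, IsRoot, eval_coverPoly, ← map_numer, ← map_denom, ← map_mul,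
        ← map_sub, Vec.point_root, map_zero])
    (by rw [card_nzVec]; exact natDegree_coverPoly hR1 _)
  obtain ⟨y, hy, hyψ⟩ := exists_lift_roots hj hψ (dualPoly γ T) (hS _ (by rwa [hQl]))
    (by rwa [hQl]) (by rw [hQl]; exact (map_ne_zero_iff ι hι).2 hR2)
    (fun v : NzVec => a v.1.hyperplane)
    (fun v w h => Subtype.ext (Vec.hyperplane_injOn _ _ v.2 w.2 (a.injective h)))
    (fun v => by
      have h4 : (4 : k) = a 4 := (map_ofNat a 4).symm
      rw [map_dualPoly, hγ, hT, IsRoot, eval_dualPoly, ← map_numerDual, ← map_denomDual, h4,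
        ← map_mul, ← map_mul, ← map_add, Vec.hyperplane_root, map_zero])
    (by rw [card_nzVec]; exact natDegree_dualPoly hR2 _)
  rw [hPl, map_coverPoly] at hx
  rw [hQl, map_dualPoly] at hy
  have hψγ : ψ (j γ) = a 353 := (DFunLike.congr_fun hψ γ).trans hγ
  have hjγ : S.subtype (j γ) = ι γ := DFunLike.congr_fun hj γ
  have hroot : ∀ v w : NzVec, eval3 Int.cast incList (ι γ) (y w : Ω) (x v) *
      eval3 Int.cast coList (ι γ) (y w : Ω) (x v) = 0 := fun v w => by
    refine inc_mul_co_eq_zero (T := ι T) ?_ ?_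
    · rw [hx, eval_mul, eval_prod, Finset.prod_eq_zero (Finset.mem_univ v) (by simp), mul_zero]
    · rw [hy, eval_mul, eval_prod, Finset.prod_eq_zero (Finset.mem_univ w) (by simp), mul_zero]
  have hres : ∀ (L : List (List (List ℤ))) (v w : NzVec),
      eval3 Int.cast L (ι γ) (y w : Ω) (x v) = 0 →
      eval3 Int.cast L 353 w.1.hyperplane v.1.point = 0 := fun L v w h => by
    have h1 : eval3 Int.cast L (j γ) (y w) (x v) = 0 := by
      apply Subtype.val_injective
      change S.subtype _ = S.subtype 0
      rw [map_eval3, hjγ, map_zero]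
      exact h
    have h2 := congrArg ψ h1
    rwa [map_eval3, hψγ, hxψ, hyψ, ← map_eval3, map_zero, map_eq_zero] at h2
  refine ⟨fun v => x v, fun w => y w, ⟨?_, ?_, fun v w h => ?_, fun v w h => ?_⟩⟩
  · simpa using hx
  · simpa using hy
  · refine (mul_eq_zero.1 (hroot v w)).resolve_right fun hc => ?_
    have h' := hres _ v w hc
    rw [eval3_eq_zero_of_zeroPattern zeroPattern_coList v.2 w.2, h] at h'
    exact zero_ne_one h'
  · refine (mul_eq_zero.1 (hroot v w)).resolve_left fun hc => h ?_
    exact (eval3_eq_zero_of_zeroPattern zeroPattern_incList v.2 w.2).1 (hres _ v w hc)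

/-- A labelling of a fibre specializes outside the branch locus. -/
theorem IsLabelling.specialize {R Ω k : Type*} [CommRing R] [Field Ω] [Field k]
    [IsAlgClosed k] {ι : R →+* Ω} (hι : Function.Injective ι) (φ : R →+* k) {γ T : R}
    {x y : NzVec → Ω} (h : IsLabelling (ι γ) (ι T) x y)
    (h1 : φ γ ^ 16 * (φ γ ^ 2 - 1) ^ 6 ≠ 0) (h2 : φ γ ^ 6 * (1 - φ γ) ^ 16 ≠ 0) :
    ∃ x y, IsLabelling (φ γ) (φ T) x y := by
  have hφ1 : φ (γ ^ 16 * (γ ^ 2 - 1) ^ 6) ≠ 0 := by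
    rwa [map_mul, map_pow, map_pow, map_sub, map_pow, map_one]
  have hφ2 : φ (γ ^ 6 * (1 - γ) ^ 16) ≠ 0 := by
    rwa [map_mul, map_pow, map_pow, map_sub, map_one]
  have hR1 : γ ^ 16 * (γ ^ 2 - 1) ^ 6 ≠ 0 := fun h => hφ1 (by rw [h, map_zero])
  have hR2 : γ ^ 6 * (1 - γ) ^ 16 ≠ 0 := fun h => hφ2 (by rw [h, map_zero])
  obtain ⟨S, j, ψ, hj, hψ, hS⟩ := exists_extension_to_roots ι hι φ
  have hx : ∀ v, x v ∈ S := fun v =>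
    hS (coverPoly γ T) (by rwa [leadingCoeff_coverPoly hR1]) _
      (by rw [map_coverPoly]; exact h.eval_cover v)
  have hy : ∀ w, y w ∈ S := fun w =>
    hS (dualPoly γ T) (by rwa [leadingCoeff_dualPoly hR2]) _
      (by rw [map_dualPoly]; exact h.eval_dual w)
  have hψγ : ψ (j γ) = φ γ := DFunLike.congr_fun hψ γ
  have hjγ : S.subtype (j γ) = ι γ := DFunLike.congr_fun hj γ
  have hres : ∀ (L : List (List (List ℤ))) (v w : NzVec),
      eval3 Int.cast L (ι γ) (y w) (x v) = 0 →
      eval3 Int.cast L (φ γ) (ψ ⟨y w, hy w⟩) (ψ ⟨x v, hx v⟩) = 0 := fun L v w h => by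
    have h1 : eval3 Int.cast L (j γ) ⟨y w, hy w⟩ ⟨x v, hx v⟩ = 0 := by
      apply Subtype.val_injective
      change S.subtype _ = S.subtype 0
      rw [map_eval3, hjγ, map_zero]
      exact h
    have h2 := congrArg ψ h1
    rwa [map_eval3, hψγ, map_zero] at h2
  refine ⟨fun v => ψ ⟨x v, hx v⟩, fun w => ψ ⟨y w, hy w⟩, ⟨?_, ?_, fun v w hvw => ?_,
    fun v w hvw => ?_⟩⟩
  · have := map_eq_prod_of_extension hj hψ (coverPoly γ T) (γ ^ 16 * (γ ^ 2 - 1) ^ 6)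
      (fun v => ⟨x v, hx v⟩) (by rw [map_coverPoly, h.cover]; simp)
    rw [map_coverPoly] at this
    simpa using this
  · have := map_eq_prod_of_extension hj hψ (dualPoly γ T) (γ ^ 6 * (1 - γ) ^ 16)
      (fun w => ⟨y w, hy w⟩) (by rw [map_dualPoly, h.dual]; simp)
    rw [map_dualPoly] at this
    simpa using this
  · exact hres _ v w (h.inc v w hvw)
  · exact hres _ v w (h.co v w hvw)

/-- The homomorphism from `ℤ[γ][T]` given by a choice of parameters. -/
noncomputable def evalParams {A : Type*} [CommRing A] (γ T : A) : ℤ[X][X] →+* A :=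
  eval₂RingHom (eval₂RingHom (Int.castRingHom A) γ) T

lemma evalParams_C_X {A : Type*} [CommRing A] (γ T : A) : evalParams γ T (C X) = γ := by
  simp only [evalParams, coe_eval₂RingHom, eval₂_C, eval₂_X]

lemma evalParams_X {A : Type*} [CommRing A] (γ T : A) : evalParams γ T X = T := by
  simp only [evalParams, coe_eval₂RingHom, eval₂_X]

/-- Every fibre outside the branch locus has a labelling. -/
theorem exists_isLabelling {k : Type*} [Field k] [IsAlgClosed k] (γ T : k)
    (h1 : γ ^ 16 * (γ ^ 2 - 1) ^ 6 ≠ 0) (h2 : γ ^ 6 * (1 - γ) ^ 16 ≠ 0) :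
    ∃ x y, IsLabelling γ T x y := by
  let ι : ℤ[X][X] →+* AlgebraicClosure (FractionRing ℤ[X][X]) :=
    (algebraMap (FractionRing ℤ[X][X]) _).comp (algebraMap ℤ[X][X] (FractionRing ℤ[X][X]))
  have hι : Function.Injective ι :=
    (algebraMap (FractionRing ℤ[X][X]) _).injective.comp (IsFractionRing.injective _ _)
  let a : ZMod 881 →+* AlgebraicClosure (ZMod 881) := algebraMap _ _
  obtain ⟨x, y, h⟩ := IsLabelling.exists_lift hι (φ := evalParams (a 353) (a 870)) a
    (evalParams_C_X _ _) (evalParams_X _ _)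
  have h3 := h.specialize hι (evalParams γ T)
    (by rwa [evalParams_C_X]) (by rwa [evalParams_C_X])
  rwa [evalParams_C_X, evalParams_X] at h3

end Lifting

section Bezout

variable {R : Type*} [CommRing R] (γ x : R)

lemma bezout_h_q : ((4 - 4 * γ + 3 * γ ^ 2 - γ ^ 3) + (-2 * γ + 2 * γ ^ 2 - γ ^ 3) * x) * eval2
    Int.cast hList γ x + ((-8 + 8 * γ - 8 * γ ^ 2 - 2 * γ ^ 3 - 6 * γ ^ 4 + 2 * γ ^ 5 - 2 * γ ^
    6) + (-16 + 32 * γ - 36 * γ ^ 2 + 9 * γ ^ 3 + 11 * γ ^ 4 - 13 * γ ^ 5 + 5 * γ ^ 6) * x + (24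
    * γ - 36 * γ ^ 2 + 50 * γ ^ 3 - 33 * γ ^ 4 + 14 * γ ^ 5 - 3 * γ ^ 6) * x ^ 2 + (-4 * γ ^ 2 -
    3 * γ ^ 3 + γ ^ 4 - γ ^ 5 - γ ^ 6) * x ^ 3 + (-2 * γ ^ 2 + 2 * γ ^ 3 + γ ^ 4 - 2 * γ ^ 5 + γ
    ^ 6) * x ^ 4) * eval2 Int.cast qList γ x = 8 * γ * (γ ^ 2 + 1) ^ 2 := by
  simp [eval2, horner, hList, qList]
  ring

lemma bezout_k_q : ((-8 + 8 * γ - 12 * γ ^ 2 + 8 * γ ^ 3 - 4 * γ ^ 4 + γ ^ 5) + (4 * γ - 4 * γ ^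
    2 + 5 * γ ^ 3 - 3 * γ ^ 4 + γ ^ 5) * x) * eval2 Int.cast kList γ x + ((-16 * γ + 8 * γ ^ 2 -
    28 * γ ^ 3 - 16 * γ ^ 5 - 7 * γ ^ 6 - 4 * γ ^ 7 - γ ^ 8) + (-48 * γ + 52 * γ ^ 2 - 108 * γ ^
    3 + 37 * γ ^ 4 - 13 * γ ^ 5 - 44 * γ ^ 6 + 48 * γ ^ 7 - 29 * γ ^ 8 + 9 * γ ^ 9) * x + (-56 *
    γ + 144 * γ ^ 2 - 286 * γ ^ 3 + 378 * γ ^ 4 - 349 * γ ^ 5 + 258 * γ ^ 6 - 122 * γ ^ 7 + 36 *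
    γ ^ 8 - 3 * γ ^ 9) * x ^ 2 + (-16 + 32 * γ - 56 * γ ^ 2 + 52 * γ ^ 3 - 7 * γ ^ 4 - 31 * γ ^
    5 + 56 * γ ^ 6 - 48 * γ ^ 7 + 23 * γ ^ 8 - 5 * γ ^ 9) * x ^ 3 + (4 * γ ^ 3 - 4 * γ ^ 4 + γ ^
    5 + γ ^ 6 - 4 * γ ^ 7 + 3 * γ ^ 8 - γ ^ 9) * x ^ 4) * eval2 Int.cast qList γ x = 8 * γ ^ 2 *
    (γ ^ 2 + 1) ^ 3 := by
  simp [eval2, horner, kList, qList]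
  ring

lemma bezout_l_q : ((-1) + (γ) * x) * eval2 Int.cast lList γ x + ((-γ)) * eval2 Int.cast qList γ
    x = (γ ^ 2 + 1) := by
  simp [eval2, horner, lList, qList]
  ring

lemma bezout_h_c1 : ((-1 + 4 * γ - 6 * γ ^ 2 + 4 * γ ^ 3 - γ ^ 4)) * eval2 Int.cast hList γ x +
    ((-4 - 4 * γ - 10 * γ ^ 2 - 2 * γ ^ 3 - 8 * γ ^ 4 - 8 * γ ^ 5 + 6 * γ ^ 6 - 2 * γ ^ 7) + (8
    - 20 * γ + 31 * γ ^ 2 - 15 * γ ^ 3 - 18 * γ ^ 4 + 30 * γ ^ 5 - 21 * γ ^ 6 + 5 * γ ^ 7) * x +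
    (-12 * γ + 41 * γ ^ 2 - 67 * γ ^ 3 + 70 * γ ^ 4 - 46 * γ ^ 5 + 17 * γ ^ 6 - 3 * γ ^ 7) * x ^
    2 + (γ ^ 2 - γ ^ 3 - 2 * γ ^ 4 + 2 * γ ^ 5 + γ ^ 6 - γ ^ 7) * x ^ 3 + (γ ^ 2 - 3 * γ ^ 3 + 2
    * γ ^ 4 + 2 * γ ^ 5 - 3 * γ ^ 6 + γ ^ 7) * x ^ 4) * ((γ - 1) * x - (γ + 1)) = 4 * (γ + 1) ^
    2 * (γ ^ 2 + 1) ^ 2 := by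
  simp [eval2, horner, hList]
  ring

lemma bezout_k_c1 : ((1 - 4 * γ + 6 * γ ^ 2 - 4 * γ ^ 3 + γ ^ 4)) * eval2 Int.cast kList γ x +
    ((-4 - 11 * γ ^ 2 - 5 * γ ^ 3 - 2 * γ ^ 4 - 10 * γ ^ 5 + γ ^ 6 - γ ^ 7) + (4 - 4 * γ + 7 * γ
    ^ 2 - 18 * γ ^ 3 + 43 * γ ^ 4 - 68 * γ ^ 5 + 65 * γ ^ 6 - 38 * γ ^ 7 + 9 * γ ^ 8) * x + (-4
    + 24 * γ - 77 * γ ^ 2 + 150 * γ ^ 3 - 197 * γ ^ 4 + 180 * γ ^ 5 - 103 * γ ^ 6 + 30 * γ ^ 7 -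
    3 * γ ^ 8) * x ^ 2 + (4 - 16 * γ + 29 * γ ^ 2 - 30 * γ ^ 3 + 9 * γ ^ 4 + 24 * γ ^ 5 - 37 * γ
    ^ 6 + 22 * γ ^ 7 - 5 * γ ^ 8) * x ^ 3 + (-γ ^ 3 + 3 * γ ^ 4 - 2 * γ ^ 5 - 2 * γ ^ 6 + 3 * γ
    ^ 7 - γ ^ 8) * x ^ 4) * ((γ - 1) * x - (γ + 1)) = 4 * (γ + 1) * (γ ^ 2 + 1) ^ 3 := by
  simp [eval2, horner, kList]
  ring

lemma bezout_l_c1 : ((-1 + γ)) * eval2 Int.cast lList γ x + ((-γ)) * ((γ - 1) * x - (γ + 1)) =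
    (γ ^ 2 + 1) := by
  simp [eval2, horner, lList]
  ring

lemma bezout_h_c2 : ((-12 + 20 * γ - 20 * γ ^ 2 + 12 * γ ^ 3) + (5 - γ - γ ^ 2 + 5 * γ ^ 3) * x)
    * eval2 Int.cast hList γ x + ((4 - 20 * γ ^ 2 + 16 * γ ^ 3 - 4 * γ ^ 4 - 16 * γ ^ 5 + 20 * γ
    ^ 6) + (40 - 64 * γ + 78 * γ ^ 2 + 8 * γ ^ 3 - 68 * γ ^ 4 + 72 * γ ^ 5 - 34 * γ ^ 6) * x +
    (-60 * γ + 99 * γ ^ 2 - 162 * γ ^ 3 + 112 * γ ^ 4 - 66 * γ ^ 5 + 13 * γ ^ 6) * x ^ 2 + (8 *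
    γ ^ 2 + 8 * γ ^ 3 + 8 * γ ^ 5 + 8 * γ ^ 6) * x ^ 3 + (5 * γ ^ 2 - 6 * γ ^ 3 + 6 * γ ^ 5 - 5
    * γ ^ 6) * x ^ 4) * ((γ + 1) * x ^ 2 + 2 * (γ - 1) * x - (γ + 1)) = 4 * (γ - 1) * (γ + 1) ^
    2 * (γ ^ 2 + 1) ^ 2 := by
  simp [eval2, horner, hList]
  ring

lemma bezout_k_c2 : ((-29 + 24 * γ - 40 * γ ^ 2 + 22 * γ ^ 3 - 11 * γ ^ 4 + 2 * γ ^ 5) + (12 + 7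
    * γ + 6 * γ ^ 2 + 8 * γ ^ 3 - 2 * γ ^ 4 + γ ^ 5) * x) * eval2 Int.cast kList γ x + ((4 - 12
    * γ - 5 * γ ^ 2 + 13 * γ ^ 3 - 16 * γ ^ 4 + 14 * γ ^ 5 + 7 * γ ^ 6 - 11 * γ ^ 7 + 10 * γ ^ 8
    - 4 * γ ^ 9) + (-8 - 76 * γ - 62 * γ ^ 2 - 22 * γ ^ 3 - 318 * γ ^ 4 + 202 * γ ^ 5 - 314 * γ
    ^ 6 + 142 * γ ^ 7 - 66 * γ ^ 8 + 10 * γ ^ 9) * x + (20 - 192 * γ + 385 * γ ^ 2 - 677 * γ ^ 3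
    + 733 * γ ^ 4 - 565 * γ ^ 5 + 371 * γ ^ 6 - 103 * γ ^ 7 + 27 * γ ^ 8 + γ ^ 9) * x ^ 2 + (-48
    + 68 * γ - 124 * γ ^ 2 + 76 * γ ^ 3 + 32 * γ ^ 4 - 72 * γ ^ 5 + 116 * γ ^ 6 - 68 * γ ^ 7 +
    24 * γ ^ 8 - 4 * γ ^ 9) * x ^ 3 + (12 * γ ^ 3 - 5 * γ ^ 4 - γ ^ 5 + 2 * γ ^ 6 - 10 * γ ^ 7 +
    3 * γ ^ 8 - γ ^ 9) * x ^ 4) * ((γ + 1) * x ^ 2 + 2 * (γ - 1) * x - (γ + 1)) = 4 * (γ - 1) ^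
    3 * (γ + 1) * (γ ^ 2 + 1) ^ 3 := by
  simp [eval2, horner, kList]
  ring

lemma bezout_l_c2 : ((1 - γ + 2 * γ ^ 2) + (γ + γ ^ 2) * x) * eval2 Int.cast lList γ x + ((-γ ^
    2)) * ((γ + 1) * x ^ 2 + 2 * (γ - 1) * x - (γ + 1)) = (γ - 1) * (γ ^ 2 + 1) := by
  simp [eval2, horner, lList]
  ring

lemma bezout_q_c1 : ((1 - 2 * γ + γ ^ 2)) * eval2 Int.cast qList γ x + ((-2 + γ - γ ^ 2) + (γ -
    γ ^ 2) * x) * ((γ - 1) * x - (γ + 1)) = 2 * (γ ^ 2 + 1) := by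
  simp [eval2, horner, qList]
  ring

lemma bezout_q_c2 : ((2 - 2 * γ) + (-1 - γ) * x) * eval2 Int.cast qList γ x + ((-2) + (γ) * x) *
    ((γ + 1) * x ^ 2 + 2 * (γ - 1) * x - (γ + 1)) = 2 * (γ ^ 2 + 1) := by
  simp [eval2, horner, qList]
  ring

lemma bezout_c1_c2 : ((-3 + 2 * γ - 3 * γ ^ 2) + (1 - γ ^ 2) * x) * ((γ - 1) * x - (γ + 1)) +
    ((1 - 2 * γ + γ ^ 2)) * ((γ + 1) * x ^ 2 + 2 * (γ - 1) * x - (γ + 1)) = 2 * (γ + 1) * (γ ^ 2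
    + 1) := by
  ring

lemma bezout_q_dq : ((-2 * γ)) * eval2 Int.cast qList γ x + ((-1) + (γ) * x) * (2 * γ * x - 2) =
    2 * (γ ^ 2 + 1) := by
  simp [eval2, horner, qList]
  ring

lemma bezout_c2_dc2 : ((-2 - 2 * γ)) * ((γ + 1) * x ^ 2 + 2 * (γ - 1) * x - (γ + 1)) + ((-1 + γ)
    + (1 + γ) * x) * (2 * (γ + 1) * x + 2 * (γ - 1)) = 4 * (γ ^ 2 + 1) := by
  ring

end Bezout

lemma eval2_cList {R : Type*} [CommRing R] (γ x : R) :
    eval2 Int.cast cList γ x =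
      ((γ - 1) * x - (γ + 1)) * ((γ + 1) * x ^ 2 + 2 * (γ - 1) * x - (γ + 1)) := by
  simp [eval2, horner, cList]
  ring

lemma isCoprime_of_bezout {A : Type*} [CommRing A] {f g u v r : A} (h : u * f + v * g = r)
    (hr : IsUnit r) : IsCoprime f g := by
  obtain ⟨s, hs⟩ := hr.exists_left_inv
  exact ⟨s * u, s * v, by rw [mul_assoc, mul_assoc, ← mul_add, h, hs]⟩

/-- The parameters with four distinct branch points. -/
structure IsRegular {F : Type*} [Field F] (γ : F) : Prop where
  ne_zero : γ ≠ 0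
  sub_one_ne_zero : γ - 1 ≠ 0
  add_one_ne_zero : γ + 1 ≠ 0
  sq_add_one_ne_zero : γ ^ 2 + 1 ≠ 0

section Coprime

variable {F : Type*} [Field F] [CharZero F] {γ : F}

theorem IsRegular.isCoprime_numer_denom (hγ : IsRegular γ) :
    IsCoprime (numer Int.cast (C γ) X) (denom Int.cast (C γ) X) := by
  have h0 : IsUnit (C γ) := (isUnit_iff_ne_zero.2 hγ.ne_zero).map C
  have hm : IsUnit (C γ - 1) := by
    simpa using (isUnit_iff_ne_zero.2 hγ.sub_one_ne_zero).map C
  have hp : IsUnit (C γ + 1) := by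
    simpa using (isUnit_iff_ne_zero.2 hγ.add_one_ne_zero).map C
  have hi : IsUnit (C γ ^ 2 + 1) := by
    simpa using (isUnit_iff_ne_zero.2 hγ.sq_add_one_ne_zero).map C
  have hn : ∀ n : ℕ, n ≠ 0 → IsUnit (n : F[X]) := fun n hn => by
    simpa only [map_natCast] using
      (isUnit_iff_ne_zero.2 (Nat.cast_ne_zero.2 hn : (n : F) ≠ 0)).map C
  have h2 : IsUnit (2 : F[X]) := hn 2 two_ne_zero
  have h4 : IsUnit (4 : F[X]) := hn 4 (by norm_num)
  have h8 : IsUnit (8 : F[X]) := hn 8 (by norm_num)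
  have key : ∀ f : F[X], IsCoprime f (eval2 Int.cast qList (C γ) X) →
      IsCoprime f ((C γ - 1) * X - (C γ + 1)) →
      IsCoprime f ((C γ + 1) * X ^ 2 + 2 * (C γ - 1) * X - (C γ + 1)) → IsCoprime f X →
      IsCoprime f (denom Int.cast (C γ) X) := fun f hq h1 h2 hX =>
    ((hq.pow_right.mul_right ((eval2_cList (C γ) X ▸ h1.mul_right h2).pow_right)).mul_right hX)
  have hh := key (eval2 Int.cast hList (C γ) X)
    (isCoprime_of_bezout (bezout_h_q _ _) ((h8.mul h0).mul (hi.pow 2)))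
    (isCoprime_of_bezout (bezout_h_c1 _ _) ((h4.mul (hp.pow 2)).mul (hi.pow 2)))
    (isCoprime_of_bezout (bezout_h_c2 _ _) (((h4.mul hm).mul (hp.pow 2)).mul (hi.pow 2)))
    (isCoprime_of_bezout (u := 1) (r := 2 * C γ ^ 2 * (C γ + 1) ^ 2)
      (v := -eval2 Int.cast hList.tail (C γ) X)
      (by simp [eval2, horner, hList]; ring) ((h2.mul (h0.pow 2)).mul (hp.pow 2)))
  have hk := key (eval2 Int.cast kList (C γ) X)
    (isCoprime_of_bezout (bezout_k_q _ _) ((h8.mul (h0.pow 2)).mul (hi.pow 3)))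
    (isCoprime_of_bezout (bezout_k_c1 _ _) ((h4.mul hp).mul (hi.pow 3)))
    (isCoprime_of_bezout (bezout_k_c2 _ _) (((h4.mul (hm.pow 3)).mul hp).mul (hi.pow 3)))
    (isCoprime_of_bezout (u := -1) (r := C γ ^ 2 * (C γ - 1) * (C γ + 1))
      (v := eval2 Int.cast kList.tail (C γ) X)
      (by simp [eval2, horner, kList]; ring) (((h0.pow 2).mul hm).mul hp))
  have hl := key (eval2 Int.cast lList (C γ) X)
    (isCoprime_of_bezout (bezout_l_q _ _) hi)
    (isCoprime_of_bezout (bezout_l_c1 _ _) hi)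
    (isCoprime_of_bezout (bezout_l_c2 _ _) (hm.mul hi))
    (isCoprime_of_bezout (u := -1) (r := 1) (v := C γ)
      (by simp [eval2, horner, lList]) isUnit_one)
  exact (hh.pow_left.mul_left hk.pow_left).mul_left hl

end Coprime

section Dual

variable {F : Type*} [Field F] {γ : F}

lemma eval2_hDual (hp : γ + 1 ≠ 0) (y : F) : 4 * eval2 Int.cast hDual γ y =
    (γ + 1) ^ 4 * eval2 Int.cast hList ((1 - γ) / (γ + 1)) y := by
  simp [eval2, horner, hDual, hList]
  field_simp
  ring

lemma eval2_kDual (hp : γ + 1 ≠ 0) (y : F) : 4 * eval2 Int.cast kDual γ y =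
    (γ + 1) ^ 5 * eval2 Int.cast kList ((1 - γ) / (γ + 1)) y := by
  simp [eval2, horner, kDual, kList]
  field_simp
  ring

lemma eval2_lDual (hp : γ + 1 ≠ 0) (y : F) : eval2 Int.cast lDual γ y =
    (γ + 1) * eval2 Int.cast lList ((1 - γ) / (γ + 1)) y := by
  simp [eval2, horner, lDual, lList]
  field_simp
  ring

lemma eval2_qDual (hp : γ + 1 ≠ 0) (y : F) : eval2 Int.cast qDual γ y =
    (γ + 1) * eval2 Int.cast qList ((1 - γ) / (γ + 1)) y := by
  simp [eval2, horner, qDual, qList]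
  field_simp
  ring

lemma eval2_cDual (hp : γ + 1 ≠ 0) (y : F) : 4 * eval2 Int.cast cDual γ y =
    (γ + 1) ^ 2 * eval2 Int.cast cList ((1 - γ) / (γ + 1)) y := by
  simp [eval2, horner, cDual, cList]
  field_simp
  ring

variable [CharZero F]

lemma IsRegular.dual (hγ : IsRegular γ) : IsRegular ((1 - γ) / (γ + 1)) where
  ne_zero := div_ne_zero (by rw [← neg_sub]; exact neg_ne_zero.2 hγ.sub_one_ne_zero)
    hγ.add_one_ne_zero
  sub_one_ne_zero := by
    have := hγ.add_one_ne_zero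
    rw [show (1 - γ) / (γ + 1) - 1 = -2 * γ / (γ + 1) by field_simp; ring]
    exact div_ne_zero (mul_ne_zero (by norm_num) hγ.ne_zero) this
  add_one_ne_zero := by
    have := hγ.add_one_ne_zero
    rw [show (1 - γ) / (γ + 1) + 1 = 2 / (γ + 1) by field_simp; ring]
    exact div_ne_zero two_ne_zero this
  sq_add_one_ne_zero := by
    have := hγ.add_one_ne_zero
    rw [show ((1 - γ) / (γ + 1)) ^ 2 + 1 = 2 * (γ ^ 2 + 1) / (γ + 1) ^ 2 by field_simp; ring]
    exact div_ne_zero (mul_ne_zero two_ne_zero hγ.sq_add_one_ne_zero) (pow_ne_zero 2 this)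

lemma numer_ne_zero_of_denom_eq_zero (hγ : IsRegular γ) {x : F} (hx : denom Int.cast γ x = 0) :
    numer Int.cast γ x ≠ 0 := by
  obtain ⟨u, v, h⟩ := hγ.isCoprime_numer_denom
  intro h0
  have := congrArg (eval x) h
  simp [hx, h0] at this

lemma numerDual_ne_zero_of_denomDual_eq_zero (hγ : IsRegular γ) {y : F}
    (hy : denomDual Int.cast γ y = 0) : numerDual Int.cast γ y ≠ 0 := by
  have hp := hγ.add_one_ne_zero
  have h4 : (4 : F) ≠ 0 := by norm_num
  have hd : 256 * denomDual Int.cast γ y =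
      (γ + 1) ^ 16 * denom Int.cast ((1 - γ) / (γ + 1)) y := by
    have hc := congrArg (· ^ 4) (eval2_cDual hp y)
    simp only [denom, denomDual, eval2_qDual hp]
    linear_combination (exp := 1) (γ + 1) ^ 8 *
      eval2 Int.cast qList ((1 - γ) / (γ + 1)) y ^ 8 * y * hc
  have hn : 4096 * numerDual Int.cast γ y =
      (γ + 1) ^ 28 * numer Int.cast ((1 - γ) / (γ + 1)) y := by
    have hh := congrArg (· ^ 3) (eval2_hDual hp y)
    have hk := congrArg (· ^ 3) (eval2_kDual hp y)
    simp only [numer, numerDual, eval2_lDual hp]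
    have := congrArg₂ (· * ·) hh hk
    linear_combination (exp := 1) (γ + 1) * eval2 Int.cast lList ((1 - γ) / (γ + 1)) y * this
  intro h
  rw [hy, mul_zero, eq_comm, mul_eq_zero, or_iff_right (pow_ne_zero _ hp)] at hd
  rw [h, mul_zero, eq_comm, mul_eq_zero, or_iff_right (pow_ne_zero _ hp)] at hn
  exact numer_ne_zero_of_denom_eq_zero hγ.dual hd hn

end Dual

section Poles

variable {F : Type*} [Field F]

/-- A simple root of a factor `f` of the denominator is a root of exact multiplicity. -/
lemma exists_factor_of_simple_root {f g D : F[X]} {n : ℕ} (hD : D = f ^ n * g) {r : F}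
    (hf : f.eval r = 0) (hf' : (derivative f).eval r ≠ 0) (hg : g.eval r ≠ 0) :
    ∃ E : F[X], D = (X - C r) ^ n * E ∧ E.eval r ≠ 0 := by
  obtain ⟨p, hp⟩ := dvd_iff_isRoot.2 hf
  refine ⟨p ^ n * g, by rw [hD, hp, mul_pow, mul_assoc], ?_⟩
  have : p.eval r ≠ 0 := by
    simpa [hp] using hf'
  simpa [this] using hg

/-- The denominator has two distinct zeros of order four and a zero of order eight. -/
theorem IsRegular.exists_poles [IsAlgClosed F] [CharZero F] {γ : F} (hγ : IsRegular γ) :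
    (∃ r s : F, r ≠ s ∧
      (∃ E : F[X], denom Int.cast (C γ) X = (X - C r) ^ 4 * E ∧ E.eval r ≠ 0) ∧
      ∃ E : F[X], denom Int.cast (C γ) X = (X - C s) ^ 4 * E ∧ E.eval s ≠ 0) ∧
    ∃ r : F, ∃ E : F[X], denom Int.cast (C γ) X = (X - C r) ^ 8 * E ∧ E.eval r ≠ 0 := by
  have h0 := hγ.ne_zero
  have hm := hγ.sub_one_ne_zero
  have hp := hγ.add_one_ne_zero
  have hi := hγ.sq_add_one_ne_zero
  have hq : ∀ x : F, (eval2 Int.cast qList (C γ) X).eval x = eval2 Int.cast qList γ x :=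
    fun x => by
      rw [← coe_evalRingHom, map_eval2]
      simp
  have hD : denom Int.cast (C γ) X = (C (γ - 1) * X - C (γ + 1)) ^ 4 *
      ((C (γ + 1) * X ^ 2 + C (2 * (γ - 1)) * X - C (γ + 1)) ^ 4 *
        eval2 Int.cast qList (C γ) X ^ 8 * X) := by
    rw [denom, eval2_cList]
    simp only [C_add, C_sub, C_mul, C_1, C_ofNat, mul_pow]
    ring
  obtain ⟨s, hs⟩ := IsAlgClosed.exists_root
    (C (γ + 1) * X ^ 2 + C (2 * (γ - 1)) * X + C (-(γ + 1)))
    (by rw [degree_quadratic hp]; norm_num)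
  obtain ⟨t, ht⟩ := IsAlgClosed.exists_root (C γ * X ^ 2 + C (-2) * X + C (-γ))
    (by rw [degree_quadratic h0]; norm_num)
  replace hs : (γ + 1) * s ^ 2 + 2 * (γ - 1) * s - (γ + 1) = 0 := by
    simpa [IsRoot, sub_eq_add_neg] using hs
  replace ht : eval2 Int.cast qList γ t = 0 := by
    simp only [eval2, horner, qList, List.map_cons, List.map_nil, List.foldr_cons, List.foldr_nil]
    simp [IsRoot] at ht
    push_cast
    linear_combination ht
  set r := (γ + 1) / (γ - 1) with hr
  replace hr : (γ - 1) * r - (γ + 1) = 0 := by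
    rw [hr]
    field_simp
    ring
  have h12 : (2 : F) * (γ + 1) * (γ ^ 2 + 1) ≠ 0 :=
    mul_ne_zero (mul_ne_zero two_ne_zero hp) hi
  have h2i : (2 : F) * (γ ^ 2 + 1) ≠ 0 := mul_ne_zero two_ne_zero hi
  have h4i : (4 : F) * (γ ^ 2 + 1) ≠ 0 := mul_ne_zero (by norm_num) hi
  have hc2r : (γ + 1) * r ^ 2 + 2 * (γ - 1) * r - (γ + 1) ≠ 0 := fun h => h12 (by
    rw [← bezout_c1_c2 γ r, hr, h]
    ring)
  have hc1s : (γ - 1) * s - (γ + 1) ≠ 0 := fun h => h12 (by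
    rw [← bezout_c1_c2 γ s, hs, h]
    ring)
  have hqr : eval2 Int.cast qList γ r ≠ 0 := fun h => h2i (by
    rw [← bezout_q_c1 γ r, hr, h]
    ring)
  have hqs : eval2 Int.cast qList γ s ≠ 0 := fun h => h2i (by
    rw [← bezout_q_c2 γ s, hs, h]
    ring)
  have hc1t : (γ - 1) * t - (γ + 1) ≠ 0 := fun h => h2i (by
    rw [← bezout_q_c1 γ t, ht, h]
    ring)
  have hc2t : (γ + 1) * t ^ 2 + 2 * (γ - 1) * t - (γ + 1) ≠ 0 := fun h => h2i (by
    rw [← bezout_q_c2 γ t, ht, h]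
    ring)
  have hds : 2 * (γ + 1) * s + 2 * (γ - 1) ≠ 0 := fun h => h4i (by
    rw [← bezout_c2_dc2 γ s, hs, h]
    ring)
  have hdt : 2 * γ * t - 2 ≠ 0 := fun h => h2i (by
    rw [← bezout_q_dq γ t, ht, h]
    ring)
  have hr0 : r ≠ 0 := by
    intro h
    rw [h] at hr
    exact hp (by linear_combination -hr)
  have hs0 : s ≠ 0 := by
    intro h
    rw [h] at hs
    exact hp (by linear_combination -hs)
  have ht0 : t ≠ 0 := by
    intro h
    rw [h] at ht
    simp [eval2, horner, qList] at ht
    exact h0 ht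
  refine ⟨⟨r, s, fun h => hc1s (h ▸ hr), ?_, ?_⟩, t, ?_⟩
  · refine exists_factor_of_simple_root hD (by simpa using hr) (by simpa using hm) ?_
    simp only [eval_mul, eval_pow, hq, eval_X]
    exact mul_ne_zero (mul_ne_zero (pow_ne_zero _ (by simpa using hc2r)) (pow_ne_zero _ hqr)) hr0
  · rw [mul_assoc, mul_left_comm] at hD
    refine exists_factor_of_simple_root hD (by simpa using hs) ?_ ?_
    · intro h
      refine hds ?_
      simp at h
      linear_combination h
    · simp only [eval_mul, eval_pow, hq, eval_X]
      exact mul_ne_zero (pow_ne_zero _ (by simpa using hc1s)) (mul_ne_zero (pow_ne_zero _ hqs) hs0)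
  · rw [denom, mul_assoc]
    refine exists_factor_of_simple_root rfl (by rw [hq, ht]) ?_ ?_
    · have : eval2 Int.cast qList (C γ) X = C γ * X ^ 2 - C 2 * X - C γ := by
        simp [eval2, horner, qList, C_ofNat]
        ring
      rw [this]
      intro h
      refine hdt ?_
      simp at h
      linear_combination h
    · rw [eval2_cList]
      simp
      exact ⟨⟨hc1t, hc2t⟩, ht0⟩

end Poles

section Irreducibility

variable {F : Type*} [Field F]

lemma irreducible_map_C_sub_X_mul {N D : F[X]} (h : IsCoprime N D) (hD : D ≠ 0) :
    Irreducible (N.map C - C X * D.map C : F[X][X]) := by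
  have : (N.map C - C X * D.map C : F[X][X]) = Bivariate.swap (C N - X * C D) := by
    rw [_root_.map_sub, _root_.map_mul, Bivariate.swap_C, Bivariate.swap_Y, Bivariate.swap_C]
  rw [this, MulEquiv.irreducible_iff]
  convert! irreducible_C_mul_X_add_C (neg_ne_zero.mpr hD)
    ((IsCoprime.neg_right_iff _ _).mpr h).symm.isRelPrime using 1
  rw [add_comm, X_mul_C, map_neg, neg_mul]
  exact sub_eq_add_neg (C N) (C D * X)

/-- The generic fibre of a nonconstant rational function is irreducible. -/
theorem irreducible_map_ratFuncC_sub {N D : F[X]} (h : IsCoprime N D) (hD : D ≠ 0)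
    (hdeg : D.natDegree < N.natDegree) :
    Irreducible (N.map RatFunc.C - C RatFunc.X * D.map RatFunc.C : (RatFunc F)[X]) := by
  have hirr := irreducible_map_C_sub_X_mul h hD
  have hmap : (N.map C - C X * D.map C : F[X][X]).map (algebraMap F[X] (RatFunc F)) =
      N.map RatFunc.C - C RatFunc.X * D.map RatFunc.C := by
    simp [Polynomial.map_map, ← RatFunc.algebraMap_comp_C]
  rw [← hmap, ← IsPrimitive.irreducible_iff_irreducible_map_fraction_map]
  · exact hirr
  · refine hirr.isPrimitive fun H => ?_
    have h1 : (N.map C - C X * D.map C : F[X][X]).coeff N.natDegree = C N.leadingCoeff := by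
      rw [coeff_sub, coeff_C_mul, coeff_map, coeff_map, coeff_eq_zero_of_natDegree_lt hdeg]
      simp
    rw [coeff_eq_zero_of_natDegree_lt (by omega), eq_comm, C_eq_zero, leadingCoeff_eq_zero] at h1
    simp [h1] at hdeg

variable {γ : F}

lemma IsRegular.leadingCoeff_ne_zero (hγ : IsRegular γ) : γ ^ 16 * (γ ^ 2 - 1) ^ 6 ≠ 0 := by
  have := mul_ne_zero hγ.sub_one_ne_zero hγ.add_one_ne_zero
  refine mul_ne_zero (pow_ne_zero _ hγ.ne_zero) (pow_ne_zero _ ?_)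
  convert this using 1
  ring

lemma IsRegular.leadingCoeff_dual_ne_zero (hγ : IsRegular γ) : γ ^ 6 * (1 - γ) ^ 16 ≠ 0 := by
  refine mul_ne_zero (pow_ne_zero _ hγ.ne_zero) (pow_ne_zero _ ?_)
  rw [← neg_sub]
  exact neg_ne_zero.2 hγ.sub_one_ne_zero

lemma IsRegular.map {L : Type*} [Field L] (hγ : IsRegular γ) (φ : F →+* L) :
    IsRegular (φ γ) where
  ne_zero := (map_ne_zero φ).2 hγ.ne_zero
  sub_one_ne_zero := by simpa using (map_ne_zero φ).2 hγ.sub_one_ne_zero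
  add_one_ne_zero := by simpa using (map_ne_zero φ).2 hγ.add_one_ne_zero
  sq_add_one_ne_zero := by simpa using (map_ne_zero φ).2 hγ.sq_add_one_ne_zero

variable [CharZero F]

lemma IsRegular.denom_ne_zero (hγ : IsRegular γ) : denom Int.cast (C γ) X ≠ 0 := by
  intro h
  have h1 := hγ.isCoprime_numer_denom
  rw [h, isCoprime_zero_right] at h1
  have h2 := natDegree_eq_zero_of_isUnit h1
  have h3 := coeff_numer γ
  rw [coeff_eq_zero_of_natDegree_lt (by omega)] at h3
  exact hγ.leadingCoeff_ne_zero h3.symm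

/-- The cover is irreducible over the field of rational functions. -/
theorem IsRegular.irreducible_coverPoly (hγ : IsRegular γ) {s : F} (hs : s ≠ 0) :
    Irreducible (coverPoly (RatFunc.C γ) (RatFunc.C s * RatFunc.X)) := by
  have hu : IsUnit (C s) := isUnit_C.2 hs.isUnit
  have h := irreducible_map_ratFuncC_sub (N := numer Int.cast (C γ) X)
    (D := C s * denom Int.cast (C γ) X)
    ((isCoprime_mul_unit_left_right hu _ _).2 hγ.isCoprime_numer_denom)
    (mul_ne_zero hu.ne_zero hγ.denom_ne_zero) ?_
  · convert h using 1
    have hN : (numer Int.cast (C γ) X).map RatFunc.C = numer Int.cast (C (RatFunc.C γ)) X := by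
      rw [← coe_mapRingHom, map_numer, coe_mapRingHom, map_C, map_X]
    have hD : (denom Int.cast (C γ) X).map RatFunc.C = denom Int.cast (C (RatFunc.C γ)) X := by
      rw [← coe_mapRingHom, map_denom, coe_mapRingHom, map_C, map_X]
    rw [coverPoly, Polynomial.map_mul, hN, hD, map_C, C_mul]
    ring
  · refine lt_of_le_of_lt ((natDegree_C_mul_le _ _).trans (natDegree_denom_le γ))
      (lt_of_lt_of_le (by norm_num : 29 < 31) (le_natDegree_of_ne_zero ?_))
    rw [coeff_numer]
    exact hγ.leadingCoeff_ne_zero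

end Irreducibility

section Monodromy

open scoped Matrix

lemma Vec.eq_or_eq_or_eq_add_of_orthogonal {p q r : Vec} (hr : r ≠ 0)
    (h : ∀ w : Vec, w ⬝ᵥ p = 0 → w ⬝ᵥ q = 0 → w ⬝ᵥ r = 0) : r = p ∨ r = q ∨ r = p + q := by
  have hspan := mem_span_of_iInf_ker_le_ker (L := ![dotProductEquiv (ZMod 2) (Fin 5) p,
    dotProductEquiv (ZMod 2) (Fin 5) q]) (K := dotProductEquiv (ZMod 2) (Fin 5) r) fun w hw => by
      have h0 := (Submodule.mem_iInf _).1 hw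
      have h1 := h0 0
      have h2 := h0 1
      simp only [Matrix.cons_val_zero, Matrix.cons_val_one, LinearMap.mem_ker,
        dotProductEquiv_apply_apply] at h1 h2 ⊢
      rw [dotProduct_comm] at h1 h2 ⊢
      exact h w h1 h2
  rw [Matrix.range_cons, Matrix.range_cons, Matrix.range_empty, Set.union_empty,
    Set.singleton_union, Submodule.mem_span_pair] at hspan
  obtain ⟨a, b, hab⟩ := hspan
  rw [← map_smul, ← map_smul, ← map_add] at hab
  have hab := (dotProductEquiv (ZMod 2) (Fin 5)).injective hab
  have h2 : ∀ a : ZMod 2, a = 0 ∨ a = 1 := by decide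
  rcases h2 a with rfl | rfl <;> rcases h2 b with rfl | rfl <;>
    simp only [zero_smul, one_smul, add_zero, zero_add] at hab
  · exact absurd hab.symm hr
  · exact Or.inr (Or.inl hab.symm)
  · exact Or.inl hab.symm
  · exact Or.inr (Or.inr hab.symm)

variable {k : Type*} [Field k] {γ T : k} {x y : NzVec → k}

lemma IsLabelling.exists_eq_of_eval_cover (h : IsLabelling γ T x y)
    (h1 : γ ^ 16 * (γ ^ 2 - 1) ^ 6 ≠ 0) {z : k} (hz : (coverPoly γ T).eval z = 0) :
    ∃ v, x v = z := by
  rw [h.cover, eval_mul, eval_C, mul_eq_zero, or_iff_right h1, eval_prod,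
    Finset.prod_eq_zero_iff] at hz
  obtain ⟨v, -, hv⟩ := hz
  exact ⟨v, (sub_eq_zero.1 (by simpa using hv)).symm⟩

lemma IsLabelling.exists_eq_of_eval_dual (h : IsLabelling γ T x y)
    (h2 : γ ^ 6 * (1 - γ) ^ 16 ≠ 0) {z : k} (hz : (dualPoly γ T).eval z = 0) :
    ∃ w, y w = z := by
  rw [h.dual, eval_mul, eval_C, mul_eq_zero, or_iff_right h2, eval_prod,
    Finset.prod_eq_zero_iff] at hz
  obtain ⟨v, -, hv⟩ := hz
  exact ⟨v, (sub_eq_zero.1 (by simpa using hv)).symm⟩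

lemma IsLabelling.injective (h : IsLabelling γ T x y) (hsep : (coverPoly γ T).Separable) :
    Function.Injective x := by
  rw [h.cover] at hsep
  exact separable_prod_X_sub_C_iff.1 hsep.of_mul_right

lemma eval_eval3_C_C (L : List (List (List ℤ))) (γ y x : k) :
    (eval3 Int.cast L (C γ) (C y) X).eval x = eval3 Int.cast L γ y x := by
  rw [← coe_evalRingHom, map_eval3]
  simp

lemma not_separable_of_mul_eq {I J f : k[X]} {a z : k} (hI : I.eval z = 0) (hJ : J.eval z = 0)
    (hf : I * J = C a * f) (ha : a ≠ 0) : ¬ f.Separable := fun hsep => by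
  have hdvd := mul_dvd_mul (dvd_iff_isRoot.2 hI) (dvd_iff_isRoot.2 hJ)
  rw [hf, (isUnit_C.2 ha.isUnit).dvd_mul_left] at hdvd
  exact not_isUnit_X_sub_C _ (hsep.squarefree _ hdvd)

lemma IsLabelling.inc_eq_zero_iff [CharZero k] (h : IsLabelling γ T x y) (hγ : IsRegular γ)
    (hsep : (coverPoly γ T).Separable) (v w : NzVec) :
    eval3 Int.cast incList γ (y w) (x v) = 0 ↔ w.1 ⬝ᵥ v.1 = 0 := by
  refine ⟨fun hinc => ?_, h.inc v w⟩
  by_contra hne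
  have hco := h.co v w hne
  rw [← eval_eval3_C_C] at hinc hco
  have hy := h.eval_dual w
  rw [eval_dualPoly] at hy
  have hy0 : denomDual Int.cast γ (y w) ≠ 0 := fun h0 =>
    numerDual_ne_zero_of_denomDual_eq_zero hγ h0 (by simpa [h0] using hy)
  have hfac : eval3 Int.cast incList (C γ) (C (y w)) X *
      eval3 Int.cast coList (C γ) (C (y w)) X =
      C (4 * denomDual Int.cast γ (y w)) * coverPoly γ T := by
    have h1 := fiber_product_factorization (C γ) (C (y w)) X
    rw [← map_denomDual C, ← map_numerDual C, eq_neg_of_add_eq_zero_left hy] at h1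
    rw [← h1, coverPoly, ← four_mul_C, C_neg, C_mul, ← four_mul_C]
    ring
  exact not_separable_of_mul_eq hinc hco hfac
    (mul_ne_zero (by norm_num) hy0) hsep

/-- The action of an invertible linear map on nonzero vectors. -/
def NzVec.map (g : Vec ≃ₗ[ZMod 2] Vec) (v : NzVec) : NzVec :=
  ⟨g v.1, (map_ne_zero_iff g g.injective).2 v.2⟩

/-- A field automorphism fixing the parameters permutes the roots linearly. -/
theorem IsLabelling.exists_linearEquiv [CharZero k] (h : IsLabelling γ T x y) (hγ : IsRegular γ)
    (hsep : (coverPoly γ T).Separable) (σ : k ≃+* k) (hσγ : σ γ = γ) (hσT : σ T = T) :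
    ∃ g : Vec ≃ₗ[ZMod 2] Vec, ∀ v : NzVec, σ (x v) = x (v.map g) := by
  have hcover : ∀ v, ∃ w, x w = σ (x v) := fun v =>
    h.exists_eq_of_eval_cover hγ.leadingCoeff_ne_zero (by
      have hv := congrArg σ (h.eval_cover v)
      rw [eval_coverPoly, map_zero, map_sub, map_mul, ← RingEquiv.coe_toRingHom, map_numer,
        map_denom] at hv
      rw [eval_coverPoly]
      simpa [hσγ, hσT] using hv)
  have hdual : ∀ w, ∃ w', σ (y w') = y w := fun w => by
    have hσγ' : σ.symm γ = γ := by rw [σ.symm_apply_eq, hσγ]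
    have hσT' : σ.symm T = T := by rw [σ.symm_apply_eq, hσT]
    obtain ⟨w', hw'⟩ := h.exists_eq_of_eval_dual (z := σ.symm (y w))
      hγ.leadingCoeff_dual_ne_zero (by
        have hv := congrArg σ.symm (h.eval_dual w)
        rw [eval_dualPoly, map_zero, map_add, map_mul, ← RingEquiv.coe_toRingHom,
          map_numerDual, map_denomDual] at hv
        rw [eval_dualPoly]
        simpa [hσγ', hσT', map_ofNat σ.symm] using hv)
    exact ⟨w', by rw [hw', σ.apply_symm_apply]⟩
  choose π hπ using hcover
  have hx := h.injective hsep
  have hπi : Function.Injective π := fun u v huv => hx (σ.injective (by rw [← hπ, ← hπ, huv]))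
  have horth : ∀ w : NzVec, ∃ w' : NzVec, ∀ v : NzVec,
      w.1 ⬝ᵥ (π v).1 = 0 ↔ w'.1 ⬝ᵥ v.1 = 0 := fun w => by
    obtain ⟨w', hw'⟩ := hdual w
    refine ⟨w', fun v => ?_⟩
    have h3 := map_eval3 (σ : k →+* k) incList γ (y w') (x v)
    rw [← h.inc_eq_zero_iff hγ hsep, ← h.inc_eq_zero_iff hγ hsep, hπ, ← hw',
      ← map_eq_zero_iff σ σ.injective (x := eval3 Int.cast incList γ (y w') (x v))]
    simp only [RingEquiv.coe_toRingHom, hσγ] at h3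
    rw [h3]
  have hadd : ∀ u v w : NzVec, w.1 = u.1 + v.1 → (π w).1 = (π u).1 + (π v).1 := by
    intro u v w huv
    have hne : ∀ u v w : NzVec, w.1 = u.1 + v.1 → π w ≠ π u := fun u v w huv he => by
      rw [hπi he] at huv
      exact v.2 (by simpa using huv)
    have horth' : ∀ z : Vec, z ⬝ᵥ (π u).1 = 0 → z ⬝ᵥ (π v).1 = 0 → z ⬝ᵥ (π w).1 = 0 := by
      intro z hu hv
      by_cases hz : z = 0
      · rw [hz, zero_dotProduct]
      · obtain ⟨w', hw'⟩ := horth ⟨z, hz⟩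
        rw [hw' w, huv, dotProduct_add, (hw' u).1 hu, (hw' v).1 hv, add_zero]
    rcases Vec.eq_or_eq_or_eq_add_of_orthogonal (π w).2 horth' with he | he | he
    · exact absurd (Subtype.ext he) (hne u v w huv)
    · exact absurd (Subtype.ext he) (hne v u w (by rw [huv, add_comm]))
    · exact he
  let f : Vec → Vec := fun v => if hv : v = 0 then 0 else (π ⟨v, hv⟩).1
  have hf : ∀ v : NzVec, f v.1 = (π v).1 := fun v => dif_neg v.2
  have hf0 : f 0 = 0 := dif_pos rfl
  have hfadd : ∀ u v, f (u + v) = f u + f v := fun u v => by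
    by_cases hu : u = 0
    · simp [hu, hf0]
    by_cases hv : v = 0
    · simp [hv, hf0]
    by_cases huv : u + v = 0
    · rw [← CharTwo.sub_eq_add] at huv
      rw [sub_eq_zero.1 huv, CharTwo.add_self_eq_zero, CharTwo.add_self_eq_zero, hf0]
    · exact (hf ⟨_, huv⟩).trans ((hadd ⟨u, hu⟩ ⟨v, hv⟩ ⟨_, huv⟩ rfl).trans
        (congrArg₂ _ (hf ⟨u, hu⟩).symm (hf ⟨v, hv⟩).symm))
  let F : Vec →ₗ[ZMod 2] Vec := (AddMonoidHom.mk' f hfadd).toZModLinearMap 2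
  have hF : Function.Injective F := (injective_iff_map_eq_zero F).2 fun v hv => by
    by_contra hne
    exact (π ⟨v, hne⟩).2 ((hf ⟨v, hne⟩).symm.trans hv)
  refine ⟨LinearEquiv.ofInjectiveEndo F hF, fun v => ?_⟩
  rw [← hπ]
  exact congrArg x (Subtype.ext (hf v).symm)

end Monodromy

section GaloisAction

open scoped Matrix

lemma NzVec.map_injective : Function.Injective NzVec.map := fun g g' h => by
  ext1 v
  by_cases hv : v = 0
  · simp [hv]
  · exact congrArg Subtype.val (congrFun h ⟨v, hv⟩)

variable {K k : Type*} [Field K] [Field k] [Algebra K k] {γ T : K} {x y : NzVec → k}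

/-- The Galois group acts on the labels of the roots through linear maps. -/
theorem IsLabelling.exists_monoidHom [CharZero K]
    (h : IsLabelling (algebraMap K k γ) (algebraMap K k T) x y) (hγ : IsRegular γ)
    (hirr : Irreducible (coverPoly γ T)) :
    ∃ ρ : (k ≃ₐ[K] k) →* (Vec ≃ₗ[ZMod 2] Vec), ∀ (σ : k ≃ₐ[K] k) (v : NzVec),
      σ (x v) = x (v.map (ρ σ)) := by
  have : CharZero k := charZero_of_injective_algebraMap (algebraMap K k).injective
  have hsep : (coverPoly (algebraMap K k γ) (algebraMap K k T)).Separable := by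
    rw [← map_coverPoly]
    exact hirr.separable.map
  choose ρ hρ using fun σ : k ≃ₐ[K] k => h.exists_linearEquiv (hγ.map _) hsep σ.toRingEquiv
    (σ.commutes γ) (σ.commutes T)
  refine ⟨MonoidHom.mk' ρ fun σ τ => NzVec.map_injective (funext fun v => h.injective hsep ?_), hρ⟩
  have h1 := hρ (σ * τ) v
  have h2 := hρ τ v
  have h3 := hρ σ (v.map (ρ τ))
  exact h1.symm.trans ((congrArg σ h2).trans h3)

/-- If the roots of `p` generate the same field as the roots of the cover and the Galois action
is onto, then the Galois group of `p` is the full linear group. -/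
theorem nonempty_gal_mulEquiv [Normal K k] (hx : Function.Injective x)
    {ρ : (k ≃ₐ[K] k) →* (Vec ≃ₗ[ZMod 2] Vec)}
    (hρ : ∀ (σ : k ≃ₐ[K] k) (v : NzVec), σ (x v) = x (v.map (ρ σ)))
    (hsurj : Function.Surjective ρ) (p : K[X]) [hp : Fact ((p.map (algebraMap K k)).Splits)]
    (hroot : ∀ σ : k ≃ₐ[K] k, (∀ r ∈ p.rootSet k, σ r = r) ↔ ∀ v, σ (x v) = x v) :
    Nonempty (p.Gal ≃* (Vec ≃ₗ[ZMod 2] Vec)) := by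
  have hker : (Gal.restrict p k).ker = ρ.ker := by
    ext σ
    rw [MonoidHom.mem_ker, MonoidHom.mem_ker]
    have h1 : ρ σ = 1 ↔ ∀ v, σ (x v) = x v := by
      constructor
      · intro h v
        rw [hρ, h]
        rfl
      · intro h
        refine NzVec.map_injective (funext fun v => hx ?_)
        rw [← hρ, h]
        rfl
    rw [h1, ← hroot]
    constructor
    · intro h r hr
      rw [← Gal.restrict_smul σ (⟨r, hr⟩ : p.rootSet k), h, one_smul]
    · intro h
      apply Gal.galActionHom_injective p k
      ext r
      rw [map_one]
      exact (Gal.restrict_smul σ r).trans (h r r.2)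
  exact ⟨(QuotientGroup.quotientKerEquivOfSurjective _ (Gal.restrict_surjective p k)).symm.trans
    ((QuotientGroup.quotientMulEquivOfEq hker).trans
      (QuotientGroup.quotientKerEquivOfSurjective ρ hsurj))⟩

theorem IsLabelling.exists_apply_eq [Normal K k]
    (h : IsLabelling (algebraMap K k γ) (algebraMap K k T) x y)
    (hirr : Irreducible (coverPoly γ T)) (u v : NzVec) : ∃ σ : k ≃ₐ[K] k, σ (x u) = x v := by
  have hroot : ∀ w, aeval (x w) (coverPoly γ T) = 0 := fun w => by
    rw [aeval_def, ← eval_map, map_coverPoly]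
    exact h.eval_cover w
  obtain ⟨σ, hσ⟩ := (Normal.minpoly_eq_iff_mem_orbit k).1
    ((minpoly.eq_of_irreducible hirr (hroot v)).symm.trans
      (minpoly.eq_of_irreducible hirr (hroot u)))
  exact ⟨σ, hσ⟩

end GaloisAction

section LinearGroup

open Module LinearEquiv

variable {V : Type*} [AddCommGroup V] [Module (ZMod 2) V]

lemma zmod_two_eq_one_iff {a : ZMod 2} : a = 1 ↔ a ≠ 0 := by revert a; decide

lemma mem_transvections_of_mem_dilatransvections {g : V ≃ₗ[ZMod 2] V}
    (hg : g ∈ dilatransvections (ZMod 2) V) : g ∈ transvections (ZMod 2) V := by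
  obtain ⟨f, v, h⟩ := hg
  have hfv : f v = 0 := by
    by_contra hne
    have h1 : g v = v + f v • v := LinearMap.congr_fun h v
    rw [zmod_two_eq_one_iff.2 hne, one_smul, ← two_smul (ZMod 2), show (2 : ZMod 2) = 0 from rfl,
      zero_smul, map_eq_zero_iff g g.injective] at h1
    exact hne (by rw [h1, map_zero])
  exact ⟨f, v, hfv, LinearEquiv.toLinearMap_injective h⟩

open scoped Pointwise in
/-- Over the field with two elements the transvections generate the general linear group. -/
lemma closure_transvections_eq_top [Module.Finite (ZMod 2) V] :
    Subgroup.closure (transvections (ZMod 2) V) = ⊤ := by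
  refine eq_top_iff.2 fun e _ => ?_
  have he : ¬ IsExceptional e := by
    rintro ⟨h1, h2, a, ha⟩
    rcases eq_or_ne a 0 with rfl | ha0
    · have hsub : Subsingleton (V ⧸ e.fixedSubmodule) := by
        refine subsingleton_of_forall_eq 0 fun x => (map_eq_zero_iff _ e.fixedReduce.injective).1 ?_
        rw [ha, zero_smul]
      rw [finrank_zero_of_subsingleton] at h1
      omega
    · refine h2 (LinearEquiv.ext fun x => ?_)
      rw [ha, zmod_two_eq_one_iff.2 ha0, one_smul]
      rfl
  obtain ⟨a, ha, b, hb, hab⟩ := mem_transvections_pow_mul_dilatransvections_of_not_isExceptional he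
  rw [← hab]
  refine mul_mem ?_ (Subgroup.subset_closure (mem_transvections_of_mem_dilatransvections hb))
  clear hab
  revert a
  generalize finrank (ZMod 2) (V ⧸ e.fixedSubmodule) - 1 = n
  induction n with
  | zero => simp
  | succ n ih =>
    rintro _ ⟨a, ha, b, hb, rfl⟩
    exact mul_mem (ih a ha) (Subgroup.subset_closure hb)

/-- The linear forms `f` such that the transvection `x ↦ x + f x • v` belongs to `H`. -/
def transvectionForms (H : Subgroup (V ≃ₗ[ZMod 2] V)) (v : V) :
    Submodule (ZMod 2) (Dual (ZMod 2) V) where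
  carrier := {f | ∃ h : f v = 0, transvection h ∈ H}
  add_mem' := by
    rintro f g ⟨hf, hfH⟩ ⟨hg, hgH⟩
    refine ⟨by simp [hf, hg], ?_⟩
    rw [← transvection.trans_of_right_eq hf hg]
    exact mul_mem hfH hgH
  zero_mem' := ⟨rfl, by rw [transvection.of_left_eq_zero]; exact one_mem H⟩
  smul_mem' := by
    rintro c f ⟨hf, hfH⟩
    rcases eq_or_ne c 0 with rfl | hc
    · rw [zero_smul]
      exact ⟨rfl, by rw [transvection.of_left_eq_zero]; exact one_mem H⟩
    · rw [zmod_two_eq_one_iff.2 hc, one_smul]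
      exact ⟨hf, hfH⟩

variable {H : Subgroup (V ≃ₗ[ZMod 2] V)} {f g : Dual (ZMod 2) V} {v w : V}

lemma apply_eq_zero_of_mem_transvectionForms (h : f ∈ transvectionForms H v) : f v = 0 := h.1

lemma mem_transvectionForms_add (hfv : f ∈ transvectionForms H v)
    (hfw : f ∈ transvectionForms H w) : f ∈ transvectionForms H (v + w) := by
  obtain ⟨hf, hfH⟩ := hfv
  obtain ⟨hg, hgH⟩ := hfw
  refine ⟨by simp [hf, hg], ?_⟩
  rw [← transvection.trans_of_left_eq hf hg (by simp [hf, hg])]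
  exact mul_mem hfH hgH

lemma comp_mem_transvectionForms {e : V ≃ₗ[ZMod 2] V} (he : e ∈ H)
    (hf : f ∈ transvectionForms H v) : f ∘ₗ e.symm ∈ transvectionForms H (e v) := by
  obtain ⟨hf, hfH⟩ := hf
  refine ⟨by simp [hf], ?_⟩
  convert mul_mem (mul_mem he hfH) (inv_mem he) using 1
  ext x
  simp [LinearMap.transvection.apply]

lemma mem_transvectionForms_of_apply_eq_one (hf : f ∈ transvectionForms H v)
    (hg : g ∈ transvectionForms H w) (hfw : f w = 1) (hgv : g v = 0) :
    g ∈ transvectionForms H v := by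
  have h := comp_mem_transvectionForms hf.2 hg
  have h1 : g ∘ₗ (transvection hf.1).symm = g := by
    ext x
    rw [transvection.symm_eq hf.1 (by simp [hf.1])]
    simp [LinearMap.transvection.apply, hgv]
  have h2 : transvection hf.1 w = v + w := by
    simp [LinearMap.transvection.apply, hfw, add_comm]
  rw [h1, h2] at h
  convert mem_transvectionForms_add h hg using 1
  rw [add_assoc, ← two_smul (ZMod 2) w, show (2 : ZMod 2) = 0 from rfl, zero_smul, add_zero]

lemma exists_apply_eq_one_of_notMem_dualCoannihilator {W : Submodule (ZMod 2) (Dual (ZMod 2) V)}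
    (h : w ∉ W.dualCoannihilator) : ∃ f ∈ W, f w = 1 := by
  rw [Submodule.mem_dualCoannihilator] at h
  push Not at h
  obtain ⟨f, hf, hfw⟩ := h
  exact ⟨f, hf, zmod_two_eq_one_iff.2 hfw⟩

variable [Module.Finite (ZMod 2) V]

lemma finrank_transvectionForms_le {e : V ≃ₗ[ZMod 2] V} (he : e ∈ H) (v : V) :
    finrank (ZMod 2) (transvectionForms H v) ≤ finrank (ZMod 2) (transvectionForms H (e v)) := by
  rw [← LinearEquiv.finrank_map_eq e.symm.dualMap (transvectionForms H v)]
  refine Submodule.finrank_mono ?_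
  rintro _ ⟨f, hf, rfl⟩
  exact comp_mem_transvectionForms he hf

lemma finrank_le_finrank_inf_ker_eval_add_one (W : Submodule (ZMod 2) (Dual (ZMod 2) V)) (v : V) :
    finrank (ZMod 2) W ≤ finrank (ZMod 2) ↥(W ⊓ LinearMap.ker (Dual.eval (ZMod 2) V v)) + 1 := by
  have h1 := Submodule.finrank_sup_add_finrank_inf_eq W (LinearMap.ker (Dual.eval (ZMod 2) V v))
  have h2 := LinearMap.finrank_range_add_finrank_ker (Dual.eval (ZMod 2) V v)
  have h3 := Submodule.finrank_le (LinearMap.range (Dual.eval (ZMod 2) V v))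
  have h4 := Submodule.finrank_le (W ⊔ LinearMap.ker (Dual.eval (ZMod 2) V v))
  rw [finrank_self] at h3
  omega

lemma mem_transvectionForms_of_finrank_le (hle : finrank (ZMod 2) (transvectionForms H v) ≤
    finrank (ZMod 2) (transvectionForms H w)) (hw : w ∉ (transvectionForms H v).dualCoannihilator)
    (hf : f ∈ transvectionForms H v) (hfw : f w = 0) : f ∈ transvectionForms H w := by
  obtain ⟨g, hg, hgw⟩ := exists_apply_eq_one_of_notMem_dualCoannihilator hw
  let A := transvectionForms H w ⊓ LinearMap.ker (Dual.eval (ZMod 2) V v)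
  let B := transvectionForms H v ⊓ LinearMap.ker (Dual.eval (ZMod 2) V w)
  have hAB : A ≤ B := fun φ hφ => ⟨mem_transvectionForms_of_apply_eq_one hg hφ.1 hgw hφ.2,
    show φ w = 0 from apply_eq_zero_of_mem_transvectionForms hφ.1⟩
  have hlt : B < transvectionForms H v := lt_of_le_of_ne inf_le_left fun h => by
    have : g ∈ B := h ▸ hg
    exact one_ne_zero (hgw.symm.trans this.2)
  have h1 := Submodule.finrank_lt_finrank_of_lt hlt
  have h2 : _ ≤ finrank (ZMod 2) A + 1 :=
    finrank_le_finrank_inf_ker_eval_add_one (transvectionForms H w) v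
  have h3 : A = B := Submodule.eq_of_le_of_finrank_le hAB (by omega)
  have : f ∈ A := h3 ▸ ⟨hf, hfw⟩
  exact this.1

lemma mem_transvectionForms_of_apply_eq_zero
    (hle : ∀ w, w ≠ 0 → finrank (ZMod 2) (transvectionForms H v) ≤
      finrank (ZMod 2) (transvectionForms H w))
    (h2 : 2 ≤ finrank (ZMod 2) (transvectionForms H v)) (hf : f ∈ transvectionForms H v)
    (hfw : f w = 0) : f ∈ transvectionForms H w := by
  have hcase : ∀ w, f w = 0 → w ∉ (transvectionForms H v).dualCoannihilator →
      f ∈ transvectionForms H w := fun w hfw hw =>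
    mem_transvectionForms_of_finrank_le (hle w fun h => hw (h ▸ zero_mem _)) hw hf hfw
  by_cases hw : w ∈ (transvectionForms H v).dualCoannihilator
  · obtain ⟨z, hz, hfz⟩ : ∃ z, f z = 0 ∧ z ∉ (transvectionForms H v).dualCoannihilator := by
      by_contra! hcon
      have hsub : transvectionForms H v ≤ Submodule.span (ZMod 2) {f} := fun g hg => by
        have := FiniteDimensional.mem_span_of_iInf_ker_le_ker (L := fun _ : Unit => f) (K := g)
          fun z hz => (Submodule.mem_dualCoannihilator z).1 (hcon z (by simpa using hz)) g hg
        simpa using this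
      have := (Submodule.finrank_mono hsub).trans (finrank_span_le_card {f})
      simp at this
      omega
    have := mem_transvectionForms_add (hcase z hz hfz) (hcase (z + w) (by simp [hz, hfw])
      fun h => hfz (by simpa using sub_mem h hw))
    rwa [← add_assoc, ← two_smul (ZMod 2) z, show (2 : ZMod 2) = 0 from rfl, zero_smul,
      zero_add] at this
  · exact hcase w hfw hw

lemma exists_ne_zero_apply_eq_zero (h3 : 3 ≤ finrank (ZMod 2) V) (f g : Dual (ZMod 2) V) :
    ∃ v, v ≠ 0 ∧ f v = 0 ∧ g v = 0 := by
  have h : LinearMap.ker (f.prod g) ≠ ⊥ := LinearMap.ker_ne_bot_of_finrank_lt (by simp; omega)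
  obtain ⟨v, hv, hv0⟩ := Submodule.exists_mem_ne_zero_of_ne_bot h
  exact ⟨v, hv0, congrArg Prod.fst hv, congrArg Prod.snd hv⟩

lemma eq_top_of_two_le_finrank_transvectionForms (h3 : 3 ≤ finrank (ZMod 2) V)
    (htrans : ∀ v w : V, v ≠ 0 → w ≠ 0 → ∃ e ∈ H, e v = w)
    (hv : v ≠ 0) (h2 : 2 ≤ finrank (ZMod 2) (transvectionForms H v)) : H = ⊤ := by
  have hle : ∀ v w : V, v ≠ 0 → w ≠ 0 → finrank (ZMod 2) (transvectionForms H v) ≤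
      finrank (ZMod 2) (transvectionForms H w) := by
    intro v w hv hw
    obtain ⟨e, he, rfl⟩ := htrans v w hv hw
    exact finrank_transvectionForms_le he v
  have hmem : ∀ f v w, v ≠ 0 → f ∈ transvectionForms H v → f w = 0 →
      f ∈ transvectionForms H w := fun f u w hu hf hfw =>
    mem_transvectionForms_of_apply_eq_zero (fun w hw => hle u w hu hw) (h2.trans (hle v u hv hu))
      hf hfw
  let Ψ : Submodule (ZMod 2) (Dual (ZMod 2) V) :=
    { carrier := {f | ∀ w, f w = 0 → f ∈ transvectionForms H w}
      zero_mem' := fun w _ => zero_mem _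
      add_mem' := by
        intro f g hf hg w hw
        obtain ⟨z, hz, hfz, hgz⟩ := exists_ne_zero_apply_eq_zero h3 f g
        exact hmem _ z w hz (add_mem (hf z hfz) (hg z hgz)) hw
      smul_mem' := by
        intro c f hf w hw
        rcases eq_or_ne c 0 with rfl | hc
        · rw [zero_smul]
          exact zero_mem _
        · rw [zmod_two_eq_one_iff.2 hc, one_smul] at hw ⊢
          exact hf w hw }
  have hΨ : Ψ = ⊤ := by
    by_contra hne
    have hbot : Ψ.dualCoannihilator ≠ ⊥ := fun h => hne <| by
      rw [← Subspace.dualCoannihilator_dualAnnihilator_eq (W := Ψ), h,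
        Submodule.dualAnnihilator_bot]
    obtain ⟨u, hu, hu0⟩ := Submodule.exists_mem_ne_zero_of_ne_bot hbot
    have hzero : ∀ f ∈ Ψ, f = 0 := by
      intro f hf
      ext w
      rcases eq_or_ne w 0 with rfl | hw
      · simp
      obtain ⟨e, he, rfl⟩ := htrans u w hu0 hw
      refine (Submodule.mem_dualCoannihilator u).1 hu (f ∘ₗ (e : V →ₗ[ZMod 2] V)) fun z hz => ?_
      have := comp_mem_transvectionForms (inv_mem he) (hf (e z) hz)
      rwa [show (e⁻¹ : V ≃ₗ[ZMod 2] V) (e z) = z from e.symm_apply_apply z] at this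
    have : transvectionForms H v = ⊥ := (Submodule.eq_bot_iff _).2 fun f hf =>
      hzero f fun w hw => hmem f v w hv hf hw
    rw [this, finrank_bot] at h2
    omega
  rw [eq_top_iff, ← closure_transvections_eq_top, Subgroup.closure_le]
  rintro _ ⟨f, w, hfw, rfl⟩
  have : f ∈ Ψ := hΨ ▸ Submodule.mem_top
  exact (this w hfw).2

/-- A symmetric matrix of odd size over the field with two elements with zero diagonal is
singular. -/
lemma det_eq_zero_of_alternating {n : ℕ} (hn : Odd n) (A : Matrix (Fin n) (Fin n) (ZMod 2))
    (hdiag : ∀ i, A i i = 0) (hsymm : ∀ i j, A i j = A j i) : A.det = 0 := by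
  let B : Matrix (Fin n) (Fin n) ℤ := Matrix.of fun i j =>
    if i < j then (A i j).val else if j < i then -(A i j).val else 0
  have hB : B.transpose = -B := by
    ext i j
    rcases lt_trichotomy i j with h | rfl | h
    · simp [Matrix.transpose_apply, Matrix.neg_apply, B, h, h.not_gt, hsymm i j]
    · simp [Matrix.transpose_apply, Matrix.neg_apply, B]
    · simp [Matrix.transpose_apply, Matrix.neg_apply, B, h, h.not_gt, hsymm i j]
  have hdet : B.det = 0 := by
    have h := B.det_transpose
    rw [hB, Matrix.det_neg, Fintype.card_fin, hn.neg_one_pow] at h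
    omega
  have hA : A = (Int.castRingHom (ZMod 2)).mapMatrix B := by
    ext i j
    rcases lt_trichotomy i j with h | rfl | h
    · simp [B, h]
    · simp [B, hdiag]
    · simp [B, h, h.not_gt, ZMod.neg_eq_self_mod_two]
  rw [hA, ← RingHom.map_det, hdet, map_zero]

lemma exists_ne_zero_form_eq_zero (hodd : Odd (finrank (ZMod 2) V)) {φ : V → Dual (ZMod 2) V}
    (h0 : ∀ v, φ v v = 0) (hsymm : ∀ v w, φ v w = φ w v) : ∃ v, v ≠ 0 ∧ φ v = 0 := by
  let b := finBasis (ZMod 2) V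
  obtain ⟨c, hc, hc0⟩ := Matrix.exists_mulVec_eq_zero_iff.2
    (det_eq_zero_of_alternating hodd (fun i j => φ (b i) (b j)) (fun i => h0 _)
      fun i j => hsymm _ _)
  refine ⟨∑ j, c j • b j, fun h => hc (funext fun j => ?_), b.ext fun i => ?_⟩
  · exact Fintype.linearIndependent_iff.1 b.linearIndependent c h j
  · rw [hsymm, map_sum]
    simpa [Matrix.mulVec, dotProduct, mul_comm] using congrFun hc0 i

/-- A subgroup of the general linear group of a space of odd dimension over the field with two
elements which is transitive on nonzero vectors and contains a transvection is everything. -/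
theorem eq_top_of_transitive_of_mem_dilatransvections (hodd : Odd (finrank (ZMod 2) V))
    (h3 : 3 ≤ finrank (ZMod 2) V)
    (htrans : ∀ v w : V, v ≠ 0 → w ≠ 0 → ∃ e ∈ H, e v = w) {e : V ≃ₗ[ZMod 2] V} (he : e ∈ H)
    (he1 : e ≠ 1) (hed : e ∈ dilatransvections (ZMod 2) V) : H = ⊤ := by
  obtain ⟨f, u, hfu, rfl⟩ := mem_transvections_of_mem_dilatransvections hed
  have hf : f ∈ transvectionForms H u := ⟨hfu, he⟩
  have hf0 : f ≠ 0 := by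
    rintro rfl
    exact he1 (transvection.of_left_eq_zero u)
  have hu : u ≠ 0 := by
    rintro rfl
    exact he1 (transvection.of_right_eq_zero f)
  have hex : ∀ v, ∃ f ∈ transvectionForms H v, f = 0 ↔ v = 0 := by
    intro v
    rcases eq_or_ne v 0 with rfl | hv
    · exact ⟨0, zero_mem _, by simp⟩
    obtain ⟨e, he, rfl⟩ := htrans u v hu hv
    refine ⟨_, comp_mem_transvectionForms he hf, iff_of_false (fun h => hf0 ?_) hv⟩
    ext x
    simpa using LinearMap.congr_fun h (e x)
  by_contra hH
  have huniq : ∀ v, v ≠ 0 → ∀ f g, f ∈ transvectionForms H v → g ∈ transvectionForms H v →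
      f ≠ 0 → g ≠ 0 → f = g := by
    intro v hv f g hf hg hf0 hg0
    have h1 : finrank (ZMod 2) (transvectionForms H v) ≤ 1 := by
      by_contra h
      exact hH (eq_top_of_two_le_finrank_transvectionForms h3 htrans hv (by omega))
    obtain ⟨w, hw⟩ := finrank_le_one_iff.1 h1
    obtain ⟨a, ha⟩ := hw ⟨f, hf⟩
    obtain ⟨b, hb⟩ := hw ⟨g, hg⟩
    have ha0 : a ≠ 0 := fun h => hf0 (by simpa [h] using (congrArg Subtype.val ha).symm)
    have hb0 : b ≠ 0 := fun h => hg0 (by simpa [h] using (congrArg Subtype.val hb).symm)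
    rw [zmod_two_eq_one_iff.2 ha0] at ha
    rw [zmod_two_eq_one_iff.2 hb0] at hb
    exact congrArg Subtype.val (ha.symm.trans hb)
  choose φ hφ hφ0 using hex
  have hself : ∀ v, φ v v = 0 := fun v => apply_eq_zero_of_mem_transvectionForms (hφ v)
  have hsymm : ∀ v w, φ v w = 1 → φ w v = 1 := by
    intro v w hvw
    by_contra hwv
    rw [zmod_two_eq_one_iff, not_not] at hwv
    have hv : v ≠ 0 := by
      rintro rfl
      simp [(hφ0 0).2 rfl] at hvw
    have hw : w ≠ 0 := by
      rintro rfl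
      simp at hvw
    have h := huniq v hv _ _ (hφ v) (mem_transvectionForms_of_apply_eq_one (hφ v) (hφ w) hvw hwv)
      (mt (hφ0 v).1 hv) (mt (hφ0 w).1 hw)
    rw [h, hself] at hvw
    exact zero_ne_one hvw
  obtain ⟨v, hv, hv0⟩ := exists_ne_zero_form_eq_zero hodd hself fun v w => by
    by_cases h : φ v w = 1
    · rw [h, hsymm v w h]
    · have h' := mt (hsymm w v) h
      rw [zmod_two_eq_one_iff, not_not] at h h'
      rw [h, h']
  exact hv ((hφ0 v).1 hv0)

end LinearGroup

section Hensel

variable {F : Type*} [Field F]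

lemma constantCoeff_eval (P : (PowerSeries F)[X]) (w : PowerSeries F) :
    PowerSeries.constantCoeff (P.eval w) =
      (P.map PowerSeries.constantCoeff).eval (PowerSeries.constantCoeff w) := by
  rw [eval_map, eval₂_hom]

lemma exists_newton_step {P : (PowerSeries F)[X]} {a : F}
    (h1 : (P.map PowerSeries.constantCoeff).derivative.eval a ≠ 0) {n : ℕ} {w : PowerSeries F}
    (hw : PowerSeries.constantCoeff w = a) (hP : PowerSeries.X ^ (n + 1) ∣ P.eval w) :
    ∃ w', PowerSeries.constantCoeff w' = a ∧ PowerSeries.X ^ (n + 2) ∣ P.eval w' ∧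
      PowerSeries.X ^ (n + 1) ∣ w' - w := by
  set d := (P.map PowerSeries.constantCoeff).derivative.eval a with hd
  obtain ⟨q, hq⟩ := hP
  obtain ⟨b, hb⟩ := P.binomExpansion w (-(PowerSeries.C d⁻¹ * (PowerSeries.X ^ (n + 1) * q)))
  have hX : PowerSeries.X ∣ 1 - P.derivative.eval w * PowerSeries.C d⁻¹ := by
    rw [PowerSeries.X_dvd_iff, map_sub, map_one, map_mul, constantCoeff_eval, hw,
      PowerSeries.constantCoeff_C, ← derivative_map, ← hd, mul_inv_cancel₀ h1, sub_self]
  obtain ⟨s, hs⟩ := hX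
  refine ⟨w + -(PowerSeries.C d⁻¹ * (PowerSeries.X ^ (n + 1) * q)), ?_,
    ⟨s * q + b * (PowerSeries.C d⁻¹ * q) ^ 2 * PowerSeries.X ^ n, ?_⟩,
    ⟨-(PowerSeries.C d⁻¹ * q), ?_⟩⟩
  · simp [hw]
  · rw [hb, hq]
    linear_combination (PowerSeries.X ^ (n + 1) * q) * hs
  · ring

/-- Hensel's lemma for power series over a field. -/
lemma exists_eval_eq_zero {P : (PowerSeries F)[X]} {a : F}
    (h0 : (P.map PowerSeries.constantCoeff).eval a = 0)
    (h1 : (P.map PowerSeries.constantCoeff).derivative.eval a ≠ 0) :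
    ∃ w, PowerSeries.constantCoeff w = a ∧ P.eval w = 0 := by
  choose! g hg0 hg1 hg2 using fun n w hw hP => exists_newton_step h1 (n := n) (w := w) hw hP
  let c : ℕ → PowerSeries F := fun n => Nat.rec (PowerSeries.C a) g n
  have hc : ∀ n, PowerSeries.constantCoeff (c n) = a ∧ PowerSeries.X ^ (n + 1) ∣ P.eval (c n) := by
    intro n
    induction n with
    | zero =>
      refine ⟨PowerSeries.constantCoeff_C a, ?_⟩
      rw [zero_add, pow_one, PowerSeries.X_dvd_iff, constantCoeff_eval]
      simpa [c] using h0
    | succ n ih => exact ⟨hg0 n _ ih.1 ih.2, hg1 n _ ih.1 ih.2⟩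
  have hstep : ∀ n, PowerSeries.X ^ (n + 1) ∣ c (n + 1) - c n := fun n =>
    hg2 n _ (hc n).1 (hc n).2
  have hcauchy : ∀ m n, m ≤ n → PowerSeries.X ^ (m + 1) ∣ c n - c m := by
    intro m n hmn
    induction n, hmn using Nat.le_induction with
    | base => simp
    | succ n hmn ih =>
      have := ((pow_dvd_pow PowerSeries.X (by omega : m + 1 ≤ n + 1)).trans (hstep n)).add ih
      rwa [sub_add_sub_cancel] at this
  let w := PowerSeries.mk fun n => PowerSeries.coeff n (c n)
  have hw : ∀ n, PowerSeries.X ^ (n + 1) ∣ w - c n := by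
    intro n
    rw [PowerSeries.X_pow_dvd_iff]
    intro m hm
    have := PowerSeries.X_pow_dvd_iff.1 (hcauchy m n (by omega)) m (by omega)
    rw [map_sub, sub_eq_zero] at this
    rw [map_sub, PowerSeries.coeff_mk, this, sub_self]
  refine ⟨w, ?_, ?_⟩
  · simp [w, c, ← PowerSeries.coeff_zero_eq_constantCoeff_apply]
  · ext n
    have h := ((hw n).trans (sub_dvd_eval_sub w (c n) P)).add (hc n).2
    rw [sub_add_cancel] at h
    simpa using PowerSeries.X_pow_dvd_iff.1 h n (by omega)

lemma eq_of_eval_eq_zero {P : (PowerSeries F)[X]} {w w' : PowerSeries F}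
    (h1 : (P.map PowerSeries.constantCoeff).derivative.eval (PowerSeries.constantCoeff w) ≠ 0)
    (hw : P.eval w = 0) (hw' : P.eval w' = 0)
    (hww' : PowerSeries.constantCoeff w' = PowerSeries.constantCoeff w) :
    w' = w := by
  obtain ⟨b, hb⟩ := P.binomExpansion w (w' - w)
  rw [add_sub_cancel, hw, hw'] at hb
  have h : (w' - w) * (P.derivative.eval w + b * (w' - w)) = 0 := by linear_combination -hb
  refine sub_eq_zero.1 ((mul_eq_zero.1 h).resolve_right fun h' => h1 ?_)
  have := congrArg PowerSeries.constantCoeff h'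
  simpa [constantCoeff_eval, hww', ← derivative_map] using this

/-- The equation satisfied by `w` when `C r + X ^ e * w` is a point of the curve
`X ^ (e * m) * N = (x - r) ^ m * E`. -/
noncomputable def branchPoly (N E : F[X]) (r : F) (m e : ℕ) : (PowerSeries F)[X] :=
  (N.map PowerSeries.C).comp (C (PowerSeries.C r) + C (PowerSeries.X ^ e) * X) -
    X ^ m * (E.map PowerSeries.C).comp (C (PowerSeries.C r) + C (PowerSeries.X ^ e) * X)

variable {N E : F[X]} {r a : F} {m e : ℕ}

lemma eval_branchPoly (w : PowerSeries F) : (branchPoly N E r m e).eval w =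
    N.eval₂ PowerSeries.C (PowerSeries.C r + PowerSeries.X ^ e * w) -
      w ^ m * E.eval₂ PowerSeries.C (PowerSeries.C r + PowerSeries.X ^ e * w) := by
  simp [branchPoly, eval_map]

lemma map_branchPoly (he : e ≠ 0) : (branchPoly N E r m e).map PowerSeries.constantCoeff =
    C (N.eval r) - X ^ m * C (E.eval r) := by
  have h : (PowerSeries.constantCoeff (R := F)).comp PowerSeries.C = RingHom.id F := by
    ext; simp
  simp [branchPoly, Polynomial.map_comp, Polynomial.map_map, h, he, comp_C]

lemma eval_derivative_map_branchPoly_ne_zero (he : e ≠ 0) (hm : (m : F) ≠ 0) (hN : N.eval r ≠ 0)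
    (ha : a ^ m * E.eval r = N.eval r) :
    ((branchPoly N E r m e).map PowerSeries.constantCoeff).derivative.eval a ≠ 0 := by
  rw [← ha] at hN
  have ha0 : a ≠ 0 := by
    rintro rfl
    rw [zero_pow (by rintro rfl; simp at hm), zero_mul] at hN
    exact hN rfl
  rw [map_branchPoly he]
  simp [derivative_X_pow, hm, ha0, right_ne_zero_of_mul hN]

lemma exists_branch (he : e ≠ 0) (hm : (m : F) ≠ 0) (hN : N.eval r ≠ 0)
    (ha : a ^ m * E.eval r = N.eval r) :
    ∃ w, PowerSeries.constantCoeff w = a ∧ (branchPoly N E r m e).eval w = 0 :=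
  exists_eval_eq_zero (by rw [map_branchPoly he]; simp [mul_comm (E.eval r), ha])
    (eval_derivative_map_branchPoly_ne_zero he hm hN ha)

lemma X_pow_mul_eval_eq {D : F[X]} (hD : D = (X - C r) ^ m * E) {w : PowerSeries F}
    (hw : (branchPoly N E r m e).eval w = 0) :
    PowerSeries.X ^ (e * m) * N.eval₂ PowerSeries.C (PowerSeries.C r + PowerSeries.X ^ e * w) =
      D.eval₂ PowerSeries.C (PowerSeries.C r + PowerSeries.X ^ e * w) := by
  rw [eval_branchPoly, sub_eq_zero] at hw
  rw [hw, hD]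
  simp only [eval₂_mul, eval₂_pow, eval₂_sub, eval₂_X, eval₂_C, add_sub_cancel_left]
  ring

lemma rescale_C (c a : F) : PowerSeries.rescale c (PowerSeries.C a) = PowerSeries.C a := by
  ext n
  rcases n with _ | n <;> simp [PowerSeries.coeff_rescale, PowerSeries.coeff_C]

lemma exists_rescale_eq_self (he : Even e) (he0 : e ≠ 0) (hm : (m : F) ≠ 0) (hN : N.eval r ≠ 0)
    {D : F[X]} (hD : D = (X - C r) ^ m * E) (ha : a ^ m * E.eval r = N.eval r) :
    ∃ z, PowerSeries.constantCoeff z = r ∧ PowerSeries.coeff e z = a ∧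
      PowerSeries.rescale (-1) z = z ∧
      PowerSeries.X ^ (e * m) * N.eval₂ PowerSeries.C z = D.eval₂ PowerSeries.C z := by
  obtain ⟨w, hw0, hw⟩ := exists_branch he0 hm hN ha
  refine ⟨PowerSeries.C r + PowerSeries.X ^ e * w, by simp [he0], ?_, ?_, X_pow_mul_eval_eq hD hw⟩
  · rw [map_add, PowerSeries.coeff_C, if_neg he0, zero_add]
    simpa [hw0] using PowerSeries.coeff_X_pow_mul w e 0
  · have hz : PowerSeries.rescale (-1) (PowerSeries.C r + PowerSeries.X ^ e * w) =
        PowerSeries.C r + PowerSeries.X ^ e * PowerSeries.rescale (-1) w := by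
      simp [rescale_C, he.neg_pow]
    have hcomp : (PowerSeries.rescale (-1 : F)).comp PowerSeries.C = PowerSeries.C :=
      RingHom.ext (rescale_C _)
    have hw' : (branchPoly N E r m e).eval (PowerSeries.rescale (-1) w) = 0 := by
      rw [eval_branchPoly] at hw ⊢
      simpa [hom_eval₂, hcomp, hz] using congrArg (PowerSeries.rescale (-1 : F)) hw
    rw [hz, eq_of_eval_eq_zero (by rw [hw0]; exact
      eval_derivative_map_branchPoly_ne_zero he0 hm hN ha) hw hw' (by
        rw [← PowerSeries.coeff_zero_eq_constantCoeff_apply, PowerSeries.coeff_rescale]; simp)]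

lemma exists_rescale_ne_self [CharZero F] (hm : (m : F) ≠ 0) (hN : N.eval r ≠ 0)
    {D : F[X]} (hD : D = (X - C r) ^ m * E) (ha : a ^ m * E.eval r = N.eval r) :
    ∃ z, PowerSeries.rescale (-1) z ≠ z ∧
      PowerSeries.X ^ m * N.eval₂ PowerSeries.C z = D.eval₂ PowerSeries.C z := by
  obtain ⟨w, hw0, hw⟩ := exists_branch one_ne_zero hm hN ha
  have h := X_pow_mul_eval_eq hD hw
  rw [one_mul] at h
  refine ⟨_, fun hz => hN ?_, h⟩
  have h1 := congrArg (PowerSeries.coeff 1) hz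
  have ha0 : a = 0 := by
    simpa [PowerSeries.coeff_rescale, PowerSeries.coeff_C, PowerSeries.coeff_succ_X_mul 0, hw0,
      neg_eq_self] using h1
  rw [← ha, ha0, zero_pow (by rintro rfl; simp at hm), zero_mul]

end Hensel

section Inertia

variable {F : Type*} [Field F]

lemma exists_finset_pow_eq [IsAlgClosed F] [CharZero F] {n : ℕ} (hn : n ≠ 0) {c : F} (hc : c ≠ 0) :
    ∃ S : Finset F, S.card = n ∧ ∀ a ∈ S, a ^ n = c := by
  classical
  refine ⟨(X ^ n - C c : F[X]).roots.toFinset, ?_, fun a ha => ?_⟩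
  · rw [Multiset.toFinset_card_of_nodup
      (nodup_roots (separable_X_pow_sub_C c (by exact_mod_cast hn) hc)),
      ← (IsAlgClosed.splits _).natDegree_eq_card_roots, natDegree_X_pow_sub_C]
  · have := isRoot_of_mem_roots (Multiset.mem_toFinset.1 ha)
    simpa [sub_eq_zero] using this

/-- The power series `z` is a point of the cover with parameter `X ^ (-8)`. -/
def IsBranch (δ : F) (z : PowerSeries F) : Prop :=
  PowerSeries.X ^ 8 * numer Int.cast (PowerSeries.C δ) z = denom Int.cast (PowerSeries.C δ) z

lemma isBranch_iff {δ : F} {z : PowerSeries F} : IsBranch δ z ↔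
    PowerSeries.X ^ 8 * (numer Int.cast (C δ) X).eval₂ PowerSeries.C z =
      (denom Int.cast (C δ) X).eval₂ PowerSeries.C z := by
  rw [← coe_eval₂RingHom, map_numer, map_denom]
  simp [IsBranch]

/-- The automorphism `X ↦ -X` of the fraction field of the ring of power series. -/
noncomputable def negAut (F : Type*) [Field F] :
    FractionRing (PowerSeries F) ≃+* FractionRing (PowerSeries F) :=
  IsFractionRing.ringEquivOfRingEquiv <| RingEquiv.ofRingHom (PowerSeries.rescale (-1 : F))
    (PowerSeries.rescale (-1)) (by rw [← PowerSeries.rescale_mul]; simp)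
    (by rw [← PowerSeries.rescale_mul]; simp)

lemma negAut_algebraMap (z : PowerSeries F) :
    negAut F (algebraMap _ _ z) = algebraMap _ _ (PowerSeries.rescale (-1) z) :=
  IsFractionRing.ringEquivOfRingEquiv_algebraMap _ z

variable [IsAlgClosed F] [CharZero F] {δ : F}

lemma exists_finset_isBranch (hδ : IsRegular δ) {r : F} {E : F[X]}
    (hE : denom Int.cast (C δ) X = (X - C r) ^ 4 * E) (hr : E.eval r ≠ 0) :
    ∃ S : Finset (PowerSeries F), S.card = 4 ∧ ∀ z ∈ S, PowerSeries.constantCoeff z = r ∧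
      PowerSeries.rescale (-1) z = z ∧ IsBranch δ z := by
  classical
  have hN : (numer Int.cast (C δ) X).eval r ≠ 0 := by
    rw [eval_numer]
    refine numer_ne_zero_of_denom_eq_zero hδ ?_
    rw [← eval_denom, hE]
    simp
  obtain ⟨S, hS, hSc⟩ := exists_finset_pow_eq four_ne_zero (div_ne_zero hN hr)
  have h : ∀ a ∈ S, ∃ z, PowerSeries.constantCoeff z = r ∧ PowerSeries.coeff 2 z = a ∧
      PowerSeries.rescale (-1) z = z ∧ IsBranch δ z := by
    intro a ha
    obtain ⟨z, hz0, hz2, hz, hb⟩ := exists_rescale_eq_self even_two two_ne_zero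
      (by norm_num) hN hE (by rw [hSc a ha, div_mul_cancel₀ _ hr])
    exact ⟨z, hz0, hz2, hz, isBranch_iff.2 hb⟩
  choose! z hz0 hz2 hz hb using h
  refine ⟨S.image z, ?_, ?_⟩
  · rw [Finset.card_image_of_injOn fun a ha b hb hab => ?_, hS]
    rw [← hz2 a ha, ← hz2 b hb, hab]
  · intro w hw
    obtain ⟨a, ha, rfl⟩ := Finset.mem_image.1 hw
    exact ⟨hz0 a ha, hz a ha, hb a ha⟩

lemma exists_fixed_branches (hδ : IsRegular δ) : ∃ S : Finset (PowerSeries F), S.card = 8 ∧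
    ∀ z ∈ S, PowerSeries.rescale (-1) z = z ∧ IsBranch δ z := by
  classical
  obtain ⟨r, s, hrs, ⟨E, hE, hEr⟩, E', hE', hEs⟩ := hδ.exists_poles.1
  obtain ⟨S, hS, hSz⟩ := exists_finset_isBranch hδ hE hEr
  obtain ⟨S', hS', hSz'⟩ := exists_finset_isBranch hδ hE' hEs
  refine ⟨S ∪ S', ?_, fun z hz => ?_⟩
  · rw [Finset.card_union_of_disjoint, hS, hS']
    exact Finset.disjoint_left.2 fun z hz hz' => hrs ((hSz z hz).1.symm.trans (hSz' z hz').1)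
  · rcases Finset.mem_union.1 hz with hz | hz
    exacts [(hSz z hz).2, (hSz' z hz).2]

lemma exists_moved_branch (hδ : IsRegular δ) :
    ∃ z : PowerSeries F, PowerSeries.rescale (-1) z ≠ z ∧ IsBranch δ z := by
  obtain ⟨r, E, hE, hEr⟩ := hδ.exists_poles.2
  have hN : (numer Int.cast (C δ) X).eval r ≠ 0 := by
    rw [eval_numer]
    refine numer_ne_zero_of_denom_eq_zero hδ ?_
    rw [← eval_denom, hE]
    simp
  obtain ⟨a, ha⟩ := IsAlgClosed.exists_pow_nat_eq
    ((numer Int.cast (C δ) X).eval r / E.eval r) (n := 8) (by norm_num)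
  obtain ⟨z, hz, hb⟩ := exists_rescale_ne_self (by norm_num) hN hE
    (by rw [ha, div_mul_cancel₀ _ hEr])
  exact ⟨z, hz, isBranch_iff.2 hb⟩

lemma mem_dilatransvections_of_card_fixed {g : Vec ≃ₗ[ZMod 2] Vec} {S : Finset Vec}
    (hS : 8 < S.card) (hg : ∀ v ∈ S, g v = v) :
    g ∈ LinearEquiv.dilatransvections (ZMod 2) Vec := by
  let W := g.fixedSubmodule
  have h1 : (S : Set Vec) ⊆ W := fun v hv => by
    simpa [W] using hg v hv
  have h2 : 8 < 2 ^ Module.finrank (ZMod 2) W := by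
    have := Set.ncard_le_ncard h1 (Set.toFinite _)
    rw [Set.ncard_coe_finset] at this
    have hc : Nat.card W = 2 ^ Module.finrank (ZMod 2) W := by
      rw [Module.natCard_eq_pow_finrank (K := ZMod 2), Nat.card_zmod]
    rw [← hc]
    exact hS.trans_le this
  have h3 : 3 < Module.finrank (ZMod 2) W :=
    (Nat.pow_lt_pow_iff_right one_lt_two).1 (show 2 ^ 3 < _ from h2)
  have h4 := W.finrank_quotient_add_finrank
  rw [Module.finrank_fin_fun] at h4
  rw [LinearEquiv.mem_dilatransvections_iff_finrank_quotient]
  change Module.finrank (ZMod 2) (Vec ⧸ W) ≤ 1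
  omega

lemma exists_algEquiv_lift {K L k : Type*} [Field K] [Field L] [Field k] [Algebra K L]
    [Algebra K k] [Normal K k] (τ : L ≃ₐ[K] L) :
    ∃ (σ : k ≃ₐ[K] k) (j : k →ₐ[K] AlgebraicClosure L), ∀ a z,
      j a = algebraMap L (AlgebraicClosure L) z →
        j (σ a) = algebraMap L (AlgebraicClosure L) (τ z) := by
  let Ω := AlgebraicClosure L
  let e : Ω ≃+* Ω := IsAlgClosure.equivOfEquiv Ω Ω (τ : L ≃+* L)
  have he : ∀ z : L, e (algebraMap L Ω z) = algebraMap L Ω (τ z) := fun z =>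
    IsAlgClosure.equivOfEquiv_algebraMap Ω Ω (τ : L ≃+* L) z
  let e' : Ω ≃ₐ[K] Ω := AlgEquiv.ofRingEquiv (f := e) fun a => by
    rw [IsScalarTower.algebraMap_apply K L Ω, he, τ.commutes]
  let j : k →ₐ[K] Ω := IsAlgClosed.lift
  let _ : Algebra k Ω := j.toRingHom.toAlgebra
  have : IsScalarTower K k Ω := IsScalarTower.of_algebraMap_eq fun a => (j.commutes a).symm
  refine ⟨e'.restrictNormal k, j, fun a z haz => ?_⟩
  rw [← he, ← haz]
  exact e'.restrictNormal_commutes k a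

/-- If the base field embeds into the field of Laurent series in such a way that `T` goes to
`X ^ (-8)`, then the Galois group contains a transvection. -/
theorem IsLabelling.exists_mem_dilatransvections {K k : Type*} [Field K] [Field k] [Algebra K k]
    [Normal K k] [Algebra K (FractionRing (PowerSeries F))] {γ T : K} {x y : NzVec → k}
    (h : IsLabelling (algebraMap K k γ) (algebraMap K k T) x y)
    (hlead : γ ^ 16 * (γ ^ 2 - 1) ^ 6 ≠ 0) (hx : Function.Injective x)
    {ρ : (k ≃ₐ[K] k) →* (Vec ≃ₗ[ZMod 2] Vec)}
    (hρ : ∀ (σ : k ≃ₐ[K] k) (v : NzVec), σ (x v) = x (v.map (ρ σ)))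
    (hδ : IsRegular δ)
    (hγ : algebraMap K (FractionRing (PowerSeries F)) γ =
      algebraMap (PowerSeries F) (FractionRing (PowerSeries F)) (PowerSeries.C δ))
    (hT : algebraMap K (FractionRing (PowerSeries F)) T *
      algebraMap (PowerSeries F) (FractionRing (PowerSeries F)) PowerSeries.X ^ 8 = 1)
    (hfix : ∀ a : K, negAut F (algebraMap K _ a) = algebraMap K _ a) :
    ∃ σ, ρ σ ≠ 1 ∧ ρ σ ∈ LinearEquiv.dilatransvections (ZMod 2) Vec := by
  classical
  let L := FractionRing (PowerSeries F)
  let i : PowerSeries F →+* AlgebraicClosure L :=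
    (algebraMap L (AlgebraicClosure L)).comp (algebraMap (PowerSeries F) L)
  have hi : Function.Injective i :=
    (algebraMap L (AlgebraicClosure L)).injective.comp (IsFractionRing.injective _ L)
  obtain ⟨σ, j, hσ⟩ := exists_algEquiv_lift (k := k) (AlgEquiv.ofRingEquiv (f := negAut F) hfix)
  have hσ' : ∀ a z, j a = i z → j (σ a) = i (PowerSeries.rescale (-1) z) := fun a z haz => by
    rw [hσ a _ haz]
    exact congrArg _ (negAut_algebraMap z)
  have hroot : ∀ z, IsBranch δ z → ∃ v, j (x v) = i z := by
    intro z hz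
    have hjγ : j (algebraMap K k γ) = i (PowerSeries.C δ) := by
      rw [j.commutes, IsScalarTower.algebraMap_apply K L, hγ]
      rfl
    have hjT : j (algebraMap K k T) * i PowerSeries.X ^ 8 = 1 := by
      rw [j.commutes, IsScalarTower.algebraMap_apply K L]
      have := congrArg (algebraMap L (AlgebraicClosure L)) hT
      rwa [map_mul, map_pow, map_one] at this
    have hz' := congrArg i hz
    rw [map_mul, map_pow, map_numer, map_denom, ← hjγ] at hz'
    have hcover := congrArg (fun p => (p.map (j : k →+* _)).eval (i z)) h.cover
    simp only [map_coverPoly, eval_coverPoly, Polynomial.map_mul, Polynomial.map_prod, map_C,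
      Polynomial.map_sub, map_X, eval_mul, eval_C, eval_prod, eval_sub, eval_X,
      AlgHom.coe_toRingHom] at hcover
    have h0 : numer Int.cast (j (algebraMap K k γ)) (i z) -
        j (algebraMap K k T) * denom Int.cast (j (algebraMap K k γ)) (i z) = 0 := by
      rw [← hz', ← mul_assoc, hjT, one_mul, sub_self]
    rw [h0] at hcover
    have hlead' : j (algebraMap K k γ ^ 16 * (algebraMap K k γ ^ 2 - 1) ^ 6) ≠ 0 := by
      refine fun h0 => (map_ne_zero (algebraMap K k)).2 hlead ?_
      simpa using j.injective (h0.trans (map_zero j).symm)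
    obtain ⟨v, -, hv⟩ := Finset.prod_eq_zero_iff.1
      ((mul_eq_zero.1 hcover.symm).resolve_left hlead')
    exact ⟨v, (sub_eq_zero.1 hv).symm⟩
  have hmap : ∀ z v, j (x v) = i z → j (x (v.map (ρ σ))) = i (PowerSeries.rescale (-1) z) :=
    fun z v hv => by rw [← hρ, hσ' _ _ hv]
  refine ⟨σ, fun h1 => ?_, ?_⟩
  · obtain ⟨z, hz, hb⟩ := exists_moved_branch hδ
    obtain ⟨v, hv⟩ := hroot z hb
    have h2 := hmap z v hv
    rw [h1, show v.map 1 = v from rfl, hv] at h2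
    exact hz (hi h2).symm
  · obtain ⟨S, hS, hSz⟩ := exists_fixed_branches hδ
    have : Nonempty NzVec := Fintype.card_pos_iff.1 (by rw [card_nzVec]; norm_num)
    choose! v hv using hroot
    refine mem_dilatransvections_of_card_fixed (S := insert 0 (S.image fun z => (v z).1)) ?_ ?_
    · rw [Finset.card_insert_of_notMem, Finset.card_image_of_injOn, hS]
      · norm_num
      · intro z hz z' hz' hzz'
        refine hi ?_
        rw [← hv z (hSz z hz).2, ← hv z' (hSz z' hz').2, Subtype.ext hzz']
      · intro h0
        obtain ⟨z, -, hz⟩ := Finset.mem_image.1 h0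
        exact (v z).2 hz
    · intro u hu
      rcases Finset.mem_insert.1 hu with rfl | hu
      · exact map_zero _
      · obtain ⟨z, hz, rfl⟩ := Finset.mem_image.1 hu
        have h2 := hmap z _ (hv z (hSz z hz).2)
        rw [(hSz z hz).1, ← hv z (hSz z hz).2] at h2
        exact congrArg Subtype.val (hx (j.injective h2))

end Inertia

section Link

variable {F : Type*} [Field F] {γ : F}

lemma eval_f0 [CharZero F] (hγ : IsRegular γ) (z : F) : γ ^ 5 * (γ ^ 2 - 1) ^ 2 *
    (f0 (3 * γ - 1)).eval (3 * γ * z) =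
      (3 * γ) ^ 10 * (eval2 Int.cast hList γ z * eval2 Int.cast kList γ z) := by
  have h0 := hγ.ne_zero
  have h1 := hγ.sub_one_ne_zero
  have h2 := hγ.add_one_ne_zero
  have e1 : 3 * γ - 1 - 2 = 3 * (γ - 1) := by ring
  have e2 : 3 * γ - 1 + 1 = 3 * γ := by ring
  have e3 : 3 * γ - 1 + 4 = 3 * (γ + 1) := by ring
  simp only [f0, a1, a2, a3, a4, a5, a6, a7, a8, a9, a10, e1, e2, e3, eval_add, eval_mul, eval_pow,
    eval_X, eval_C]
  simp [hList, kList, eval2, horner]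
  field_simp
  ring

lemma eval_g0 (z : F) :
    (g0 (3 * γ - 1)).eval (3 * γ * z) = 9 * γ * eval2 Int.cast qList γ z := by
  simp [g0, a11, qList, eval2, horner]
  ring

lemma eval_g1 (hγ : IsRegular γ) (z : F) : (γ ^ 2 - 1) * (g1 (3 * γ - 1)).eval (3 * γ * z) =
    27 * γ ^ 3 * eval2 Int.cast cList γ z := by
  have h1 := hγ.sub_one_ne_zero
  have h2 := hγ.add_one_ne_zero
  have e1 : 3 * γ - 1 - 2 = 3 * (γ - 1) := by ring
  have e2 : 3 * γ - 1 + 1 = 3 * γ := by ring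
  have e3 : 3 * γ - 1 + 4 = 3 * (γ + 1) := by ring
  simp only [g1, a12, a13, a14, e1, e2, e3, eval_add, eval_mul, eval_pow, eval_X, eval_C]
  simp [cList, eval2, horner]
  field_simp
  ring

/-- The change of variables that turns `fFamily` into `coverPoly`. -/
theorem fFamily_comp [CharZero F] (hγ : IsRegular γ) (t : F) :
    C ((γ ^ 2 - 1) ^ 6) * (fFamily (3 * γ - 1) t).comp (C (3 * γ) * X) =
      C (3 ^ 31 * γ ^ 15) * coverPoly γ (γ ^ 6 * (γ ^ 2 - 1) ^ 2 / 9 * t) := by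
  refine Polynomial.funext fun z => ?_
  have h0 := hγ.ne_zero
  have hf := congrArg (· ^ 3) (eval_f0 hγ z)
  have hg := congrArg (· ^ 4) (eval_g1 hγ z)
  simp only [fFamily, eval_mul, eval_C, eval_comp, eval_X, eval_sub, eval_pow, eval_ofNat,
    eval_coverPoly, eval_g0, numer, denom]
  have hl : eval2 Int.cast lList γ z = γ * z - 1 := by
    simp [lList, eval2, horner]
    ring
  rw [hl]
  refine mul_left_cancel₀ (pow_ne_zero 15 h0) ?_
  linear_combination (3 * γ * z - 3) * hf -
    γ ^ 15 * (γ ^ 2 - 1) ^ 2 * t * (9 * γ * eval2 Int.cast qList γ z) ^ 8 * (3 * γ * z) * hg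

end Link

section LaurentEmbedding

variable {F : Type*} [Field F]

lemma transcendental_fractionRing_X : Transcendental F
    (algebraMap (PowerSeries F) (FractionRing (PowerSeries F)) PowerSeries.X) := by
  refine transcendental_iff.2 fun p hp => coe_injective F ?_
  rw [aeval_algebraMap_apply, map_eq_zero_iff _ (IsFractionRing.injective _ _), aeval_def] at hp
  rw [coe_zero, ← hp]
  exact (eval₂_C_X_eq_coe (φ := p)).symm

/-- The field of rational functions embeds into the field of Laurent series in such a way that
`s X` goes to `X ^ (-8)`. -/
theorem exists_ratFunc_ringHom {k : Type*} [Field k] (φ : k →+* F) {s : k} (hs : s ≠ 0) :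
    ∃ ψ : RatFunc k →+* FractionRing (PowerSeries F),
      (∀ a, ψ (RatFunc.C a) = algebraMap (PowerSeries F) _ (PowerSeries.C (φ a))) ∧
      ψ (RatFunc.C s * RatFunc.X) * algebraMap (PowerSeries F) _ PowerSeries.X ^ 8 = 1 ∧
      ∀ a, negAut F (ψ a) = ψ a := by
  let L := FractionRing (PowerSeries F)
  let i : PowerSeries F →+* L := algebraMap _ _
  let v : L := i PowerSeries.X
  let w : L := algebraMap F L (φ s)⁻¹ * (v ^ 8)⁻¹
  have hφ : φ s ≠ 0 := (map_ne_zero φ).2 hs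
  have hv : Transcendental F v := transcendental_fractionRing_X
  have hw : Transcendental F w := fun h => hv <| by
    have h1 := ((isAlgebraic_algebraMap (A := L) (φ s)).mul h).inv
    refine IsAlgebraic.of_pow (n := 8) (by norm_num) ?_
    suffices h2 : (algebraMap F L (φ s) * w)⁻¹ = v ^ 8 from h2 ▸ h1
    rw [← mul_assoc, ← map_mul, mul_inv_cancel₀ hφ, map_one, one_mul, inv_inv]
  have hv0 : v ≠ 0 := fun h => hv (h ▸ isAlgebraic_zero)
  let g : k[X] →+* L := (aeval w : F[X] →ₐ[F] L).toRingHom.comp (mapRingHom φ)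
  have hg : Function.Injective g :=
    (transcendental_iff_injective.1 hw).comp (map_injective φ φ.injective)
  have hgC : ∀ a, g (C a) = i (PowerSeries.C (φ a)) := fun a => by
    simp [g, i]
    rfl
  have hgX : g X = w := by simp [g]
  let ψ : RatFunc k →+* L := IsFractionRing.lift hg
  have hψ : ∀ p : k[X], ψ (algebraMap _ _ p) = g p := IsFractionRing.lift_algebraMap hg
  have hψC : ∀ a, ψ (RatFunc.C a) = i (PowerSeries.C (φ a)) := fun a => by
    rw [← RatFunc.algebraMap_C, hψ, hgC]
  have hψX : ψ RatFunc.X = w := by rw [← RatFunc.algebraMap_X, hψ, hgX]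
  have hiC : ∀ a, i (PowerSeries.C a) = algebraMap F L a := fun a => rfl
  refine ⟨ψ, hψC, ?_, fun a => ?_⟩
  · rw [map_mul, hψC, hψX, hiC]
    change algebraMap F L (φ s) * (algebraMap F L (φ s)⁻¹ * (v ^ 8)⁻¹) * v ^ 8 = 1
    rw [← mul_assoc, ← map_mul, mul_inv_cancel₀ hφ, map_one, one_mul,
      inv_mul_cancel₀ (pow_ne_zero 8 hv0)]
  · have hnC : ∀ a, negAut F (i (PowerSeries.C a)) = i (PowerSeries.C a) := fun a => by
      rw [negAut_algebraMap, rescale_C]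
    have hnv : negAut F v = -v := by
      rw [negAut_algebraMap, PowerSeries.rescale_neg_one_X, map_neg]
    have hnw : negAut F w = w := by
      rw [map_mul, ← hiC, hnC, map_inv₀ (negAut F), map_pow, hnv, Even.neg_pow (by decide), hiC]
    suffices h : ((negAut F : L →+* L).comp ψ) = ψ from congrArg (fun e => e a) h
    refine IsLocalization.ringHom_ext (nonZeroDivisors k[X]) (Polynomial.ringHom_ext ?_ ?_)
    · intro b
      simp [hψC, hnC]
    · simp [hψX, hnw]

end LaurentEmbedding

section Main

/-- The special linear group over the field with two elements is the general linear group. -/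
lemma nonempty_mulEquiv_specialLinearGroup (n : ℕ) : Nonempty
    (((Fin n → ZMod 2) ≃ₗ[ZMod 2] (Fin n → ZMod 2)) ≃*
      Matrix.SpecialLinearGroup (Fin n) (ZMod 2)) := by
  refine ⟨(MulEquiv.ofBijective Matrix.SpecialLinearGroup.toLin'
    ⟨Matrix.SpecialLinearGroup.toLin'_injective, fun e => ?_⟩).symm⟩
  have hdet : ∀ a : ZMod 2, a ≠ 0 → a = 1 := by decide
  have he : (LinearMap.toMatrix' e.toLinearMap).det = 1 := hdet _ <| by
    rw [LinearMap.det_toMatrix']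
    exact e.isUnit_det'.ne_zero
  let A : Matrix.SpecialLinearGroup (Fin n) (ZMod 2) := ⟨LinearMap.toMatrix' e.toLinearMap, he⟩
  refine ⟨A, LinearEquiv.toLinearMap_injective ?_⟩
  exact (Matrix.SpecialLinearGroup.toLin'_to_linearMap A).trans (Matrix.toLin'_toMatrix' _)

lemma nonempty_mulEquiv_projectiveSpecialLinearGroup (n : ℕ) : Nonempty
    (((Fin n → ZMod 2) ≃ₗ[ZMod 2] (Fin n → ZMod 2)) ≃*
      Matrix.ProjectiveSpecialLinearGroup (Fin n) (ZMod 2)) := by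
  obtain ⟨e⟩ := nonempty_mulEquiv_specialLinearGroup n
  have hz : Subgroup.center (Matrix.SpecialLinearGroup (Fin n) (ZMod 2)) = ⊥ := by
    have h0 : ∀ r : ZMod 2, r = 0 ∨ r = 1 := by decide
    refine (Subgroup.eq_bot_iff_forall _).2 fun A hA => ?_
    obtain ⟨r, hr, hA⟩ := Matrix.SpecialLinearGroup.mem_center_iff.1 hA
    rcases n with _ | n
    · exact Subsingleton.elim _ _
    rcases h0 r with rfl | rfl
    · simp at hr
    · exact Subtype.ext (by rw [← hA, map_one, Matrix.SpecialLinearGroup.coe_one])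
  exact ⟨(e.trans QuotientGroup.quotientBot.symm).trans
    (QuotientGroup.quotientMulEquivOfEq hz.symm)⟩

variable {F : Type*} [Field F] [CharZero F] {γ s : F}

/-- The monodromy action on the points of the projective space is surjective. -/
theorem IsLabelling.surjective {k : Type*} [Field k] [Algebra (RatFunc F) k] [Normal (RatFunc F) k]
    {x y : NzVec → k} (hγ : IsRegular γ) (hs : s ≠ 0)
    (h : IsLabelling (algebraMap (RatFunc F) k (RatFunc.C γ))
      (algebraMap (RatFunc F) k (RatFunc.C s * RatFunc.X)) x y) (hx : Function.Injective x)
    {ρ : (k ≃ₐ[RatFunc F] k) →* (Vec ≃ₗ[ZMod 2] Vec)}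
    (hρ : ∀ (σ : k ≃ₐ[RatFunc F] k) (v : NzVec), σ (x v) = x (v.map (ρ σ))) :
    Function.Surjective ρ := by
  have hirr := hγ.irreducible_coverPoly hs
  let E := AlgebraicClosure F
  have : CharZero E := charZero_of_injective_algebraMap (algebraMap F E).injective
  obtain ⟨ψ, hψC, hψX, hψ⟩ := exists_ratFunc_ringHom (algebraMap F E) hs
  let _ : Algebra (RatFunc F) (FractionRing (PowerSeries E)) := ψ.toAlgebra
  obtain ⟨σ, hσ1, hσ⟩ := h.exists_mem_dilatransvections (hγ.map RatFunc.C).leadingCoeff_ne_zero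
    hx hρ (hγ.map (algebraMap F E)) (hψC γ) hψX hψ
  refine MonoidHom.range_eq_top.1 (eq_top_of_transitive_of_mem_dilatransvections
    (by rw [Module.finrank_fin_fun]; decide) (by rw [Module.finrank_fin_fun]; norm_num)
    (fun v w hv hw => ?_) (MonoidHom.mem_range.2 ⟨σ, rfl⟩) hσ1 hσ)
  obtain ⟨τ, hτ⟩ := h.exists_apply_eq hirr ⟨v, hv⟩ ⟨w, hw⟩
  refine ⟨ρ τ, ⟨τ, rfl⟩, ?_⟩
  rw [hρ] at hτ
  exact congrArg Subtype.val (hx hτ)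

/-- The Galois group of a polynomial whose roots are multiples of the roots of the cover. -/
theorem nonempty_gal_mulEquiv_of_comp (hγ : IsRegular γ) (hs : s ≠ 0) {p : (RatFunc F)[X]}
    {a u w : RatFunc F} (ha : a ≠ 0) (hu : u ≠ 0) (hw : w ≠ 0)
    (hp : C u * p.comp (C a * X) =
      C w * coverPoly (RatFunc.C γ) (RatFunc.C s * RatFunc.X)) :
    p.natDegree = 31 ∧ Nonempty (p.Gal ≃* (Vec ≃ₗ[ZMod 2] Vec)) := by
  let K := RatFunc F
  let k := AlgebraicClosure K
  have hγ' := hγ.map RatFunc.C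
  have hirr := hγ.irreducible_coverPoly hs
  have hdeg : p.natDegree = 31 := by
    have h := congrArg natDegree hp
    rwa [natDegree_C_mul hu, natDegree_C_mul hw, natDegree_comp, natDegree_C_mul_X _ ha, mul_one,
      natDegree_coverPoly hγ'.leadingCoeff_ne_zero] at h
  have hp0 : p ≠ 0 := by
    rintro rfl
    simp at hdeg
  refine ⟨hdeg, ?_⟩
  have hγk := hγ'.map (algebraMap K k)
  obtain ⟨x, y, h⟩ := exists_isLabelling (algebraMap K k (RatFunc.C γ))
    (algebraMap K k (RatFunc.C s * RatFunc.X)) hγk.leadingCoeff_ne_zero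
    hγk.leadingCoeff_dual_ne_zero
  have hx : Function.Injective x := h.injective <| by
    rw [← map_coverPoly]
    exact hirr.separable.map
  obtain ⟨ρ, hρ⟩ := h.exists_monoidHom hγ' hirr
  have : Fact ((p.map (algebraMap K k)).Splits) := ⟨IsAlgClosed.splits _⟩
  refine nonempty_gal_mulEquiv hx hρ (h.surjective hγ hs hx hρ) p fun σ => ?_
  have ha' : algebraMap K k a ≠ 0 := (_root_.map_ne_zero _).2 ha
  have hroot : ∀ z : k, algebraMap K k a * z ∈ p.rootSet k ↔
      (coverPoly (algebraMap K k (RatFunc.C γ))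
        (algebraMap K k (RatFunc.C s * RatFunc.X))).eval z = 0 := fun z => by
    have h1 := congrArg (aeval z) hp
    rw [map_mul, map_mul, aeval_comp, map_mul, aeval_C, aeval_C, aeval_C, aeval_X,
      aeval_def z (coverPoly _ _), ← eval_map, map_coverPoly] at h1
    rw [mem_rootSet_of_ne hp0, ← mul_eq_zero_iff_left ((map_ne_zero (algebraMap K k)).2 hu), h1,
      mul_eq_zero_iff_left ((map_ne_zero (algebraMap K k)).2 hw)]
  constructor
  · intro hr v
    have h1 := hr _ ((hroot (x v)).2 (h.eval_cover v))
    rw [map_mul, σ.commutes] at h1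
    exact mul_left_cancel₀ ha' h1
  · intro hv r hr
    obtain ⟨z, rfl⟩ : ∃ z, algebraMap K k a * z = r := ⟨_, mul_div_cancel₀ r ha'⟩
    obtain ⟨v, rfl⟩ := h.exists_eq_of_eval_cover hγk.leadingCoeff_ne_zero ((hroot z).1 hr)
    rw [map_mul, σ.commutes, hv]

end Main

/-- For every rational `c ∉ {−4, −1, 2}`, the specialized polynomial
`f(x, c, t)` has degree 31 in `x` and its Galois group over `ℚ(t)` is isomorphic to
`PSL₅(𝔽₂)`, the projective special linear group of degree 5 over the field with two
elements. -/
theorem galoisGroup_fFamily_specialized_eq_PSL52 (c : ℚ) (hc : c ∉ ({-4, -1, 2} : Set ℚ)) :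
    (fFamily (RatFunc.C c : RatFunc ℚ) RatFunc.X).natDegree = 31 ∧
    Nonempty ((fFamily (RatFunc.C c : RatFunc ℚ) RatFunc.X).Gal ≃*
      Matrix.ProjectiveSpecialLinearGroup (Fin 5) (ZMod 2)) := by
  simp only [Set.mem_insert_iff, Set.mem_singleton_iff, not_or] at hc
  obtain ⟨h1, h2, h3⟩ := hc
  obtain ⟨γ, rfl⟩ : ∃ γ : ℚ, 3 * γ - 1 = c := ⟨(c + 1) / 3, by ring⟩
  have hγ : IsRegular γ :=
    ⟨fun h => h2 (by linear_combination 3 * h), fun h => h3 (by linear_combination 3 * h),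
      fun h => h1 (by linear_combination 3 * h), by positivity⟩
  have hq : γ ^ 2 - 1 ≠ 0 := by
    rw [show γ ^ 2 - 1 = (γ - 1) * (γ + 1) by ring]
    exact mul_ne_zero hγ.sub_one_ne_zero hγ.add_one_ne_zero
  have hq' : (RatFunc.C γ : RatFunc ℚ) ^ 2 - 1 ≠ 0 := by
    simpa using (map_ne_zero (RatFunc.C : ℚ →+* RatFunc ℚ)).2 hq
  have h0 : (RatFunc.C γ : RatFunc ℚ) ≠ 0 := (_root_.map_ne_zero _).2 hγ.ne_zero
  have hs : γ ^ 6 * (γ ^ 2 - 1) ^ 2 / 9 ≠ 0 :=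
    div_ne_zero (mul_ne_zero (pow_ne_zero _ hγ.ne_zero) (pow_ne_zero _ hq)) (by norm_num)
  have hcomp := fFamily_comp (hγ.map RatFunc.C) (RatFunc.X : RatFunc ℚ)
  rw [show (RatFunc.C γ : RatFunc ℚ) ^ 6 * (RatFunc.C γ ^ 2 - 1) ^ 2 / 9 =
    RatFunc.C (γ ^ 6 * (γ ^ 2 - 1) ^ 2 / 9) by simp] at hcomp
  obtain ⟨hdeg, ⟨e⟩⟩ := nonempty_gal_mulEquiv_of_comp hγ hs (mul_ne_zero three_ne_zero h0)
    (pow_ne_zero _ hq') (mul_ne_zero (pow_ne_zero _ three_ne_zero) (pow_ne_zero _ h0)) hcomp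
  obtain ⟨e'⟩ := nonempty_mulEquiv_projectiveSpecialLinearGroup 5
  rw [show (RatFunc.C (3 * γ - 1) : RatFunc ℚ) = 3 * RatFunc.C γ - 1 by simp]
  exact ⟨hdeg, ⟨e.trans e'⟩⟩

end PSL52Family
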